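/- Sharp Jackson and sharp inverse inequalities: let f ∈ L_p^0(T²), 1<p<∞, σ=max(2,p), θ=min(2,p), α₁,α₂>0, n₁,n₂ ∈ ℕ. Then n₁^{−α₁} n₂^{−α₂} {Σ_{ν₁=1}^{n₁+1} Σ_{ν₂=1}^{n₂+1} ν₁^{α₁σ−1} ν₂^{α₂σ−1} Y_{ν₁−1,ν₂−1}(f)_p^σ}^{1/σ} ≲ ω_{α₁,α₂}(f, 1/n₁, 1/n₂)_p ≲ n₁^{−α₁} n₂^{−α₂} {Σ_{ν₁=1}^{n₁+1} Σ_{ν₂=1}^{n₂+1} ν₁^{α₁θ−1} ν₂^{α₂θ−1} Y_{ν₁−1,ν₂−1}(f)_p^θ}^{1/θ}. -/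

import Mathlib

open MeasureTheory Real
open scoped ENNReal

noncomputable section

/-- The `L_p` norm of a function of two variables over the period square `(0,2π]²`. -/
def Lp2Norm (p : ℝ) (f : ℝ → ℝ → ℝ) : ℝ≥0∞ :=
  (∫⁻ x in Set.Ioc (0:ℝ) (2*π), ∫⁻ y in Set.Ioc (0:ℝ) (2*π),
      ENNReal.ofReal (|f x y| ^ p)) ^ (1/p)

/-- `f ∈ L_p^0(T²)`: measurable, `2π`-periodic in each variable, finite `L_p` norm,
and zero mean in each variable separately. -/
structure MemLp0 (p : ℝ) (f : ℝ → ℝ → ℝ) : Prop where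
  meas : Measurable (Function.uncurry f)
  periodic_x : ∀ y, Function.Periodic (fun x => f x y) (2*π)
  periodic_y : ∀ x, Function.Periodic (f x) (2*π)
  norm_ne_top : Lp2Norm p f ≠ ⊤
  mean_x : ∀ᵐ (y : ℝ) ∂volume, (∫ x in (0:ℝ)..(2*π), f x y) = 0
  mean_y : ∀ᵐ (x : ℝ) ∂volume, (∫ y in (0:ℝ)..(2*π), f x y) = 0

/-- Generalized (fractional) binomial coefficient `C(α,ν) = α(α-1)⋯(α-ν+1)/ν!`. -/
def fracBinom (α : ℝ) : ℕ → ℝ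
  | 0 => 1
  | n+1 => fracBinom α n * (α - (n : ℝ)) / ((n : ℝ) + 1)

/-- Fractional difference of order `α` with step `h` in the first variable. -/
def diffX (α h : ℝ) (f : ℝ → ℝ → ℝ) : ℝ → ℝ → ℝ :=
  fun x y => ∑' ν : ℕ, (-1 : ℝ) ^ ν * fracBinom α ν * f (x + (α - (ν : ℝ)) * h) y

/-- Fractional difference of order `α` with step `h` in the second variable. -/
def diffY (α h : ℝ) (f : ℝ → ℝ → ℝ) : ℝ → ℝ → ℝ :=
  fun x y => ∑' ν : ℕ, (-1 : ℝ) ^ ν * fracBinom α ν * f x (y + (α - (ν : ℝ)) * h)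

/-- The mixed (fractional) modulus of smoothness `ω_{α₁,α₂}(f, δ₁, δ₂)_p`. -/
def mixedMod (p α₁ α₂ δ₁ δ₂ : ℝ) (f : ℝ → ℝ → ℝ) : ℝ≥0∞ :=
  ⨆ (h₁ : ℝ) (_ : |h₁| ≤ δ₁) (h₂ : ℝ) (_ : |h₂| ≤ δ₂),
    Lp2Norm p (diffX α₁ h₁ (diffY α₂ h₂ f))

/-- `T` is (an `L_p(T²)` function which is) a trigonometric polynomial of degree
at most `m` in the first variable. -/
def TrigPolyX (p : ℝ) (m : ℕ) (T : ℝ → ℝ → ℝ) : Prop :=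
  Measurable (Function.uncurry T) ∧ Lp2Norm p T ≠ ⊤ ∧
  (∀ x, Function.Periodic (T x) (2*π)) ∧
  ∃ a b : ℕ → ℝ → ℝ, ∀ x y,
    T x y = ∑ k ∈ Finset.range (m+1),
      (a k y * Real.cos ((k : ℝ) * x) + b k y * Real.sin ((k : ℝ) * x))

/-- `T` is (an `L_p(T²)` function which is) a trigonometric polynomial of degree
at most `m` in the second variable. -/
def TrigPolyY (p : ℝ) (m : ℕ) (T : ℝ → ℝ → ℝ) : Prop :=
  Measurable (Function.uncurry T) ∧ Lp2Norm p T ≠ ⊤ ∧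
  (∀ y, Function.Periodic (fun x => T x y) (2*π)) ∧
  ∃ a b : ℕ → ℝ → ℝ, ∀ x y,
    T x y = ∑ k ∈ Finset.range (m+1),
      (a k x * Real.cos ((k : ℝ) * y) + b k x * Real.sin ((k : ℝ) * y))

/-- The best angular approximation `Y_{m₁,m₂}(f)_p`. -/
def Yapprox (p : ℝ) (m₁ m₂ : ℕ) (f : ℝ → ℝ → ℝ) : ℝ≥0∞ :=
  ⨅ (T₁ : ℝ → ℝ → ℝ) (_ : TrigPolyX p m₁ T₁) (T₂ : ℝ → ℝ → ℝ) (_ : TrigPolyY p m₂ T₂),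
    Lp2Norm p (fun x y => f x y - T₁ x y - T₂ x y)

/-- The weighted sum of angular approximations
`n₁^{-α₁} n₂^{-α₂} {Σ_{ν₁=1}^{n₁+1} Σ_{ν₂=1}^{n₂+1} ν₁^{α₁s-1} ν₂^{α₂s-1} Y_{ν₁-1,ν₂-1}(f)_p^s}^{1/s}`. -/
def Ysum (p α₁ α₂ s : ℝ) (n₁ n₂ : ℕ) (f : ℝ → ℝ → ℝ) : ℝ≥0∞ :=
  ENNReal.ofReal ((n₁:ℝ) ^ (-α₁) * (n₂:ℝ) ^ (-α₂)) *
    (∑ ν₁ ∈ Finset.Icc 1 (n₁+1), ∑ ν₂ ∈ Finset.Icc 1 (n₂+1),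
      ENNReal.ofReal ((ν₁:ℝ) ^ (α₁*s-1) * (ν₂:ℝ) ^ (α₂*s-1)) *
        Yapprox p (ν₁-1) (ν₂-1) f ^ s) ^ (1/s)

section Flow

variable {X Y : Type*} [NormedAddCommGroup X] [NormedSpace ℝ X]
  [NormedAddCommGroup Y] [NormedSpace ℝ Y]

theorem exists_bound_of_strongly_continuous [CompleteSpace X] (a b : ℝ) (T : ℝ → X →L[ℝ] X)
    (hT : ∀ x, Continuous fun t => T t x) : ∃ C, ∀ t ∈ Set.uIcc a b, ‖T t‖ ≤ C := by
  obtain ⟨C, hC⟩ := banach_steinhaus (g := fun t : Set.uIcc a b => T t) (fun x => by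
    obtain ⟨C, hC⟩ := (isCompact_uIcc (a := a) (b := b)).exists_bound_of_continuousOn
      (hT x).continuousOn
    exact ⟨C, fun t => hC t t.2⟩)
  exact ⟨C, fun t ht => hC ⟨t, ht⟩⟩

/-- The integral over `[a, b]` of a strongly continuous family of operators. -/
def strongIntegral [CompleteSpace X] (a b : ℝ) (T : ℝ → X →L[ℝ] X)
    (hT : ∀ x, Continuous fun t => T t x) : X →L[ℝ] X :=
  LinearMap.mkContinuousOfExistsBound
    { toFun := fun x => ∫ t in a..b, T t x
      map_add' := fun x y => by
        simp only [map_add]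
        exact intervalIntegral.integral_add ((hT x).intervalIntegrable _ _)
          ((hT y).intervalIntegrable _ _)
      map_smul' := fun c x => by
        simp only [map_smul, RingHom.id_apply]
        exact intervalIntegral.integral_smul _ _ }
    (by
      obtain ⟨C, hC⟩ := exists_bound_of_strongly_continuous a b T hT
      refine ⟨C * |b - a|, fun x => ?_⟩
      have := intervalIntegral.norm_integral_le_of_norm_le_const (a := a) (b := b)
        (f := fun t => T t x) (C := C * ‖x‖) (fun t ht =>
          (T t).le_of_opNorm_le (hC t (Set.uIoc_subset_uIcc ht)) x)
      calc _ ≤ C * ‖x‖ * |b - a| := this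
        _ = _ := by ring)

theorem strongIntegral_apply [CompleteSpace X] (a b : ℝ) (T : ℝ → X →L[ℝ] X)
    (hT : ∀ x, Continuous fun t => T t x) (x : X) :
    strongIntegral a b T hT x = ∫ t in a..b, T t x := rfl

theorem map_strongIntegral [CompleteSpace X] [CompleteSpace Y] (a b : ℝ) (T : ℝ → X →L[ℝ] X)
    (hT : ∀ x, Continuous fun t => T t x) (B : X →L[ℝ] Y) (x : X) :
    B (strongIntegral a b T hT x) = ∫ t in a..b, B (T t x) :=
  (B.intervalIntegral_comp_comm ((hT x).intervalIntegrable _ _)).symm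

/-- A `2π`-periodic strongly continuous one-parameter group of isometries. -/
structure PeriodicFlow (X : Type*) [NormedAddCommGroup X] [NormedSpace ℝ X] where
  τ : ℝ → X →L[ℝ] X
  τ_zero : ∀ x, τ 0 x = x
  τ_add : ∀ s t x, τ (s + t) x = τ s (τ t x)
  norm_τ : ∀ t x, ‖τ t x‖ = ‖x‖
  cont : ∀ x, Continuous fun t => τ t x
  periodic : ∀ t x, τ (t + 2 * π) x = τ t x

namespace PeriodicFlow

variable (R : PeriodicFlow X)

theorem opNorm_τ_le (t : ℝ) : ‖R.τ t‖ ≤ 1 :=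
  ContinuousLinearMap.opNorm_le_bound _ zero_le_one fun x => by rw [R.norm_τ, one_mul]

theorem τ_comm (s t : ℝ) (x : X) : R.τ s (R.τ t x) = R.τ t (R.τ s x) := by
  rw [← R.τ_add, ← R.τ_add, add_comm]

/-- Operators commuting with the flow. -/
def Commutes (B : X →L[ℝ] X) : Prop := ∀ t x, B (R.τ t x) = R.τ t (B x)

variable {R}

theorem Commutes.sub {B B' : X →L[ℝ] X} (h : R.Commutes B) (h' : R.Commutes B') :
    R.Commutes (B - B') := fun t x => by simp [h t x, h' t x]

theorem commutes_τ (s : ℝ) : R.Commutes (R.τ s) := fun t x => R.τ_comm s t x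

variable (R)

theorem continuous_smul_τ (v : C(ℝ, ℝ)) (x : X) : Continuous fun t => v t • R.τ t x :=
  v.continuous.smul (R.cont x)

/-- Trigonometric vectors of degree at most `N` for the flow. -/
def IsTrig (N : ℕ) (x : X) : Prop :=
  ∃ a b : ℕ → X, ∀ t, R.τ t x =
    ∑ k ∈ Finset.range (N + 1), (Real.cos (k * t) • a k + Real.sin (k * t) • b k)

variable [CompleteSpace X]

/-- Convolution with a continuous kernel along the flow. -/
def conv (v : C(ℝ, ℝ)) : X →L[ℝ] X :=
  strongIntegral (-π) π (fun t => v t • R.τ t) fun x => by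
    exact v.continuous.smul (R.cont x)

theorem conv_apply (v : C(ℝ, ℝ)) (x : X) : R.conv v x = ∫ t in (-π)..π, v t • R.τ t x := rfl

theorem conv_sub (v w : C(ℝ, ℝ)) : R.conv (v - w) = R.conv v - R.conv w := by
  ext x
  simp only [_root_.sub_apply, conv_apply, ContinuousMap.sub_apply, sub_smul]
  exact intervalIntegral.integral_sub ((R.continuous_smul_τ v x).intervalIntegrable _ _)
    ((R.continuous_smul_τ w x).intervalIntegrable _ _)

theorem neg_pi_le_pi : -π ≤ π := by linarith [Real.pi_pos]

theorem norm_conv_le (v : C(ℝ, ℝ)) (x : X) :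
    ‖R.conv v x‖ ≤ (∫ t in (-π)..π, |v t|) * ‖x‖ := by
  rw [conv_apply, ← intervalIntegral.integral_mul_const]
  refine (intervalIntegral.norm_integral_le_integral_norm neg_pi_le_pi).trans (le_of_eq ?_)
  simp [norm_smul, R.norm_τ]

variable {R}

theorem Commutes.conv {B : X →L[ℝ] X} (h : R.Commutes B) (v : C(ℝ, ℝ)) (x : X) :
    B (R.conv v x) = R.conv v (B x) := by
  rw [PeriodicFlow.conv, map_strongIntegral, strongIntegral_apply]
  simp [h _ x]

variable (R)

theorem commutes_conv (v : C(ℝ, ℝ)) : R.Commutes (R.conv v) := fun t x =>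
  ((commutes_τ t).conv v x).symm

/-- A functional version of the estimate for kernels of mean zero. -/
theorem abs_map_conv_le (v : C(ℝ, ℝ)) (hv : ∫ t in (-π)..π, v t = 0) (x : X) (φ : X →L[ℝ] Y)
    [CompleteSpace Y] :
    ‖φ (R.conv v x)‖ ≤ ∫ t in (-π)..π, |v t| * ‖φ (R.τ t x) - φ x‖ := by
  have h : φ (R.conv v x) = ∫ t in (-π)..π, v t • (φ (R.τ t x) - φ x) := by
    simp only [smul_sub]
    rw [intervalIntegral.integral_sub, intervalIntegral.integral_smul_const, hv, zero_smul,
      sub_zero, PeriodicFlow.conv, map_strongIntegral]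
    · simp
    · exact (v.continuous.smul (φ.continuous.comp (R.cont x))).intervalIntegrable _ _
    · exact (v.continuous.smul continuous_const).intervalIntegrable _ _
  rw [h]
  refine (intervalIntegral.norm_integral_le_integral_norm neg_pi_le_pi).trans (le_of_eq ?_)
  simp [norm_smul]

theorem norm_sub_conv_le (v : C(ℝ, ℝ)) (hv : ∫ t in (-π)..π, v t = 1) (x : X) :
    ‖x - R.conv v x‖ ≤ ∫ t in (-π)..π, |v t| * ‖R.τ t x - x‖ := by
  have h : R.conv v x - x = ∫ t in (-π)..π, v t • (R.τ t x - x) := by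
    simp only [smul_sub]
    rw [intervalIntegral.integral_sub, intervalIntegral.integral_smul_const, hv, one_smul,
      conv_apply]
    · exact (v.continuous.smul (R.cont x)).intervalIntegrable _ _
    · exact (v.continuous.smul continuous_const).intervalIntegrable _ _
  rw [norm_sub_rev, h]
  refine (intervalIntegral.norm_integral_le_integral_norm neg_pi_le_pi).trans (le_of_eq ?_)
  simp [norm_smul]

theorem τ_conv (v : C(ℝ, ℝ)) (hv : Function.Periodic v (2 * π)) (s : ℝ) (x : X) :
    R.τ s (R.conv v x) = ∫ t in (-π)..π, v (t - s) • R.τ t x := by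
  rw [PeriodicFlow.conv, map_strongIntegral]
  have h1 : ∀ t, R.τ s ((v t • R.τ t) x) = (fun t => v (t - s) • R.τ t x) (t + s) := fun t => by
    simp [add_comm t s, R.τ_add]
  simp_rw [h1]
  rw [intervalIntegral.integral_comp_add_right (fun t => v (t - s) • R.τ t x)]
  have hper : Function.Periodic (fun t => v (t - s) • R.τ t x) (2 * π) := fun t => by
    simp only [R.periodic]
    rw [show t + 2 * π - s = t - s + 2 * π by ring, hv]
  have := hper.intervalIntegral_add_eq (-π + s) (-π)
  rw [show -π + s + 2 * π = π + s by ring, show -π + 2 * π = π by ring] at this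
  exact this

/-- Lipschitz bound along the flow for convolutions with smooth kernels. -/
theorem norm_τ_conv_sub_le (v v' : C(ℝ, ℝ)) (hv : Function.Periodic v (2 * π))
    (hv' : Function.Periodic v' (2 * π)) (hd : ∀ t, HasDerivAt v (v' t) t) {B : ℝ}
    (hB : ∀ t, |v' t| ≤ B) (s : ℝ) (x : X) :
    ‖R.τ s (R.conv v x) - R.conv v x‖ ≤ (∫ t in (-π)..π, |v' t|) * ‖x‖ * |s| := by
  have hder : ∀ s, HasDerivAt (fun s => R.τ s (R.conv v x)) (-(R.τ s (R.conv v' x))) s := by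
    intro s
    have hF : (fun s => R.τ s (R.conv v x)) =
        fun s => ∫ t in (-π)..π, v (t - s) • R.τ t x := by
      funext s
      exact R.τ_conv v hv s x
    rw [hF, R.τ_conv v' hv' s x, ← intervalIntegral.integral_neg]
    refine (intervalIntegral.hasDerivAt_integral_of_dominated_loc_of_deriv_le
      (F := fun s t => v (t - s) • R.τ t x) (F' := fun s t => -(v' (t - s) • R.τ t x))
      (bound := fun _ => B * ‖x‖) (s := Set.univ) Filter.univ_mem ?_ ?_ ?_ ?_ ?_ ?_).2
    · exact Filter.Eventually.of_forall fun s =>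
        (((v.continuous.comp (continuous_id.sub continuous_const)).smul
          (R.cont x)).aestronglyMeasurable)
    · exact ((v.continuous.comp (continuous_id.sub continuous_const)).smul
          (R.cont x)).intervalIntegrable _ _
    · exact ((v'.continuous.comp (continuous_id.sub continuous_const)).smul
          (R.cont x)).neg.aestronglyMeasurable
    · refine Filter.Eventually.of_forall fun t _ s _ => ?_
      rw [norm_neg, norm_smul, R.norm_τ]
      exact mul_le_mul_of_nonneg_right (hB _) (norm_nonneg _)
    · exact intervalIntegrable_const
    · refine Filter.Eventually.of_forall fun t _ s _ => ?_
      have h1 : HasDerivAt (fun s => v (t - s)) (v' (t - s) * (-1)) s :=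
        (hd (t - s)).comp s ((hasDerivAt_id s).const_sub t)
      have h2 := h1.smul_const (R.τ t x)
      simpa using h2
  have := Convex.norm_image_sub_le_of_norm_hasDerivWithin_le (s := Set.univ)
    (f := fun s => R.τ s (R.conv v x)) (C := (∫ t in (-π)..π, |v' t|) * ‖x‖) (x := 0) (y := s)
    (fun s _ => (hder s).hasDerivWithinAt)
    (fun s _ => by
      rw [norm_neg, R.norm_τ]
      exact R.norm_conv_le v' x) convex_univ (Set.mem_univ _) (Set.mem_univ _)
  simpa [R.τ_zero] using this

theorem isTrig_conv (N : ℕ) (v : C(ℝ, ℝ)) (c : ℕ → ℝ)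
    (hv : ∀ t, v t = ∑ k ∈ Finset.range (N + 1), c k * Real.cos (k * t)) (x : X) :
    R.IsTrig N (R.conv v x) := by
  have hper : Function.Periodic v (2 * π) := fun t => by
    simp only [hv]
    refine Finset.sum_congr rfl fun k _ => ?_
    rw [mul_add, Real.cos_add_nat_mul_two_pi]
  refine ⟨fun k => c k • ∫ t in (-π)..π, Real.cos (k * t) • R.τ t x,
    fun k => c k • ∫ t in (-π)..π, Real.sin (k * t) • R.τ t x, fun s => ?_⟩
  have hc : ∀ k : ℕ, IntervalIntegrable (fun t => Real.cos (k * t) • R.τ t x) volume (-π) π :=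
    fun k => (((Real.continuous_cos.comp (continuous_const.mul continuous_id))).smul
      (R.cont x)).intervalIntegrable _ _
  have hs : ∀ k : ℕ, IntervalIntegrable (fun t => Real.sin (k * t) • R.τ t x) volume (-π) π :=
    fun k => (((Real.continuous_sin.comp (continuous_const.mul continuous_id))).smul
      (R.cont x)).intervalIntegrable _ _
  rw [R.τ_conv v hper]
  have h1 : ∀ t, v (t - s) • R.τ t x = ∑ k ∈ Finset.range (N + 1),
      ((c k * Real.cos (k * s)) • (Real.cos (k * t) • R.τ t x) +
        (c k * Real.sin (k * s)) • (Real.sin (k * t) • R.τ t x)) := by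
    intro t
    rw [hv, Finset.sum_smul]
    refine Finset.sum_congr rfl fun k _ => ?_
    rw [mul_sub, Real.cos_sub, smul_smul, smul_smul, ← add_smul]
    congr 1
    ring
  simp_rw [h1]
  rw [intervalIntegral.integral_finsetSum]
  · refine Finset.sum_congr rfl fun k _ => ?_
    rw [intervalIntegral.integral_add (by exact (hc k).smul _) (by exact (hs k).smul _),
      intervalIntegral.integral_smul, intervalIntegral.integral_smul, smul_smul, smul_smul,
      mul_comm (c k), mul_comm (c k)]
  · exact fun k _ => ((hc k).smul _).add ((hs k).smul _)

theorem integral_mul_sin_eq_zero (v : C(ℝ, ℝ)) (heven : ∀ t, v (-t) = v t) (k : ℝ) :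
    ∫ t in (-π)..π, v t * Real.sin (k * t) = 0 := by
  have h := intervalIntegral.integral_comp_neg (a := -π) (b := π)
    (fun t => v t * Real.sin (k * t))
  simp only [heven, mul_neg, Real.sin_neg, intervalIntegral.integral_neg, neg_neg] at h
  linarith

variable {R}

theorem IsTrig.conv_eq_self {N : ℕ} {x : X} (hx : R.IsTrig N x) (v : C(ℝ, ℝ))
    (heven : ∀ t, v (-t) = v t)
    (hv : ∀ k ≤ N, ∫ t in (-π)..π, v t * Real.cos (k * t) = 1) : R.conv v x = x := by
  obtain ⟨a, b, hab⟩ := hx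
  have hc : ∀ k : ℕ, Continuous (fun t => v t * Real.cos (k * t)) := fun k => by fun_prop
  have hs : ∀ k : ℕ, Continuous (fun t => v t * Real.sin (k * t)) := fun k => by fun_prop
  have h0 : x = ∑ k ∈ Finset.range (N + 1), a k := by
    have := hab 0
    simpa [R.τ_zero] using this
  rw [conv_apply]
  have h1 : ∀ t, v t • R.τ t x = ∑ k ∈ Finset.range (N + 1),
      ((v t * Real.cos (k * t)) • a k + (v t * Real.sin (k * t)) • b k) := by
    intro t
    rw [hab, Finset.smul_sum]
    refine Finset.sum_congr rfl fun k _ => ?_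
    rw [smul_add, smul_smul, smul_smul]
  simp_rw [h1]
  rw [intervalIntegral.integral_finsetSum]
  · conv_rhs => rw [h0]
    refine Finset.sum_congr rfl fun k hk => ?_
    rw [intervalIntegral.integral_add, intervalIntegral.integral_smul_const,
      intervalIntegral.integral_smul_const, hv k (by simpa [Nat.lt_succ_iff] using hk),
      integral_mul_sin_eq_zero v heven, one_smul, zero_smul, add_zero]
    · exact ((hc k).smul continuous_const).intervalIntegrable _ _
    · exact ((hs k).smul continuous_const).intervalIntegrable _ _
  · exact fun k _ => (((hc k).smul continuous_const).add
      ((hs k).smul continuous_const)).intervalIntegrable _ _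

end PeriodicFlow
end Flow

section Kernels

/-- Even trigonometric polynomials of degree at most `N`. -/
def IsCosPoly (N : ℕ) (v : ℝ → ℝ) : Prop :=
  ∃ c : ℕ → ℝ, ∀ t, v t = ∑ k ∈ Finset.range (N + 1), c k * Real.cos (k * t)

namespace IsCosPoly

theorem cos_nat {N k : ℕ} (hk : k ≤ N) : IsCosPoly N fun t => Real.cos (k * t) :=
  ⟨fun l => if l = k then 1 else 0, fun t => by simp [Nat.lt_succ_of_le hk]⟩

theorem cos_int {N : ℕ} {k : ℤ} (hk : k.natAbs ≤ N) : IsCosPoly N fun t => Real.cos (k * t) := by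
  convert cos_nat hk using 2 with t
  rcases Int.natAbs_eq k with h | h
  · conv_lhs => rw [h]
    simp
  · conv_lhs => rw [h]
    simp

theorem smul {N : ℕ} {v : ℝ → ℝ} (a : ℝ) (h : IsCosPoly N v) : IsCosPoly N fun t => a * v t := by
  obtain ⟨c, hc⟩ := h
  exact ⟨fun k => a * c k, fun t => by simp [hc, Finset.mul_sum, mul_assoc]⟩

theorem sum {ι : Type*} {N : ℕ} (s : Finset ι) {v : ι → ℝ → ℝ} (h : ∀ i ∈ s, IsCosPoly N (v i)) :
    IsCosPoly N fun t => ∑ i ∈ s, v i t := by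
  choose! c hc using h
  refine ⟨fun k => ∑ i ∈ s, c i k, fun t => ?_⟩
  simp_rw [Finset.sum_mul]
  rw [Finset.sum_comm]
  exact Finset.sum_congr rfl fun i hi => hc i hi t

theorem mul {N M : ℕ} {v w : ℝ → ℝ} (hv : IsCosPoly N v) (hw : IsCosPoly M w) :
    IsCosPoly (N + M) fun t => v t * w t := by
  obtain ⟨c, hc⟩ := hv
  obtain ⟨d, hd⟩ := hw
  have : (fun t => v t * w t) = fun t => ∑ k ∈ Finset.range (N + 1), ∑ l ∈ Finset.range (M + 1),
      (c k * d l / 2) * ∑ e ∈ ({1, -1} : Finset ℤ), Real.cos (((k + e * l : ℤ) : ℝ) * t) := by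
    funext t
    rw [hc, hd, Finset.sum_mul_sum]
    refine Finset.sum_congr rfl fun k _ => Finset.sum_congr rfl fun l _ => ?_
    rw [Finset.sum_pair (by decide)]
    push_cast
    rw [show ((k : ℝ) + 1 * l) * t = k * t + l * t by ring,
      show ((k : ℝ) + -1 * l) * t = k * t - l * t by ring, Real.cos_add, Real.cos_sub]
    ring
  rw [this]
  refine sum _ fun k hk => sum _ fun l hl => smul _ (sum _ fun e he => cos_int ?_)
  simp only [Finset.mem_range] at hk hl
  simp only [Finset.mem_insert, Finset.mem_singleton] at he
  rcases he with rfl | rfl <;> omega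

theorem mono {N M : ℕ} (h : N ≤ M) {v : ℝ → ℝ} (hv : IsCosPoly N v) : IsCosPoly M v := by
  obtain ⟨c, hc⟩ := hv
  have : v = fun t => ∑ k ∈ Finset.range (N + 1), c k * Real.cos (k * t) := funext hc
  rw [this]
  exact sum _ fun k hk => smul _ (cos_nat (by simp at hk; omega))

theorem even {N : ℕ} {v : ℝ → ℝ} (hv : IsCosPoly N v) (t : ℝ) : v (-t) = v t := by
  obtain ⟨c, hc⟩ := hv
  simp [hc]

theorem periodic {N : ℕ} {v : ℝ → ℝ} (hv : IsCosPoly N v) : Function.Periodic v (2 * π) := by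
  obtain ⟨c, hc⟩ := hv
  intro t
  simp only [hc]
  refine Finset.sum_congr rfl fun k _ => ?_
  rw [mul_add, Real.cos_add_nat_mul_two_pi]

end IsCosPoly

theorem integral_cos_int_mul (n : ℤ) :
    ∫ t in (-π)..π, Real.cos (n * t) = if n = 0 then 2 * π else 0 := by
  split_ifs with h
  · simp [h]
    ring
  · have hn : (n : ℝ) ≠ 0 := by exact_mod_cast h
    rw [intervalIntegral.integral_comp_mul_left (fun t => Real.cos t) hn, integral_cos,
      mul_neg, Real.sin_neg, Real.sin_int_mul_pi]
    simp

/-- The Dirichlet kernel. -/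
def dirichletKernel (M : ℕ) (t : ℝ) : ℝ := ∑ k ∈ Finset.Icc (-M : ℤ) M, Real.cos (k * t)

theorem isCosPoly_dirichletKernel (M : ℕ) : IsCosPoly M (dirichletKernel M) :=
  IsCosPoly.sum _ fun k hk => IsCosPoly.cos_int (by simp at hk; omega)

theorem continuous_dirichletKernel (M : ℕ) : Continuous (dirichletKernel M) := by
  unfold dirichletKernel
  fun_prop

theorem abs_dirichletKernel_le (M : ℕ) (t : ℝ) : |dirichletKernel M t| ≤ 2 * M + 1 := by
  refine (Finset.abs_sum_le_sum_abs _ _).trans ?_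
  refine (Finset.sum_le_card_nsmul _ _ 1 fun k _ => Real.abs_cos_le_one _).trans ?_
  rw [Int.card_Icc, show ((M : ℤ) + 1 - -M).toNat = 2 * M + 1 by omega]
  simp

theorem integral_dirichletKernel_mul {N M : ℕ} (h : N ≤ M) {w : ℝ → ℝ} (hw : IsCosPoly N w) :
    ∫ t in (-π)..π, dirichletKernel M t * w t = 2 * π * w 0 := by
  obtain ⟨c, hc⟩ := hw
  have h1 : ∀ t, dirichletKernel M t * w t = ∑ l ∈ Finset.range (N + 1),
      ∑ k ∈ Finset.Icc (-M : ℤ) M,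
        (c l / 2 * Real.cos (((k + l : ℤ) : ℝ) * t) + c l / 2 * Real.cos (((k - l : ℤ) : ℝ) * t)) := by
    intro t
    rw [hc, dirichletKernel, Finset.sum_mul_sum, Finset.sum_comm]
    refine Finset.sum_congr rfl fun l _ => Finset.sum_congr rfl fun k _ => ?_
    push_cast
    rw [add_mul, sub_mul, Real.cos_add, Real.cos_sub]
    ring
  simp_rw [h1]
  rw [intervalIntegral.integral_finsetSum
    (fun l _ => (by fun_prop : Continuous _).intervalIntegrable _ _)]
  rw [hc, Finset.mul_sum]
  refine Finset.sum_congr rfl fun l hl => ?_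
  rw [intervalIntegral.integral_finsetSum
    (fun l _ => (by fun_prop : Continuous _).intervalIntegrable _ _)]
  simp only [Finset.mem_range] at hl
  have h2 : ∀ k : ℤ, ∫ t in (-π)..π, (c l / 2 * Real.cos (((k + l : ℤ) : ℝ) * t) +
      c l / 2 * Real.cos (((k - l : ℤ) : ℝ) * t)) =
      (if k = -(l : ℤ) then c l * π else 0) + (if k = (l : ℤ) then c l * π else 0) := by
    intro k
    rw [intervalIntegral.integral_add
      ((by fun_prop : Continuous _).intervalIntegrable _ _)
      ((by fun_prop : Continuous _).intervalIntegrable _ _),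
      intervalIntegral.integral_const_mul, intervalIntegral.integral_const_mul,
      integral_cos_int_mul, integral_cos_int_mul]
    congr 1
    · by_cases hk : k = -(l : ℤ)
      · rw [if_pos (by omega), if_pos hk]; ring
      · rw [if_neg (by omega), if_neg hk]; ring
    · by_cases hk : k = (l : ℤ)
      · rw [if_pos (by omega), if_pos hk]; ring
      · rw [if_neg (by omega), if_neg hk]; ring
  simp_rw [h2]
  rw [Finset.sum_add_distrib, Finset.sum_ite_eq', Finset.sum_ite_eq', if_pos, if_pos]
  · simp; ring
  · simp; omega
  · simp; omega

/-- The Fejér kernel, normalised to be `1` at the origin. -/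
def fejerKernel (L : ℕ) (t : ℝ) : ℝ :=
  (L : ℝ)⁻¹ ^ 2 * ∑ k ∈ Finset.range L, ∑ l ∈ Finset.range L, Real.cos (((k - l : ℤ) : ℝ) * t)

theorem isCosPoly_fejerKernel (L : ℕ) : IsCosPoly L (fejerKernel L) :=
  IsCosPoly.smul _ <| IsCosPoly.sum _ fun k hk => IsCosPoly.sum _ fun l hl =>
    IsCosPoly.cos_int (by simp at hk hl; omega)

theorem continuous_fejerKernel (L : ℕ) : Continuous (fejerKernel L) := by
  unfold fejerKernel
  fun_prop

theorem fejerKernel_zero {L : ℕ} (hL : 1 ≤ L) : fejerKernel L 0 = 1 := by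
  have : (L : ℝ) ≠ 0 := by positivity
  simp [fejerKernel]
  field_simp

theorem fejerKernel_eq (L : ℕ) (t : ℝ) : fejerKernel L t =
    (L : ℝ)⁻¹ ^ 2 * ((∑ k ∈ Finset.range L, Real.cos (k * t)) ^ 2 +
      (∑ k ∈ Finset.range L, Real.sin (k * t)) ^ 2) := by
  rw [fejerKernel, sq (∑ k ∈ Finset.range L, Real.cos (k * t)),
    sq (∑ k ∈ Finset.range L, Real.sin (k * t)), Finset.sum_mul_sum, Finset.sum_mul_sum,
    ← Finset.sum_add_distrib]
  congr 1
  refine Finset.sum_congr rfl fun k _ => ?_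
  rw [← Finset.sum_add_distrib]
  refine Finset.sum_congr rfl fun l _ => ?_
  push_cast
  rw [sub_mul, Real.cos_sub]

theorem fejerKernel_nonneg (L : ℕ) (t : ℝ) : 0 ≤ fejerKernel L t := by
  rw [fejerKernel_eq]
  positivity

theorem fejerKernel_le_one {L : ℕ} (hL : 1 ≤ L) (t : ℝ) : fejerKernel L t ≤ 1 := by
  rw [← fejerKernel_zero hL, fejerKernel, fejerKernel]
  gcongr
  simp [Real.cos_le_one]

theorem sin_sq_mul_fejerKernel_le {L : ℕ} (hL : 1 ≤ L) (t : ℝ) :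
    Real.sin (t / 2) ^ 2 * (L ^ 2 * fejerKernel L t) ≤ 1 := by
  have hL0 : (L : ℝ) ≠ 0 := by positivity
  have hc : ∀ n : ℕ, 2 * Real.sin (t / 2) * ∑ k ∈ Finset.range n, Real.cos (k * t) =
      Real.sin (n * t - t / 2) + Real.sin (t / 2) := by
    intro n
    induction n with
    | zero => simp
    | succ n ih =>
      rw [Finset.sum_range_succ, mul_add, ih]
      push_cast
      rw [show ((n : ℝ) + 1) * t - t / 2 = n * t + t / 2 by ring, Real.sin_add, Real.sin_sub]
      ring
  have hs : ∀ n : ℕ, 2 * Real.sin (t / 2) * ∑ k ∈ Finset.range n, Real.sin (k * t) =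
      Real.cos (t / 2) - Real.cos (n * t - t / 2) := by
    intro n
    induction n with
    | zero => simp
    | succ n ih =>
      rw [Finset.sum_range_succ, mul_add, ih]
      push_cast
      rw [show ((n : ℝ) + 1) * t - t / 2 = n * t + t / 2 by ring, Real.cos_add, Real.cos_sub]
      ring
  have h1 : Real.sin (t / 2) ^ 2 * (L ^ 2 * fejerKernel L t) * 4 =
      (Real.sin (L * t - t / 2) + Real.sin (t / 2)) ^ 2 +
        (Real.cos (t / 2) - Real.cos (L * t - t / 2)) ^ 2 := by
    rw [← hc, ← hs, fejerKernel_eq]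
    field_simp
    ring
  have h2 := Real.sin_sq_add_cos_sq (t / 2)
  have h3 := Real.sin_sq_add_cos_sq (L * t - t / 2)
  have h4 := Real.neg_one_le_cos (L * t - t / 2 + t / 2)
  rw [Real.cos_add] at h4
  nlinarith

theorem one_add_sq_mul_fejerKernel_le {L : ℕ} (hL : 1 ≤ L) {t : ℝ} (ht : |t| ≤ π) :
    (1 + (L * t) ^ 2) * fejerKernel L t ≤ 11 := by
  have h1 := sin_sq_mul_fejerKernel_le hL t
  have h2 : (t / π) ^ 2 ≤ Real.sin (t / 2) ^ 2 := by
    rw [← sq_abs (Real.sin (t / 2)), ← sq_abs (t / π)]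
    have := Real.mul_abs_le_abs_sin (x := t / 2)
      (by rw [abs_div, abs_two]; linarith [Real.pi_pos])
    rw [abs_div, abs_two] at this
    have h3 : |t / π| ≤ |Real.sin (t / 2)| := by
      rw [abs_div, abs_of_pos Real.pi_pos]
      calc |t| / π = 2 / π * (|t| / 2) := by ring
        _ ≤ _ := this
    gcongr
  have hQ := fejerKernel_nonneg L t
  have h3 : (t / π) ^ 2 * (L ^ 2 * fejerKernel L t) ≤ 1 :=
    (mul_le_mul_of_nonneg_right h2 (by positivity)).trans h1
  have hpi : π ^ 2 ≤ 10 := by nlinarith [Real.pi_lt_d2, Real.pi_pos]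
  have h4 : (L * t) ^ 2 * fejerKernel L t = π ^ 2 * ((t / π) ^ 2 * (L ^ 2 * fejerKernel L t)) := by
    field_simp
  have := fejerKernel_le_one hL t
  nlinarith [mul_le_mul_of_nonneg_left h3 (sq_nonneg π)]

theorem integral_fejerKernel_le {L : ℕ} (hL : 1 ≤ L) :
    ∫ t in (-π)..π, fejerKernel L t ≤ 11 * π / L := by
  have hL0 : (0 : ℝ) < L := by positivity
  have h1 : ∫ t in (-π)..π, fejerKernel L t ≤ ∫ t in (-π)..π, 11 * (1 / (1 + (L * t) ^ 2)) := by
    refine intervalIntegral.integral_mono_on PeriodicFlow.neg_pi_le_pi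
      ((continuous_fejerKernel L).intervalIntegrable _ _) ?_ fun t ht => ?_
    · refine Continuous.intervalIntegrable ?_ _ _
      refine continuous_const.mul (continuous_const.div (by fun_prop) fun t => ?_)
      positivity
    · have := one_add_sq_mul_fejerKernel_le hL (abs_le.2 ht)
      rw [mul_one_div, le_div_iff₀ (by positivity)]
      linarith
  refine h1.trans ?_
  rw [intervalIntegral.integral_const_mul,
    intervalIntegral.integral_comp_mul_left (fun t => 1 / (1 + t ^ 2)) hL0.ne',
    integral_one_div_one_add_sq, smul_eq_mul, mul_div_assoc, div_eq_inv_mul π]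
  have h2 := Real.arctan_lt_pi_div_two (L * π)
  have h3 := Real.neg_pi_div_two_lt_arctan (L * -π)
  gcongr
  linarith

/-- A de la Vallée-Poussin type kernel with fast decay. -/
def smoothKernel (L : ℕ) (t : ℝ) : ℝ := dirichletKernel (3 * L) t * fejerKernel L t ^ 2

/-- The derivative of `smoothKernel`. -/
def smoothKernelDeriv (L : ℕ) (t : ℝ) : ℝ :=
  (∑ k ∈ Finset.Icc (-(3 * L : ℕ) : ℤ) (3 * L : ℕ), -(k * Real.sin (k * t))) * fejerKernel L t ^ 2 +
    dirichletKernel (3 * L) t * (2 * fejerKernel L t * ((L : ℝ)⁻¹ ^ 2 *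
      ∑ k ∈ Finset.range L, ∑ l ∈ Finset.range L,
        -(((k - l : ℤ) : ℝ) * Real.sin (((k - l : ℤ) : ℝ) * t))))

theorem hasDerivAt_cos_int (k : ℤ) (t : ℝ) :
    HasDerivAt (fun t => Real.cos (k * t)) (-(k * Real.sin (k * t))) t := by
  have := ((hasDerivAt_id t).const_mul (k : ℝ)).cos
  simp only [id_eq, mul_one] at this
  convert this using 1
  ring

theorem hasDerivAt_smoothKernel (L : ℕ) (t : ℝ) :
    HasDerivAt (smoothKernel L) (smoothKernelDeriv L t) t := by
  have h1 : HasDerivAt (dirichletKernel (3 * L)) (∑ k ∈ Finset.Icc (-(3 * L : ℕ) : ℤ) (3 * L : ℕ),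
      -(k * Real.sin (k * t))) t :=
    HasDerivAt.fun_sum fun k _ => hasDerivAt_cos_int k t
  have h2 : HasDerivAt (fejerKernel L) ((L : ℝ)⁻¹ ^ 2 *
      ∑ k ∈ Finset.range L, ∑ l ∈ Finset.range L,
        -(((k - l : ℤ) : ℝ) * Real.sin (((k - l : ℤ) : ℝ) * t))) t :=
    (HasDerivAt.fun_sum fun (k : ℕ) _ => HasDerivAt.fun_sum fun (l : ℕ) _ =>
      hasDerivAt_cos_int ((k : ℤ) - (l : ℤ)) t).const_mul _
  refine (h1.fun_mul (h2.fun_pow 2)).congr_deriv ?_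
  simp [smoothKernelDeriv]

theorem isCosPoly_smoothKernel (L : ℕ) : IsCosPoly (5 * L) (smoothKernel L) := by
  have := (isCosPoly_dirichletKernel (3 * L)).mul
    ((isCosPoly_fejerKernel L).mul (isCosPoly_fejerKernel L))
  convert this using 1
  · ring
  · funext t
    rw [smoothKernel, sq]

theorem integral_smoothKernel_mul_cos {L k : ℕ} (hL : 1 ≤ L) (hk : k ≤ L) :
    ∫ t in (-π)..π, smoothKernel L t * Real.cos (k * t) = 2 * π := by
  have hw : IsCosPoly (3 * L) fun t => fejerKernel L t * fejerKernel L t * Real.cos (k * t) :=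
    (((isCosPoly_fejerKernel L).mul (isCosPoly_fejerKernel L)).mul
      (IsCosPoly.cos_nat hk)).mono (by omega)
  have := integral_dirichletKernel_mul le_rfl hw
  simp only [fejerKernel_zero hL, mul_zero, Real.cos_zero, mul_one] at this
  rw [← this]
  congr 1
  funext t
  rw [smoothKernel]
  ring

theorem continuous_smoothKernel (L : ℕ) : Continuous (smoothKernel L) :=
  (continuous_dirichletKernel _).mul ((continuous_fejerKernel L).pow 2)

theorem continuous_smoothKernelDeriv (L : ℕ) : Continuous (smoothKernelDeriv L) := by
  have := continuous_dirichletKernel (3 * L)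
  have := continuous_fejerKernel L
  unfold smoothKernelDeriv
  fun_prop

theorem abs_smoothKernel_le {L : ℕ} (hL : 1 ≤ L) (t : ℝ) :
    |smoothKernel L t| ≤ 7 * L * fejerKernel L t ^ 2 := by
  have hL1 : (1 : ℝ) ≤ L := by exact_mod_cast hL
  rw [smoothKernel, abs_mul, abs_of_nonneg (sq_nonneg (fejerKernel L t))]
  gcongr
  refine (abs_dirichletKernel_le _ t).trans ?_
  push_cast
  linarith

theorem abs_mul_sin_le {x y K : ℝ} (h : |x| ≤ K) : |-(x * Real.sin y)| ≤ K := by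
  rw [abs_neg, abs_mul]
  calc |x| * |Real.sin y| ≤ |x| * 1 := by gcongr; exact Real.abs_sin_le_one _
    _ ≤ K := by linarith

theorem abs_smoothKernelDeriv_le {L : ℕ} (hL : 1 ≤ L) (t : ℝ) :
    |smoothKernelDeriv L t| ≤ 35 * L ^ 2 * fejerKernel L t := by
  have hL1 : (1 : ℝ) ≤ L := by exact_mod_cast hL
  have hQ := fejerKernel_nonneg L t
  have hQ1 := fejerKernel_le_one hL t
  have h1 : |∑ k ∈ Finset.Icc (-(3 * L : ℕ) : ℤ) (3 * L : ℕ), -((k : ℝ) * Real.sin (k * t))| ≤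
      21 * L ^ 2 := by
    refine (Finset.abs_sum_le_sum_abs _ _).trans ?_
    refine (Finset.sum_le_card_nsmul _ _ (3 * L : ℝ) fun k hk => ?_).trans ?_
    · refine abs_mul_sin_le ?_
      rw [Finset.mem_Icc] at hk
      rw [← Int.cast_abs]
      exact_mod_cast abs_le.2 hk
    · rw [Int.card_Icc, show (((3 * L : ℕ) : ℤ) + 1 - -(3 * L : ℕ)).toNat = 6 * L + 1 by omega,
        nsmul_eq_mul]
      push_cast
      nlinarith
  have h2 : |(L : ℝ)⁻¹ ^ 2 * ∑ k ∈ Finset.range L, ∑ l ∈ Finset.range L,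
        -(((k - l : ℤ) : ℝ) * Real.sin (((k - l : ℤ) : ℝ) * t))| ≤ L := by
    rw [abs_mul, abs_of_nonneg (by positivity)]
    have : |∑ k ∈ Finset.range L, ∑ l ∈ Finset.range L,
        -(((k - l : ℤ) : ℝ) * Real.sin (((k - l : ℤ) : ℝ) * t))| ≤ L * (L * L) := by
      refine (Finset.abs_sum_le_sum_abs _ _).trans ?_
      refine (Finset.sum_le_card_nsmul _ _ (L * L : ℝ) fun k hk => ?_).trans (by simp)
      refine (Finset.abs_sum_le_sum_abs _ _).trans ?_
      refine (Finset.sum_le_card_nsmul _ _ (L : ℝ) fun l hl => ?_).trans (by simp)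
      refine abs_mul_sin_le ?_
      simp only [Finset.mem_range] at hk hl
      rw [← Int.cast_abs]
      have : |(k : ℤ) - l| ≤ L := abs_le.2 ⟨by omega, by omega⟩
      exact_mod_cast this
    calc _ ≤ (L : ℝ)⁻¹ ^ 2 * (L * (L * L)) := by gcongr
      _ = L := by field_simp
  have h3 : |dirichletKernel (3 * L) t| ≤ 7 * L := by
    refine (abs_dirichletKernel_le _ t).trans ?_
    push_cast
    linarith
  rw [smoothKernelDeriv]
  refine (abs_add_le _ _).trans ?_
  rw [abs_mul, abs_mul (dirichletKernel _ _), abs_mul (2 * _),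
    abs_of_nonneg (sq_nonneg (fejerKernel L t)), abs_of_nonneg (by positivity :
    0 ≤ 2 * fejerKernel L t)]
  calc _ ≤ 21 * L ^ 2 * fejerKernel L t ^ 2 + 7 * L * (2 * fejerKernel L t * L) := by gcongr
    _ ≤ 21 * L ^ 2 * fejerKernel L t + 7 * L * (2 * fejerKernel L t * L) := by
      gcongr
      nlinarith
    _ = _ := by ring

theorem integral_abs_smoothKernelDeriv_le {L : ℕ} (hL : 1 ≤ L) :
    ∫ t in (-π)..π, |smoothKernelDeriv L t| ≤ 385 * π * L := by
  have hL1 : (1 : ℝ) ≤ L := by exact_mod_cast hL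
  calc _ ≤ ∫ t in (-π)..π, 35 * L ^ 2 * fejerKernel L t :=
        intervalIntegral.integral_mono_on PeriodicFlow.neg_pi_le_pi
          ((continuous_smoothKernelDeriv L).abs.intervalIntegrable _ _)
          ((continuous_const.mul (continuous_fejerKernel L)).intervalIntegrable _ _)
          fun t _ => abs_smoothKernelDeriv_le hL t
    _ = 35 * L ^ 2 * ∫ t in (-π)..π, fejerKernel L t := intervalIntegral.integral_const_mul _ _
    _ ≤ 35 * L ^ 2 * (11 * π / L) := by gcongr; exact integral_fejerKernel_le hL
    _ = _ := by field_simp; ring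

theorem integral_abs_smoothKernel_le {L : ℕ} (hL : 1 ≤ L) :
    ∫ t in (-π)..π, |smoothKernel L t| * (1 + L * |t|) ≤ 1694 * π := by
  have hL1 : (1 : ℝ) ≤ L := by exact_mod_cast hL
  calc _ ≤ ∫ t in (-π)..π, 154 * L * fejerKernel L t := by
        refine intervalIntegral.integral_mono_on PeriodicFlow.neg_pi_le_pi
          (((continuous_smoothKernel L).abs.mul (by fun_prop)).intervalIntegrable _ _)
          ((continuous_const.mul (continuous_fejerKernel L)).intervalIntegrable _ _)
          fun t ht => ?_
        have hQ := fejerKernel_nonneg L t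
        have h1 := one_add_sq_mul_fejerKernel_le hL (abs_le.2 ht)
        have h2 : 1 + L * |t| ≤ 2 * (1 + (L * t) ^ 2) := by
          rw [← sq_abs (L * t), abs_mul, Nat.abs_cast]
          nlinarith [sq_nonneg (L * |t| - 1)]
        calc _ ≤ (7 * L * fejerKernel L t ^ 2) * (2 * (1 + (L * t) ^ 2)) := by
              gcongr
              exact abs_smoothKernel_le hL t
          _ = 14 * L * fejerKernel L t * ((1 + (L * t) ^ 2) * fejerKernel L t) := by ring
          _ ≤ 14 * L * fejerKernel L t * 11 := by gcongr
          _ = _ := by ring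
    _ = 154 * L * ∫ t in (-π)..π, fejerKernel L t := intervalIntegral.integral_const_mul _ _
    _ ≤ 154 * L * (11 * π / L) := by gcongr; exact integral_fejerKernel_le hL
    _ = _ := by field_simp; ring

/-- The degree of the kernels at scale `8 ^ j`. -/
def scaleDeg (j : ℕ) : ℕ := if j = 0 then 0 else 8 ^ j

/-- The approximation kernel at scale `8 ^ j`. -/
def kernel : ℕ → C(ℝ, ℝ)
  | 0 => ContinuousMap.const ℝ (1 / (2 * π))
  | j + 1 => ⟨fun t => 1 / (2 * π) * smoothKernel (8 ^ j) t,
      continuous_const.mul (continuous_smoothKernel _)⟩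

/-- The derivative of `kernel j`. -/
def kernelDeriv : ℕ → C(ℝ, ℝ)
  | 0 => 0
  | j + 1 => ⟨fun t => 1 / (2 * π) * smoothKernelDeriv (8 ^ j) t,
      continuous_const.mul (continuous_smoothKernelDeriv _)⟩

theorem hasDerivAt_kernel (j : ℕ) (t : ℝ) : HasDerivAt (kernel j) (kernelDeriv j t) t := by
  cases j with
  | zero => exact hasDerivAt_const _ _
  | succ j => exact (hasDerivAt_smoothKernel _ t).const_mul _

theorem isCosPoly_kernel (j : ℕ) : IsCosPoly (scaleDeg j) (kernel j) := by
  cases j with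
  | zero => exact ⟨fun _ => 1 / (2 * π), fun t => by simp [scaleDeg, kernel]⟩
  | succ j =>
    refine ((isCosPoly_smoothKernel (8 ^ j)).mono ?_).smul _
    simp only [scaleDeg, Nat.succ_ne_zero, if_false]
    rw [pow_succ]
    omega

theorem periodic_kernelDeriv (j : ℕ) : Function.Periodic (kernelDeriv j) (2 * π) := by
  intro t
  have h1 := hasDerivAt_kernel j (t + 2 * π)
  have h2 : HasDerivAt (fun t => kernel j (t + 2 * π)) (kernelDeriv j (t + 2 * π)) t :=
    h1.comp_add_const t (2 * π)
  simp only [(isCosPoly_kernel j).periodic _] at h2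
  exact h2.unique (hasDerivAt_kernel j t)

theorem integral_kernel_mul_cos {j k : ℕ} (hk : k ≤ scaleDeg (j - 1)) :
    ∫ t in (-π)..π, kernel j t * Real.cos (k * t) = 1 := by
  have hpi := Real.pi_pos
  cases j with
  | zero =>
    simp only [scaleDeg, Nat.zero_sub, if_true, Nat.le_zero] at hk
    simp [hk, kernel]
    field_simp
    ring
  | succ j =>
    have hk' : k ≤ 8 ^ j := by
      refine hk.trans ?_
      simp only [scaleDeg, Nat.add_sub_cancel]
      split_ifs <;> simp
    have := integral_smoothKernel_mul_cos (Nat.one_le_pow j 8 (by norm_num)) hk'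
    simp only [kernel, ContinuousMap.coe_mk, mul_assoc]
    rw [intervalIntegral.integral_const_mul, this]
    field_simp

theorem abs_kernelDeriv_bounded (j : ℕ) : ∃ B, ∀ t, |kernelDeriv j t| ≤ B := by
  cases j with
  | zero => exact ⟨0, fun t => by simp [kernelDeriv]⟩
  | succ j =>
    refine ⟨1 / (2 * π) * (35 * ((8 ^ j : ℕ) : ℝ) ^ 2), fun t => ?_⟩
    have h8 := Nat.one_le_pow j 8 (by norm_num)
    simp only [kernelDeriv, ContinuousMap.coe_mk]
    rw [abs_mul, abs_of_nonneg (by positivity)]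
    gcongr
    refine (abs_smoothKernelDeriv_le h8 t).trans ?_
    exact mul_le_of_le_one_right (by positivity) (fejerKernel_le_one h8 t)

theorem integral_abs_kernelDeriv_le (j : ℕ) :
    ∫ t in (-π)..π, |kernelDeriv j t| ≤ 10000 * 8 ^ j := by
  have hpi := Real.pi_pos
  cases j with
  | zero => simp [kernelDeriv]
  | succ j =>
    have h8 := integral_abs_smoothKernelDeriv_le (Nat.one_le_pow j 8 (by norm_num))
    simp only [kernelDeriv, ContinuousMap.coe_mk, abs_mul]
    rw [intervalIntegral.integral_const_mul, abs_of_nonneg (by positivity)]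
    calc _ ≤ 1 / (2 * π) * (385 * π * ((8 ^ j : ℕ) : ℝ)) := by gcongr
      _ = 385 / 2 * 8 ^ j := by field_simp; push_cast; ring
      _ ≤ _ := by
        rw [pow_succ]
        have : (0 : ℝ) < 8 ^ j := by positivity
        linarith

theorem integral_abs_kernel_le (j : ℕ) :
    ∫ t in (-π)..π, |kernel j t| * (1 + 8 ^ j * |t|) ≤ 10000 := by
  have hpi := Real.pi_pos
  cases j with
  | zero =>
    have h1 : ∫ t in (-π)..π, |kernel 0 t| * (1 + 8 ^ 0 * |t|) ≤
        ∫ t in (-π)..π, 1 / (2 * π) * (1 + π) := by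
      refine intervalIntegral.integral_mono_on PeriodicFlow.neg_pi_le_pi
        (Continuous.intervalIntegrable (by fun_prop) _ _) (by simp) fun t ht => ?_
      have := abs_le.2 ht
      simp only [kernel, ContinuousMap.const_apply]
      rw [abs_of_nonneg (by positivity)]
      gcongr
      simpa using this
    refine h1.trans ?_
    rw [intervalIntegral.integral_const, smul_eq_mul]
    have : (π - -π) * (1 / (2 * π) * (1 + π)) = 1 + π := by field_simp; ring
    rw [this]
    linarith [Real.pi_lt_d2]
  | succ j =>
    have h8 := integral_abs_smoothKernel_le (Nat.one_le_pow j 8 (by norm_num))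
    have h1 : ∫ t in (-π)..π, |kernel (j + 1) t| * (1 + 8 ^ (j + 1) * |t|) ≤
        ∫ t in (-π)..π, 8 / (2 * π) * (|smoothKernel (8 ^ j) t| * (1 + ((8 ^ j : ℕ) : ℝ) * |t|)) := by
      refine intervalIntegral.integral_mono_on PeriodicFlow.neg_pi_le_pi
        (Continuous.intervalIntegrable (by fun_prop) _ _) ?_ fun t ht => ?_
      · have := continuous_smoothKernel (8 ^ j)
        exact Continuous.intervalIntegrable (by fun_prop) _ _
      · simp only [kernel, ContinuousMap.coe_mk]
        rw [abs_mul, abs_of_nonneg (by positivity : 0 ≤ 1 / (2 * π))]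
        have : 1 + (8 : ℝ) ^ (j + 1) * |t| ≤ 8 * (1 + ((8 ^ j : ℕ) : ℝ) * |t|) := by
          push_cast
          rw [pow_succ]
          linarith
        calc _ ≤ 1 / (2 * π) * |smoothKernel (8 ^ j) t| * (8 * (1 + ((8 ^ j : ℕ) : ℝ) * |t|)) := by
              gcongr
          _ = _ := by ring
    refine h1.trans ?_
    rw [intervalIntegral.integral_const_mul]
    calc _ ≤ 8 / (2 * π) * (1694 * π) := by gcongr
      _ = 6776 := by field_simp; norm_num
      _ ≤ _ := by norm_num

end Kernels

section Discrete

/-- Schur's test for nonnegative matrices on `ℓ^s`. -/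
theorem schur_test {s B : ℝ} (hs : 1 ≤ s) (I : Finset ℕ) (κ : ℕ → ℕ → ℝ) (a : ℕ → ℝ)
    (hκ : ∀ i j, 0 ≤ κ i j) (ha : ∀ j, 0 ≤ a j) (h1 : ∀ i ∈ I, ∑ j ∈ I, κ i j ≤ B)
    (h2 : ∀ j ∈ I, ∑ i ∈ I, κ i j ≤ B) :
    ∑ i ∈ I, (∑ j ∈ I, κ i j * a j) ^ s ≤ B ^ s * ∑ j ∈ I, a j ^ s := by
  rcases I.eq_empty_or_nonempty with rfl | ⟨i₀, hi₀⟩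
  · simp
  have hB : 0 ≤ B := (Finset.sum_nonneg fun j _ => hκ i₀ j).trans (h1 i₀ hi₀)
  have hs0 : 0 < s := by linarith
  have key : ∀ i ∈ I, (∑ j ∈ I, κ i j * a j) ^ s ≤ B ^ (s - 1) * ∑ j ∈ I, κ i j * a j ^ s := by
    intro i hi
    have h := Real.inner_le_weight_mul_Lp_of_nonneg I hs (κ i) a (hκ i) ha
    have h0 : 0 ≤ ∑ j ∈ I, κ i j * a j ^ s :=
      Finset.sum_nonneg fun j _ => mul_nonneg (hκ i j) (Real.rpow_nonneg (ha j) s)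
    have h3 := Real.rpow_le_rpow (Finset.sum_nonneg fun j _ => mul_nonneg (hκ i j) (ha j)) h hs0.le
    have h4 : 0 ≤ ∑ j ∈ I, κ i j := Finset.sum_nonneg fun j _ => hκ i j
    rw [Real.mul_rpow (Real.rpow_nonneg h4 _) (Real.rpow_nonneg h0 _), ← Real.rpow_mul h4,
      ← Real.rpow_mul h0, inv_mul_cancel₀ hs0.ne', Real.rpow_one, sub_mul, one_mul,
      inv_mul_cancel₀ hs0.ne'] at h3
    refine h3.trans ?_
    gcongr
    exact h1 i hi
  calc _ ≤ ∑ i ∈ I, B ^ (s - 1) * ∑ j ∈ I, κ i j * a j ^ s := Finset.sum_le_sum key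
    _ = B ^ (s - 1) * ∑ j ∈ I, (∑ i ∈ I, κ i j) * a j ^ s := by
      rw [← Finset.mul_sum, Finset.sum_comm]
      simp_rw [Finset.sum_mul]
    _ ≤ B ^ (s - 1) * ∑ j ∈ I, B * a j ^ s := by
      gcongr with j hj
      · exact Real.rpow_nonneg (ha j) s
      · exact h2 j hj
    _ = _ := by
      rw [← Finset.mul_sum, ← mul_assoc, ← Real.rpow_add_one' hB (by linarith), sub_add_cancel]

theorem sum_pow_dist_le {r : ℝ} (hr0 : 0 ≤ r) (hr1 : r < 1) (n i : ℕ) :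
    ∑ j ∈ Finset.range n, r ^ ((i - j) + (j - i)) ≤ 2 / (1 - r) := by
  have hg : ∀ I : Finset ℕ, ∑ k ∈ I, r ^ k ≤ (1 - r)⁻¹ := fun I =>
    (tsum_geometric_of_lt_one hr0 hr1) ▸
      (summable_geometric_of_lt_one hr0 hr1).sum_le_tsum I fun k _ => pow_nonneg hr0 k
  rw [← Finset.sum_filter_add_sum_filter_not _ (fun j => j ≤ i)]
  have h1 : ∑ j ∈ (Finset.range n).filter (fun j => j ≤ i), r ^ ((i - j) + (j - i)) ≤ (1 - r)⁻¹ := by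
    refine le_trans (le_of_eq ?_) (hg (((Finset.range n).filter (fun j => j ≤ i)).image (i - ·)))
    rw [Finset.sum_image]
    · refine Finset.sum_congr rfl fun j hj => ?_
      simp only [Finset.mem_filter] at hj
      rw [Nat.sub_eq_zero_of_le hj.2, add_zero]
    · intro j hj k hk h
      simp only [Finset.coe_filter, Set.mem_ofPred_eq] at hj hk
      simp only at h
      omega
  have h2 : ∑ j ∈ (Finset.range n).filter (fun j => ¬ j ≤ i), r ^ ((i - j) + (j - i)) ≤
      (1 - r)⁻¹ := by
    refine le_trans (le_of_eq ?_) (hg (((Finset.range n).filter (fun j => ¬ j ≤ i)).image (· - i)))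
    rw [Finset.sum_image]
    · refine Finset.sum_congr rfl fun j hj => ?_
      simp only [Finset.mem_filter] at hj
      rw [Nat.sub_eq_zero_of_le (by omega), zero_add]
    · intro j hj k hk h
      simp only [Finset.coe_filter, Set.mem_ofPred_eq] at hj hk
      simp only at h
      omega
  calc _ ≤ (1 - r)⁻¹ + (1 - r)⁻¹ := add_le_add h1 h2
    _ = _ := by ring

/-- Discrete Hardy inequality with geometric weights. -/
theorem hardy_geometric {r s : ℝ} (hr0 : 0 ≤ r) (hr1 : r < 1) (hs : 1 ≤ s) (n : ℕ) (a : ℕ → ℝ)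
    (ha : ∀ j, 0 ≤ a j) :
    ∑ i ∈ Finset.range n, (∑ j ∈ Finset.range n, r ^ ((i - j) + (j - i)) * a j) ^ s ≤
      (2 / (1 - r)) ^ s * ∑ j ∈ Finset.range n, a j ^ s :=
  schur_test hs _ (fun i j => r ^ ((i - j) + (j - i))) a (fun _ _ => pow_nonneg hr0 _) ha
    (fun i _ => sum_pow_dist_le hr0 hr1 n i) fun j _ => by
      simpa [add_comm] using sum_pow_dist_le hr0 hr1 n j

end Discrete

section Block

/-- The reproducing kernel of the `j`-th dyadic block. -/
def blockKernel (j : ℕ) : C(ℝ, ℝ) := kernel (j + 2) - kernel (j - 1)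

theorem kernel_even (j : ℕ) (t : ℝ) : kernel j (-t) = kernel j t := (isCosPoly_kernel j).even t

theorem blockKernel_even (j : ℕ) (t : ℝ) : blockKernel j (-t) = blockKernel j t := by
  simp [blockKernel, kernel_even]

theorem integral_kernel (j : ℕ) : ∫ t in (-π)..π, kernel j t = 1 := by
  simpa using integral_kernel_mul_cos (j := j) (k := 0) (Nat.zero_le _)

theorem integral_blockKernel (j : ℕ) : ∫ t in (-π)..π, blockKernel j t = 0 := by
  simp only [blockKernel, ContinuousMap.sub_apply]
  rw [intervalIntegral.integral_sub ((kernel _).continuous.intervalIntegrable _ _)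
    ((kernel _).continuous.intervalIntegrable _ _), integral_kernel, integral_kernel, sub_self]

theorem integral_abs_kernel_le_of_le {i j : ℕ} (h : j ≤ i + 1) :
    ∫ t in (-π)..π, |kernel i t| * (1 + 8 ^ j * |t|) ≤ 80000 := by
  calc _ ≤ ∫ t in (-π)..π, 8 * (|kernel i t| * (1 + 8 ^ i * |t|)) := by
        refine intervalIntegral.integral_mono_on PeriodicFlow.neg_pi_le_pi
          (Continuous.intervalIntegrable (by fun_prop) _ _)
          (Continuous.intervalIntegrable (by fun_prop) _ _) fun t _ => ?_
        have h1 : (8 : ℝ) ^ j ≤ 8 * 8 ^ i := by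
          rw [← pow_succ']
          exact pow_le_pow_right₀ (by norm_num) h
        calc _ ≤ |kernel i t| * (8 + 8 * 8 ^ i * |t|) := by gcongr; norm_num
          _ = _ := by ring
    _ ≤ _ := by
      rw [intervalIntegral.integral_const_mul]
      linarith [integral_abs_kernel_le i]

theorem integral_abs_blockKernel_mul_le (j : ℕ) :
    ∫ t in (-π)..π, |blockKernel j t| * (1 + 8 ^ j * |t|) ≤ 1000000 := by
  calc _ ≤ ∫ t in (-π)..π, (|kernel (j + 2) t| * (1 + 8 ^ j * |t|) +
        |kernel (j - 1) t| * (1 + 8 ^ j * |t|)) := by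
        refine intervalIntegral.integral_mono_on PeriodicFlow.neg_pi_le_pi
          (Continuous.intervalIntegrable (by fun_prop) _ _)
          (Continuous.intervalIntegrable (by fun_prop) _ _) fun t _ => ?_
        rw [← add_mul, blockKernel, ContinuousMap.sub_apply]
        gcongr
        exact abs_sub _ _
    _ ≤ _ := by
      rw [intervalIntegral.integral_add (Continuous.intervalIntegrable (by fun_prop) _ _)
        (Continuous.intervalIntegrable (by fun_prop) _ _)]
      have h1 := integral_abs_kernel_le_of_le (i := j + 2) (j := j) (by omega)
      have h2 := integral_abs_kernel_le_of_le (i := j - 1) (j := j) (by omega)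
      linarith

theorem integral_abs_le_weighted (v : C(ℝ, ℝ)) {c : ℝ} (hc : 0 ≤ c) :
    ∫ t in (-π)..π, |v t| ≤ ∫ t in (-π)..π, |v t| * (1 + c * |t|) := by
  refine intervalIntegral.integral_mono_on PeriodicFlow.neg_pi_le_pi
    (Continuous.intervalIntegrable (by fun_prop) _ _)
    (Continuous.intervalIntegrable (by fun_prop) _ _) fun t _ => ?_
  exact le_mul_of_one_le_right (abs_nonneg _) (by simp; positivity)

namespace PeriodicFlow

variable {X : Type*} [NormedAddCommGroup X] [NormedSpace ℝ X] [CompleteSpace X]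
  (R : PeriodicFlow X)

/-- The de la Vallée-Poussin means at scale `8 ^ j`. -/
def V (j : ℕ) : X →L[ℝ] X := R.conv (kernel j)

/-- The reproducing operators of the dyadic blocks. -/
def U (j : ℕ) : X →L[ℝ] X := R.conv (blockKernel j)

theorem U_apply (j : ℕ) (x : X) : R.U j x = R.V (j + 2) x - R.V (j - 1) x := by
  rw [U, blockKernel, conv_sub]
  rfl

theorem commutes_V (j : ℕ) : R.Commutes (R.V j) := R.commutes_conv _

theorem commutes_U (j : ℕ) : R.Commutes (R.U j) := R.commutes_conv _

variable {R} in
theorem Commutes.V {B : X →L[ℝ] X} (h : R.Commutes B) (j : ℕ) (x : X) :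
    B (R.V j x) = R.V j (B x) := h.conv _ x

theorem norm_V_le (j : ℕ) (x : X) : ‖R.V j x‖ ≤ 10000 * ‖x‖ := by
  refine (R.norm_conv_le _ x).trans ?_
  gcongr
  exact (integral_abs_le_weighted _ (by positivity)).trans (integral_abs_kernel_le j)

theorem norm_sub_V_le (j : ℕ) (x : X) : ‖x - R.V j x‖ ≤ 10001 * ‖x‖ := by
  refine (norm_sub_le _ _).trans ?_
  linarith [R.norm_V_le j x]

theorem norm_U_le (j : ℕ) (x : X) : ‖R.U j x‖ ≤ 1000000 * ‖x‖ := by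
  refine (R.norm_conv_le _ x).trans ?_
  gcongr
  exact (integral_abs_le_weighted _ (by positivity)).trans (integral_abs_blockKernel_mul_le j)

theorem norm_τ_V_sub_le (j : ℕ) (s : ℝ) (x : X) :
    ‖R.τ s (R.V j x) - R.V j x‖ ≤ 10000 * 8 ^ j * ‖x‖ * |s| := by
  obtain ⟨B, hB⟩ := abs_kernelDeriv_bounded j
  refine (R.norm_τ_conv_sub_le _ (kernelDeriv j) (isCosPoly_kernel j).periodic
    (periodic_kernelDeriv j) (hasDerivAt_kernel j) hB s x).trans ?_
  gcongr
  exact integral_abs_kernelDeriv_le j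

theorem norm_τ_U_sub_le (j : ℕ) (s : ℝ) (x : X) :
    ‖R.τ s (R.U j x) - R.U j x‖ ≤ 1000000 * 8 ^ j * ‖x‖ * |s| := by
  rw [U_apply, map_sub, sub_sub_sub_comm]
  refine (norm_sub_le _ _).trans ?_
  refine (add_le_add (R.norm_τ_V_sub_le _ s x) (R.norm_τ_V_sub_le _ s x)).trans ?_
  have h1 : (8 : ℝ) ^ (j - 1) ≤ 8 ^ j := pow_le_pow_right₀ (by norm_num) (by omega)
  calc _ = 10000 * (64 * 8 ^ j + 8 ^ (j - 1)) * ‖x‖ * |s| := by ring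
    _ ≤ 10000 * (64 * 8 ^ j + 8 ^ j) * ‖x‖ * |s| := by gcongr
    _ = 650000 * 8 ^ j * ‖x‖ * |s| := by ring
    _ ≤ _ := by gcongr; norm_num

theorem isTrig_V (j : ℕ) (x : X) : R.IsTrig (scaleDeg j) (R.V j x) := by
  obtain ⟨c, hc⟩ := isCosPoly_kernel j
  exact R.isTrig_conv _ _ c hc x

variable {R} in
theorem IsTrig.V_eq_self {N j : ℕ} {x : X} (hx : R.IsTrig N x) (h : N ≤ scaleDeg (j - 1)) :
    R.V j x = x :=
  hx.conv_eq_self _ (kernel_even j) fun _ hk => integral_kernel_mul_cos (hk.trans h)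

theorem scaleDeg_mono {i j : ℕ} (h : i ≤ j) : scaleDeg i ≤ scaleDeg j := by
  unfold scaleDeg
  split_ifs with h1 h2
  · exact le_rfl
  · exact Nat.zero_le _
  · omega
  · exact Nat.pow_le_pow_right (by norm_num) h

theorem V_V_of_lt {i j : ℕ} (h : j < i) (x : X) : R.V i (R.V j x) = R.V j x :=
  (R.isTrig_V j x).V_eq_self (scaleDeg_mono (by omega))

theorem V_comm (i j : ℕ) (x : X) : R.V i (R.V j x) = R.V j (R.V i x) := (R.commutes_V i).V j x

theorem V_V_of_gt {i j : ℕ} (h : i < j) (x : X) : R.V i (R.V j x) = R.V i x := by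
  rw [V_comm, V_V_of_lt _ h]

theorem V_zero_V_zero (x : X) : R.V 0 (R.V 0 x) = R.V 0 x :=
  (R.isTrig_V 0 x).V_eq_self (scaleDeg_mono (by omega))

/-- The dyadic blocks. -/
def Δ (j : ℕ) : X →L[ℝ] X := R.V (j + 1) - R.V j

theorem Δ_apply (j : ℕ) (x : X) : R.Δ j x = R.V (j + 1) x - R.V j x := rfl

theorem commutes_Δ (j : ℕ) : R.Commutes (R.Δ j) := (R.commutes_V _).sub (R.commutes_V _)

variable {R} in
theorem Commutes.Δ {B : X →L[ℝ] X} (h : R.Commutes B) (j : ℕ) (x : X) :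
    B (R.Δ j x) = R.Δ j (B x) := by
  rw [Δ_apply, Δ_apply, map_sub, h.V, h.V]

theorem U_Δ (j : ℕ) (x : X) : R.U j (R.Δ j x) = R.Δ j x := by
  rw [U_apply, Δ_apply, map_sub, map_sub, V_V_of_lt _ (by omega), V_V_of_lt _ (by omega)]
  have h : R.V (j - 1) (R.V (j + 1) x) - R.V (j - 1) (R.V j x) = 0 := by
    rw [V_V_of_gt _ (by omega)]
    cases j with
    | zero => rw [Nat.zero_sub, V_zero_V_zero, sub_self]
    | succ j => rw [V_V_of_gt _ (by omega), sub_self]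
  rw [h, sub_zero]

theorem sum_Δ (x : X) (i m : ℕ) (h : i ≤ m) : ∑ j ∈ Finset.Ico i m, R.Δ j x = R.V m x - R.V i x :=
  Finset.sum_Ico_sub (fun j => R.V j x) h

theorem norm_Δ_le (j : ℕ) (x : X) : ‖R.Δ j x‖ ≤ 20000 * ‖x‖ := by
  rw [Δ_apply]
  refine (norm_sub_le _ _).trans ?_
  linarith [R.norm_V_le j x, R.norm_V_le (j + 1) x]

end PeriodicFlow

end Block

section SquareFunction

variable {X X' : Type*} [NormedAddCommGroup X] [NormedSpace ℝ X] [CompleteSpace X]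
  [NormedAddCommGroup X'] [NormedSpace ℝ X'] [CompleteSpace X']

/-- A duality map of order `p` with modulus of continuity `θ - 1`, compatible with the flow. -/
structure DualityMap (R : PeriodicFlow X) (p θ : ℝ) where
  J : X → X →L[ℝ] ℝ
  K : ℝ
  K_nonneg : 0 ≤ K
  apply_self : ∀ x, J x x = ‖x‖ ^ p
  norm_le : ∀ x, ‖J x‖ ≤ ‖x‖ ^ (p - 1)
  equivariant : ∀ t x y, J (R.τ t x) (R.τ t y) = J x y
  holder : ∀ x y, ‖J x - J y‖ ≤ K * (‖x‖ + ‖y‖) ^ (p - θ) * ‖x - y‖ ^ (θ - 1)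

namespace DualityMap

variable {R : PeriodicFlow X} {p θ : ℝ} (D : DualityMap R p θ)

omit [CompleteSpace X] in
theorem norm_add_rpow_le (hp : 1 < p) (hθ : 1 < θ) (S d : X) :
    ‖S + d‖ ^ p ≤ ‖S‖ ^ p + p * D.J S d +
      p * D.K * (‖S + d‖ + ‖S‖) ^ (p - θ) * ‖d‖ ^ θ := by
  have hp0 : 0 < p := by linarith
  have h1 : D.J (S + d) S ≤ ‖S + d‖ ^ (p - 1) * ‖S‖ :=
    (le_abs_self _).trans (((D.J (S + d)).le_opNorm S).trans
      (mul_le_mul_of_nonneg_right (D.norm_le _) (norm_nonneg _)))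
  have hpq : (p / (p - 1)).HolderConjugate p := (Real.HolderConjugate.conjExponent hp).symm
  have h2 := Real.young_inequality_of_nonneg (Real.rpow_nonneg (norm_nonneg (S + d)) (p - 1))
    (norm_nonneg S) hpq
  have hp1 : p - 1 ≠ 0 := by linarith
  rw [← Real.rpow_mul (norm_nonneg _), mul_div_cancel₀ _ hp1] at h2
  have h3 : p * D.J (S + d) S ≤ (p - 1) * ‖S + d‖ ^ p + ‖S‖ ^ p := by
    calc _ ≤ p * (‖S + d‖ ^ p / (p / (p - 1)) + ‖S‖ ^ p / p) := by gcongr; exact h1.trans h2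
      _ = _ := by field_simp
  have h4 : D.J (S + d) S = ‖S + d‖ ^ p - D.J (S + d) d := by
    have := D.apply_self (S + d)
    rw [map_add] at this
    linarith
  have h5 : D.J (S + d) d - D.J S d ≤ D.K * (‖S + d‖ + ‖S‖) ^ (p - θ) * ‖d‖ ^ θ := by
    have h6 := D.holder (S + d) S
    rw [add_sub_cancel_left] at h6
    calc _ = (D.J (S + d) - D.J S) d := rfl
      _ ≤ ‖D.J (S + d) - D.J S‖ * ‖d‖ := (le_abs_self _).trans ((D.J (S + d) - D.J S).le_opNorm d)
      _ ≤ (D.K * (‖S + d‖ + ‖S‖) ^ (p - θ) * ‖d‖ ^ (θ - 1)) * ‖d‖ := by gcongr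
      _ = _ := by
        rw [mul_assoc, ← Real.rpow_add_one' (norm_nonneg _) (by linarith), sub_add_cancel]
  have h6 := mul_le_mul_of_nonneg_left h5 hp0.le
  rw [h4] at h3
  linarith

theorem apply_U_le (hθ : 1 < θ) (hθ2 : θ ≤ 2) (hθp : θ ≤ p) (S : X) {M A : ℝ} (j : ℕ)
    (hM : ‖S‖ ≤ M) (hA : 0 ≤ A) (hS : ∀ t, ‖R.τ t S - S‖ ≤ A * (8 ^ j * |t|)) (x : X) :
    D.J S (R.U j x) ≤ 1000000 * D.K * (2 * M) ^ (p - θ) * A ^ (θ - 1) * ‖x‖ := by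
  have hM0 : 0 ≤ M := (norm_nonneg S).trans hM
  have hK := D.K_nonneg
  refine (le_abs_self _).trans ?_
  refine (R.abs_map_conv_le (blockKernel j) (integral_blockKernel j) x (D.J S)).trans ?_
  have hbound : ∀ t, ‖D.J S (R.τ t x) - D.J S x‖ ≤
      (D.K * (2 * M) ^ (p - θ) * A ^ (θ - 1) * ‖x‖) * (1 + 8 ^ j * |t|) := by
    intro t
    have h1 : D.J S (R.τ t x) = D.J (R.τ (-t) S) x := by
      have := D.equivariant t (R.τ (-t) S) x
      rwa [← R.τ_add, add_neg_cancel, R.τ_zero] at this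
    have h2 := D.holder (R.τ (-t) S) S
    have h3 : (8 ^ j * |t|) ^ (θ - 1) ≤ 1 + 8 ^ j * |t| := by
      have h8 : (0 : ℝ) ≤ 8 ^ j * |t| := by positivity
      calc (8 ^ j * |t|) ^ (θ - 1) ≤ (1 + 8 ^ j * |t|) ^ (θ - 1) := by gcongr; linarith
        _ ≤ (1 + 8 ^ j * |t|) ^ (1 : ℝ) :=
          Real.rpow_le_rpow_of_exponent_le (by linarith) (by linarith)
        _ = _ := Real.rpow_one _
    rw [h1]
    have hSt := hS (-t)
    rw [abs_neg] at hSt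
    calc _ = ‖(D.J (R.τ (-t) S) - D.J S) x‖ := rfl
      _ ≤ ‖D.J (R.τ (-t) S) - D.J S‖ * ‖x‖ := ContinuousLinearMap.le_opNorm _ _
      _ ≤ (D.K * (‖R.τ (-t) S‖ + ‖S‖) ^ (p - θ) * ‖R.τ (-t) S - S‖ ^ (θ - 1)) * ‖x‖ := by gcongr
      _ ≤ (D.K * (2 * M) ^ (p - θ) * (A * (8 ^ j * |t|)) ^ (θ - 1)) * ‖x‖ := by
        rw [R.norm_τ]
        gcongr
        linarith
      _ = (D.K * (2 * M) ^ (p - θ) * A ^ (θ - 1) * ‖x‖) * (8 ^ j * |t|) ^ (θ - 1) := by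
        rw [Real.mul_rpow hA (by positivity)]
        ring
      _ ≤ _ := by gcongr
  calc _ ≤ ∫ t in (-π)..π, (D.K * (2 * M) ^ (p - θ) * A ^ (θ - 1) * ‖x‖) *
        (|blockKernel j t| * (1 + 8 ^ j * |t|)) := by
        refine intervalIntegral.integral_mono_on PeriodicFlow.neg_pi_le_pi
          (Continuous.intervalIntegrable ?_ _ _)
          (Continuous.intervalIntegrable (by fun_prop) _ _) fun t _ => ?_
        · have := R.cont x
          fun_prop
        · calc _ ≤ |blockKernel j t| * ((D.K * (2 * M) ^ (p - θ) * A ^ (θ - 1) * ‖x‖) *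
              (1 + 8 ^ j * |t|)) := by gcongr; exact hbound t
            _ = _ := by ring
    _ = (D.K * (2 * M) ^ (p - θ) * A ^ (θ - 1) * ‖x‖) *
        ∫ t in (-π)..π, |blockKernel j t| * (1 + 8 ^ j * |t|) :=
      intervalIntegral.integral_const_mul _ _
    _ ≤ (D.K * (2 * M) ^ (p - θ) * A ^ (θ - 1) * ‖x‖) * 1000000 := by
      gcongr
      exact integral_abs_blockKernel_mul_le j
    _ = _ := by ring

include D in
/-- Upper square-function estimate for sums of dyadic blocks. -/
theorem exists_norm_sum_U_le (hp : 1 < p) (hθ : 1 < θ) (hθ2 : θ ≤ 2) (hθp : θ ≤ p) :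
    ∃ C : ℝ, 0 < C ∧ ∀ (n : ℕ) (x : ℕ → X),
      ‖∑ j ∈ Finset.range n, R.U j (x j)‖ ^ θ ≤ C * ∑ j ∈ Finset.range n, ‖x j‖ ^ θ := by
  have hK := D.K_nonneg
  set L : ℝ := 1000000 with hL
  set H : ℝ := (2 / (1 - 1 / 8 : ℝ)) ^ θ with hH
  have hH0 : 0 ≤ H := by positivity
  set C : ℝ := p * D.K * 2 ^ (p - θ) * (L * L ^ θ * (H + 1) + L ^ θ) with hC
  have hp0 : 0 < p := by linarith
  have hC0 : 0 ≤ C := by positivity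
  refine ⟨C + 1, by linarith, fun n x => ?_⟩
  set S : ℕ → X := fun i => ∑ j ∈ Finset.range i, R.U j (x j) with hS
  obtain ⟨m, hm, hmax⟩ := (Finset.range (n + 1)).exists_max_image (fun i => ‖S i‖)
    ⟨0, by simp⟩
  set M := ‖S m‖ with hM
  have hM0 : 0 ≤ M := norm_nonneg _
  simp only [Finset.mem_range] at hm hmax
  set A : ℕ → ℝ := fun i => ∑ j ∈ Finset.range n, (1 / 8 : ℝ) ^ ((i - j) + (j - i)) * ‖x j‖
    with hA
  have hA0 : ∀ i, 0 ≤ A i := fun i => Finset.sum_nonneg fun j _ => by positivity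
  have hlip : ∀ i ≤ n, ∀ t, ‖R.τ t (S i) - S i‖ ≤ (L * A i) * (8 ^ i * |t|) := by
    intro i hi t
    simp only [hS, map_sum]
    rw [← Finset.sum_sub_distrib]
    refine (norm_sum_le _ _).trans ?_
    calc _ ≤ ∑ j ∈ Finset.range i, L * 8 ^ j * ‖x j‖ * |t| :=
          Finset.sum_le_sum fun j _ => R.norm_τ_U_sub_le j t (x j)
      _ = ∑ j ∈ Finset.range i, (L * ((1 / 8 : ℝ) ^ ((i - j) + (j - i)) * ‖x j‖)) * (8 ^ i * |t|) := by
          refine Finset.sum_congr rfl fun j hj => ?_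
          rw [Finset.mem_range] at hj
          rw [Nat.sub_eq_zero_of_le hj.le, add_zero]
          obtain ⟨k, rfl⟩ := Nat.exists_eq_add_of_le hj.le
          rw [Nat.add_sub_cancel_left, pow_add]
          have h8 : ((1 : ℝ) / 8) ^ k * 8 ^ k = 1 := by rw [← mul_pow]; norm_num
          calc _ = L * 8 ^ j * ‖x j‖ * |t| * 1 := by ring
            _ = L * 8 ^ j * ‖x j‖ * |t| * ((1 / 8) ^ k * 8 ^ k) := by rw [h8]
            _ = _ := by ring
      _ ≤ ∑ j ∈ Finset.range n, (L * ((1 / 8 : ℝ) ^ ((i - j) + (j - i)) * ‖x j‖)) * (8 ^ i * |t|) :=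
          Finset.sum_le_sum_of_subset_of_nonneg (Finset.range_mono hi) fun j _ _ => by positivity
      _ = _ := by
          rw [← Finset.sum_mul, ← Finset.mul_sum]
  have hstep : ∀ i < n, ‖S (i + 1)‖ ^ p ≤ ‖S i‖ ^ p +
      p * D.K * (2 * M) ^ (p - θ) * (L * L ^ θ * (A i ^ θ + ‖x i‖ ^ θ) + L ^ θ * ‖x i‖ ^ θ) := by
    intro i hi
    have h1 : S (i + 1) = S i + R.U i (x i) := Finset.sum_range_succ _ _
    have h2 := D.norm_add_rpow_le hp hθ (S i) (R.U i (x i))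
    have h3 := D.apply_U_le hθ hθ2 hθp (S i) i (hmax i (by omega)) (by positivity)
      (hlip i hi.le) (x i)
    rw [← h1] at h2
    have h4 : (‖S (i + 1)‖ + ‖S i‖) ^ (p - θ) ≤ (2 * M) ^ (p - θ) := by
      gcongr
      linarith [hmax i (by omega), hmax (i + 1) (by omega)]
    have h5 : ‖R.U i (x i)‖ ^ θ ≤ L ^ θ * ‖x i‖ ^ θ := by
      rw [← Real.mul_rpow (by positivity) (norm_nonneg _)]
      gcongr
      exact R.norm_U_le i (x i)
    have h6 : (L * A i) ^ (θ - 1) * ‖x i‖ ≤ L ^ θ * (A i ^ θ + ‖x i‖ ^ θ) := by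
      have hmx : 0 ≤ max (A i) ‖x i‖ := (hA0 i).trans (le_max_left _ _)
      rw [Real.mul_rpow (by positivity) (hA0 i)]
      have h7 : A i ^ (θ - 1) * ‖x i‖ ≤ A i ^ θ + ‖x i‖ ^ θ := by
        calc _ ≤ (max (A i) ‖x i‖) ^ (θ - 1) * max (A i) ‖x i‖ := by
              gcongr
              · exact le_max_left _ _
              · exact le_max_right _ _
          _ = (max (A i) ‖x i‖) ^ θ := by
              rw [← Real.rpow_add_one' hmx (by linarith), sub_add_cancel]
          _ ≤ _ := by
              have := Real.rpow_nonneg (hA0 i) θ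
              have := Real.rpow_nonneg (norm_nonneg (x i)) θ
              rcases max_cases (A i) ‖x i‖ with h | h <;> rw [h.1] <;> linarith
      have h8 : L ^ (θ - 1) ≤ L ^ θ :=
        Real.rpow_le_rpow_of_exponent_le (by norm_num [hL]) (by linarith)
      calc _ = L ^ (θ - 1) * (A i ^ (θ - 1) * ‖x i‖) := by ring
        _ ≤ _ := by
          have := Real.rpow_nonneg (hA0 i) (θ - 1)
          gcongr
    have hMp : 0 ≤ (2 * M) ^ (p - θ) := by positivity
    calc _ ≤ _ := h2
      _ ≤ ‖S i‖ ^ p + p * (L * D.K * (2 * M) ^ (p - θ) * (L * A i) ^ (θ - 1) * ‖x i‖) +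
          p * D.K * (2 * M) ^ (p - θ) * (L ^ θ * ‖x i‖ ^ θ) := by gcongr
      _ = ‖S i‖ ^ p + p * L * D.K * (2 * M) ^ (p - θ) * ((L * A i) ^ (θ - 1) * ‖x i‖) +
          p * D.K * (2 * M) ^ (p - θ) * (L ^ θ * ‖x i‖ ^ θ) := by ring
      _ ≤ ‖S i‖ ^ p + p * L * D.K * (2 * M) ^ (p - θ) * (L ^ θ * (A i ^ θ + ‖x i‖ ^ θ)) +
          p * D.K * (2 * M) ^ (p - θ) * (L ^ θ * ‖x i‖ ^ θ) := by gcongr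
      _ = _ := by ring
  have hS0 : S 0 = 0 := by simp [hS]
  have htel : ‖S m‖ ^ p ≤ ∑ i ∈ Finset.range n,
      p * D.K * (2 * M) ^ (p - θ) * (L * L ^ θ * (A i ^ θ + ‖x i‖ ^ θ) + L ^ θ * ‖x i‖ ^ θ) := by
    have h1 : ∀ k ≤ n, ‖S k‖ ^ p ≤ ∑ i ∈ Finset.range k,
        p * D.K * (2 * M) ^ (p - θ) * (L * L ^ θ * (A i ^ θ + ‖x i‖ ^ θ) + L ^ θ * ‖x i‖ ^ θ) := by
      intro k
      induction k with
      | zero => intro _; simp [hS0, Real.zero_rpow hp0.ne']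
      | succ k ih =>
        intro hk
        rw [Finset.sum_range_succ]
        linarith [ih (by omega), hstep k (by omega)]
    refine (h1 m (by omega)).trans (Finset.sum_le_sum_of_subset_of_nonneg
      (Finset.range_mono (by omega)) fun i _ _ => ?_)
    have := Real.rpow_nonneg (hA0 i) θ
    positivity
  set Q := ∑ j ∈ Finset.range n, ‖x j‖ ^ θ with hQ
  have hQ0 : 0 ≤ Q := Finset.sum_nonneg fun j _ => by positivity
  have hhardy : ∑ i ∈ Finset.range n, A i ^ θ ≤ H * Q :=
    hardy_geometric (by norm_num) (by norm_num) hθ.le n (fun j => ‖x j‖) fun j => norm_nonneg _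
  have hfin : M ^ p ≤ C * M ^ (p - θ) * Q := by
    refine htel.trans ?_
    rw [← Finset.mul_sum, Finset.sum_add_distrib, ← Finset.mul_sum, Finset.sum_add_distrib,
      ← Finset.mul_sum, ← hQ]
    calc _ ≤ p * D.K * (2 * M) ^ (p - θ) * (L * L ^ θ * (H * Q + Q) + L ^ θ * Q) := by gcongr
      _ = _ := by
        rw [Real.mul_rpow (by norm_num) hM0, hC]
        ring
  have hMθ : M ^ θ ≤ (C + 1) * Q := by
    rcases hM0.eq_or_lt with h | h
    · rw [← h, Real.zero_rpow (by linarith)]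
      positivity
    · have h1 : 0 < M ^ (p - θ) := Real.rpow_pos_of_pos h _
      have h2 : M ^ p = M ^ (p - θ) * M ^ θ := by rw [← Real.rpow_add h]; ring_nf
      rw [h2] at hfin
      have h3 : M ^ θ ≤ C * Q := by
        refine le_of_mul_le_mul_left ?_ h1
        calc _ ≤ _ := hfin
          _ = _ := by ring
      linarith
  refine le_trans ?_ hMθ
  gcongr
  exact hmax n (by omega)

end DualityMap

/-- A contractive pairing between two spaces with flows, norming on the left. -/
structure FlowPairing (R : PeriodicFlow X) (R' : PeriodicFlow X') where
  pair : X' →L[ℝ] X →L[ℝ] ℝ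
  norm_le : ∀ z x, |pair z x| ≤ ‖z‖ * ‖x‖
  adjoint : ∀ t z x, pair z (R.τ t x) = pair (R'.τ (-t) z) x
  norming : ∀ x, ∃ z, ‖z‖ ≤ 1 ∧ pair z x = ‖x‖

namespace FlowPairing

variable {R : PeriodicFlow X} {R' : PeriodicFlow X'} (P : FlowPairing R R')

theorem pair_conv (v : C(ℝ, ℝ)) (hv : ∀ t, v (-t) = v t) (z : X') (x : X) :
    P.pair z (R.conv v x) = P.pair (R'.conv v z) x := by
  have h1 : P.pair z (R.conv v x) = ∫ t in (-π)..π, v t * P.pair z (R.τ t x) := by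
    rw [PeriodicFlow.conv, map_strongIntegral]
    simp
  have h2 : P.pair (R'.conv v z) x = ∫ t in (-π)..π, v t * P.pair (R'.τ t z) x := by
    have : P.pair (R'.conv v z) x = P.pair.flip x (R'.conv v z) := rfl
    rw [this, PeriodicFlow.conv, map_strongIntegral]
    simp
  rw [h1, h2]
  have := intervalIntegral.integral_comp_neg (a := -π) (b := π)
    (fun t => v t * P.pair (R'.τ t z) x)
  rw [neg_neg] at this
  rw [← this]
  simp only [hv, P.adjoint]

include P in
/-- Lower square-function estimate, by duality. -/
theorem exists_sum_norm_U_le {p θ : ℝ} (D : DualityMap R' p θ) (hp : 1 < p) (hθ : 1 < θ)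
    (hθ2 : θ ≤ 2) (hθp : θ ≤ p) {σ : ℝ} (hσ : σ.HolderConjugate θ) :
    ∃ C : ℝ, 0 < C ∧ ∀ (n : ℕ) (x : X),
      ∑ j ∈ Finset.range n, ‖R.U j x‖ ^ σ ≤ C * ‖x‖ ^ σ := by
  obtain ⟨C, hC0, hC⟩ := D.exists_norm_sum_U_le hp hθ hθ2 hθp
  have hσ0 : 0 < σ := hσ.pos
  have hσ1 : 1 < σ := hσ.lt
  have hθ0 : 0 < θ := by linarith
  refine ⟨C ^ (σ / θ), by positivity, fun n x => ?_⟩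
  choose z hz1 hz2 using fun j => P.norming (R.U j x)
  set T := ∑ j ∈ Finset.range n, ‖R.U j x‖ ^ σ with hT
  have hT0 : 0 ≤ T := Finset.sum_nonneg fun j _ => by positivity
  set h : ℕ → X' := fun j => ‖R.U j x‖ ^ (σ - 1) • z j with hh
  have h1 : T = P.pair (∑ j ∈ Finset.range n, R'.U j (h j)) x := by
    rw [map_sum, sum_apply]
    refine Finset.sum_congr rfl fun j _ => ?_
    have hadj : P.pair (R'.U j (h j)) x = P.pair (h j) (R.U j x) :=
      (P.pair_conv _ (blockKernel_even j) _ _).symm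
    rw [hadj, hh]
    simp only [map_smul, smul_apply, smul_eq_mul]
    rw [hz2, ← Real.rpow_add_one' (norm_nonneg _) (by linarith), sub_add_cancel]
  have h2 : ‖∑ j ∈ Finset.range n, R'.U j (h j)‖ ^ θ ≤ C * T := by
    refine (hC n h).trans (mul_le_mul_of_nonneg_left (Finset.sum_le_sum fun j _ => ?_) hC0.le)
    have h3 : ‖h j‖ ≤ ‖R.U j x‖ ^ (σ - 1) := by
      rw [hh, norm_smul, Real.norm_of_nonneg (by positivity)]
      exact mul_le_of_le_one_right (by positivity) (hz1 j)
    calc ‖h j‖ ^ θ ≤ (‖R.U j x‖ ^ (σ - 1)) ^ θ := by gcongr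
      _ = _ := by
        rw [← Real.rpow_mul (norm_nonneg _), hσ.sub_one_mul_conj]
  have h3 : T ≤ ‖∑ j ∈ Finset.range n, R'.U j (h j)‖ * ‖x‖ := by
    conv_lhs => rw [h1]
    exact (le_abs_self _).trans (P.norm_le _ _)
  have h4 : T ^ θ ≤ C * T * ‖x‖ ^ θ := by
    calc T ^ θ ≤ (‖∑ j ∈ Finset.range n, R'.U j (h j)‖ * ‖x‖) ^ θ := by gcongr
      _ = ‖∑ j ∈ Finset.range n, R'.U j (h j)‖ ^ θ * ‖x‖ ^ θ :=
        Real.mul_rpow (norm_nonneg _) (norm_nonneg _)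
      _ ≤ _ := by gcongr
  rcases hT0.eq_or_lt with h5 | h5
  · rw [← h5]
    positivity
  · have h6 : T ^ (θ - 1) ≤ C * ‖x‖ ^ θ := by
      refine le_of_mul_le_mul_right ?_ h5
      rw [← Real.rpow_add_one h5.ne', sub_add_cancel]
      linarith
    have hc : (θ - 1) * (σ / θ) = 1 := by
      have := hσ.symm.sub_one_mul_conj
      rw [← mul_div_assoc, this, div_self hθ0.ne']
    calc T = (T ^ (θ - 1)) ^ (σ / θ) := by rw [← Real.rpow_mul hT0, hc, Real.rpow_one]
      _ ≤ (C * ‖x‖ ^ θ) ^ (σ / θ) := by gcongr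
      _ = _ := by
        rw [Real.mul_rpow hC0.le (by positivity), ← Real.rpow_mul (norm_nonneg _),
          mul_div_cancel₀ _ hθ0.ne']

end FlowPairing

end SquareFunction

section Coefficients

/-- The coefficients of the fractional difference of order `α`. -/
def diffCoeff (α : ℝ) (ν : ℕ) : ℝ := (-1 : ℝ) ^ ν * fracBinom α ν

theorem fracBinom_eq_choose (α : ℝ) (ν : ℕ) : fracBinom α ν = Ring.choose α ν := by
  induction ν with
  | zero => simp [fracBinom]
  | succ n ih =>
    have h : ∀ k : ℕ, (k.factorial : ℝ) * Ring.choose α k = (descPochhammer ℤ k).smeval α :=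
      fun k => by rw [Ring.descPochhammer_eq_factorial_smul_choose, nsmul_eq_mul]
    have h1 := h n
    have h2 := h (n + 1)
    rw [descPochhammer_succ_right, Polynomial.smeval_mul, ← h1, Nat.factorial_succ,
      Polynomial.smeval_sub, Polynomial.smeval_X, Polynomial.smeval_natCast] at h2
    have hn : (n.factorial : ℝ) ≠ 0 := by exact_mod_cast n.factorial_ne_zero
    rw [fracBinom, ih]
    have hn1 : (n : ℝ) + 1 ≠ 0 := by positivity
    field_simp
    push_cast at h2
    refine mul_left_cancel₀ hn ?_
    simp at h2
    linarith

theorem diffCoeff_zero (α : ℝ) : diffCoeff α 0 = 1 := by simp [diffCoeff, fracBinom]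

theorem diffCoeff_succ (α : ℝ) (ν : ℕ) :
    diffCoeff α (ν + 1) = diffCoeff α ν * ((ν - α) / (ν + 1)) := by
  simp only [diffCoeff, fracBinom, pow_succ]
  ring

theorem diffCoeff_pascal (α : ℝ) (ν : ℕ) :
    diffCoeff (α + 1) (ν + 1) = diffCoeff α (ν + 1) - diffCoeff α ν := by
  simp only [diffCoeff, fracBinom_eq_choose, Ring.choose_succ_succ, pow_succ]
  ring

theorem diffCoeff_vandermonde (α β : ℝ) (n : ℕ) :
    diffCoeff (α + β) n = ∑ ij ∈ Finset.HasAntidiagonal.antidiagonal n, diffCoeff α ij.1 * diffCoeff β ij.2 := by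
  simp only [diffCoeff, fracBinom_eq_choose]
  rw [Ring.add_choose_eq n (Commute.all α β), Finset.mul_sum]
  refine Finset.sum_congr rfl fun ij hij => ?_
  rw [Finset.HasAntidiagonal.mem_antidiagonal] at hij
  rw [← hij, pow_add]
  ring

theorem diffCoeff_zero_succ (ν : ℕ) : diffCoeff 0 (ν + 1) = 0 := by
  simp only [diffCoeff, fracBinom_eq_choose, Ring.choose_zero_succ, mul_zero]

theorem diffCoeff_succ_nonpos {α : ℝ} (h0 : 0 < α) (h1 : α < 1) (ν : ℕ) :
    diffCoeff α (ν + 1) ≤ 0 := by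
  induction ν with
  | zero =>
    rw [diffCoeff_succ, diffCoeff_zero]
    simp
    exact h0.le
  | succ n ih =>
    rw [diffCoeff_succ]
    refine mul_nonpos_of_nonpos_of_nonneg ih (div_nonneg ?_ (by positivity))
    push_cast
    have : (0 : ℝ) ≤ n := by positivity
    linarith

theorem hasSum_diffCoeff_mul_pow (α : ℝ) {r : ℝ} (h0 : 0 ≤ r) (h1 : r < 1) :
    HasSum (fun ν => diffCoeff α ν * r ^ ν) ((1 - r) ^ α) := by
  have h := (Real.one_add_rpow_hasFPowerSeriesOnBall_zero (a := α)).hasSum (y := -r) (by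
    rw [Metric.mem_eball, edist_zero_right, enorm_neg]
    rw [← ofReal_norm, Real.norm_of_nonneg h0]
    exact ENNReal.ofReal_lt_one.2 h1)
  simp only [zero_add, binomialSeries_apply, List.ofFn_const, List.prod_replicate, smul_eq_mul] at h
  rw [← sub_eq_add_neg] at h
  refine (funext fun ν => ?_ : (fun ν => diffCoeff α ν * r ^ ν) = _) ▸ h
  rw [diffCoeff, fracBinom_eq_choose, neg_pow]
  ring

theorem abs_diffCoeff_mul {α : ℝ} (h0 : 0 < α) (h1 : α < 1) (ν : ℕ) :
    |diffCoeff α ν| = (if ν = 0 then 2 else 0) - diffCoeff α ν := by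
  cases ν with
  | zero => simp [diffCoeff_zero]; norm_num
  | succ n => simp [abs_of_nonpos (diffCoeff_succ_nonpos h0 h1 n)]

theorem hasSum_abs_diffCoeff_mul_pow {α r : ℝ} (hα0 : 0 < α) (hα1 : α < 1) (h0 : 0 ≤ r)
    (h1 : r < 1) : HasSum (fun ν => |diffCoeff α ν| * r ^ ν) (2 - (1 - r) ^ α) := by
  have h2 := (hasSum_ite_eq (0 : ℕ) (2 : ℝ)).sub (hasSum_diffCoeff_mul_pow α h0 h1)
  refine (funext fun ν => ?_ : (fun ν => |diffCoeff α ν| * r ^ ν) = _) ▸ h2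
  rw [abs_diffCoeff_mul hα0 hα1]
  split_ifs with h
  · simp [h]
  · ring

theorem sum_abs_diffCoeff_le {α : ℝ} (hα0 : 0 < α) (hα1 : α < 1) (N : ℕ) :
    ∑ ν ∈ Finset.range N, |diffCoeff α ν| ≤ 2 := by
  have hlim : Filter.Tendsto (fun r : ℝ => ∑ ν ∈ Finset.range N, |diffCoeff α ν| * r ^ ν)
      (nhdsWithin 1 (Set.Iio 1)) (nhds (∑ ν ∈ Finset.range N, |diffCoeff α ν| * 1 ^ ν)) :=
    (Continuous.tendsto (by fun_prop) 1).mono_left nhdsWithin_le_nhds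
  simp only [one_pow, mul_one] at hlim
  refine le_of_tendsto hlim ?_
  filter_upwards [Ico_mem_nhdsLT (zero_lt_one' ℝ)] with r hr
  have h := hasSum_abs_diffCoeff_mul_pow hα0 hα1 hr.1 hr.2
  refine (h.summable.sum_le_tsum _ fun ν _ => mul_nonneg (abs_nonneg _) (pow_nonneg hr.1 _)).trans ?_
  rw [h.tsum_eq]
  have := Real.rpow_nonneg (sub_nonneg.2 hr.2.le) α
  linarith

theorem summable_diffCoeff_of_lt_one {α : ℝ} (hα0 : 0 < α) (hα1 : α < 1) :
    Summable fun ν => |diffCoeff α ν| :=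
  summable_of_sum_range_le (fun _ => abs_nonneg _) (sum_abs_diffCoeff_le hα0 hα1)

theorem tsum_abs_diffCoeff_mul_le {α r : ℝ} (hα0 : 0 < α) (hα1 : α < 1) (h0 : 0 ≤ r) (h1 : r ≤ 1) :
    ∑' ν, |diffCoeff α ν| * (1 - r ^ ν) ≤ (1 - r) ^ α := by
  rcases h1.eq_or_lt with rfl | h1
  · simp [Real.zero_rpow hα0.ne']
  have hs := summable_diffCoeff_of_lt_one hα0 hα1
  have h := hasSum_abs_diffCoeff_mul_pow hα0 hα1 h0 h1
  have h2 : ∑' ν, |diffCoeff α ν| ≤ 2 := hs.tsum_le_of_sum_range_le (sum_abs_diffCoeff_le hα0 hα1)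
  simp only [mul_sub, mul_one]
  rw [hs.tsum_sub h.summable, h.tsum_eq]
  linarith

theorem summable_abs_diffCoeff {α : ℝ} (hα : 0 ≤ α) : Summable fun ν => |diffCoeff α ν| := by
  have key : ∀ k : ℕ, ∀ β : ℝ, 0 ≤ β → β < 1 → Summable fun ν => |diffCoeff (β + k) ν| := by
    intro k
    induction k with
    | zero =>
      intro β h0 h1
      rw [Nat.cast_zero, add_zero]
      rcases h0.eq_or_lt with rfl | h0
      · rw [← summable_nat_add_iff 1]
        simp [diffCoeff_zero_succ, summable_zero]
      · exact summable_diffCoeff_of_lt_one h0 h1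
    | succ k ih =>
      intro β h0 h1
      have h := ih β h0 h1
      rw [← summable_nat_add_iff 1]
      refine Summable.of_nonneg_of_le (fun _ => abs_nonneg _) (fun ν => ?_)
        (((summable_nat_add_iff 1).2 h).add h)
      push_cast
      rw [← add_assoc, diffCoeff_pascal]
      exact abs_sub _ _
  have := key ⌊α⌋₊ (α - ⌊α⌋₊) (sub_nonneg.2 (Nat.floor_le hα))
    (by linarith [Nat.lt_floor_add_one α])
  rwa [sub_add_cancel] at this

theorem summable_diffCoeff {α : ℝ} (hα : 0 ≤ α) : Summable (diffCoeff α) :=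
  (summable_abs_diffCoeff hα).of_abs

theorem tsum_diffCoeff_of_lt_one {α : ℝ} (hα0 : 0 < α) (hα1 : α < 1) : ∑' ν, diffCoeff α ν = 0 := by
  have hs := summable_diffCoeff hα0.le
  have hsa := summable_diffCoeff_of_lt_one hα0 hα1
  have key : ∀ r ∈ Set.Ico (0 : ℝ) 1, |∑' ν, diffCoeff α ν| ≤ 2 * (1 - r) ^ α := by
    intro r hr
    have h := hasSum_diffCoeff_mul_pow α hr.1 hr.2
    have h' := hasSum_abs_diffCoeff_mul_pow hα0 hα1 hr.1 hr.2
    have h1 : ∑' ν, diffCoeff α ν - (1 - r) ^ α = ∑' ν, diffCoeff α ν * (1 - r ^ ν) := by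
      simp only [mul_sub, mul_one]
      rw [hs.tsum_sub h.summable, h.tsum_eq]
    have h2 : Summable fun ν => |diffCoeff α ν * (1 - r ^ ν)| := by
      refine (hsa.sub h'.summable).congr fun ν => ?_
      rw [abs_mul, abs_of_nonneg (sub_nonneg.2 (pow_le_one₀ hr.1 hr.2.le)), mul_sub, mul_one]
    have h3 : |∑' ν, diffCoeff α ν * (1 - r ^ ν)| ≤ (1 - r) ^ α := by
      have := norm_tsum_le_tsum_norm (f := fun ν => diffCoeff α ν * (1 - r ^ ν)) h2
      refine this.trans (le_trans (le_of_eq (tsum_congr fun ν => ?_))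
        (tsum_abs_diffCoeff_mul_le hα0 hα1 hr.1 hr.2.le))
      rw [Real.norm_eq_abs, abs_mul, abs_of_nonneg (sub_nonneg.2 (pow_le_one₀ hr.1 hr.2.le))]
    rw [← h1] at h3
    have h4 := Real.rpow_nonneg (sub_nonneg.2 hr.2.le) α
    rw [abs_le] at h3 ⊢
    constructor <;> linarith
  have hlim : Filter.Tendsto (fun r : ℝ => 2 * (1 - r) ^ α) (nhdsWithin 1 (Set.Iio 1))
      (nhds (2 * (1 - 1) ^ α)) := by
    refine (Continuous.tendsto ?_ 1).mono_left nhdsWithin_le_nhds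
    exact continuous_const.mul
      ((Real.continuous_rpow_const hα0.le).comp (continuous_const.sub continuous_id))
  rw [sub_self, Real.zero_rpow hα0.ne', mul_zero] at hlim
  have := ge_of_tendsto hlim (Filter.eventually_of_mem (Ico_mem_nhdsLT (zero_lt_one' ℝ)) key)
  exact abs_eq_zero.1 (le_antisymm this (abs_nonneg _))

theorem tsum_diffCoeff {α : ℝ} (hα : 0 < α) : ∑' ν, diffCoeff α ν = 0 := by
  rcases lt_or_ge α 1 with h | h
  · exact tsum_diffCoeff_of_lt_one hα h
  · have h1 : 0 ≤ α - 1 := by linarith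
    have hs := summable_diffCoeff h1
    have hs' := summable_diffCoeff hα.le
    rw [hs'.tsum_eq_zero_add, diffCoeff_zero]
    have h2 : ∀ ν, diffCoeff α (ν + 1) = diffCoeff (α - 1) (ν + 1) - diffCoeff (α - 1) ν := by
      intro ν
      have := diffCoeff_pascal (α - 1) ν
      rwa [sub_add_cancel] at this
    simp only [h2]
    rw [((summable_nat_add_iff 1).2 hs).tsum_sub hs, hs.tsum_eq_zero_add, diffCoeff_zero]
    ring

end Coefficients

section FractionalDifference

/-- The `ℓ₁` norm of the coefficients of the fractional difference of order `α`. -/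
def diffNorm (α : ℝ) : ℝ := ∑' ν, |diffCoeff α ν|

theorem diffNorm_nonneg (α : ℝ) : 0 ≤ diffNorm α := tsum_nonneg fun _ => abs_nonneg _

theorem diffNorm_le_two {α : ℝ} (hα0 : 0 < α) (hα1 : α < 1) : diffNorm α ≤ 2 :=
  (summable_diffCoeff_of_lt_one hα0 hα1).tsum_le_of_sum_range_le (sum_abs_diffCoeff_le hα0 hα1)

theorem min_two_mul_le {s : ℝ} (h0 : 0 ≤ s) (h1 : s ≤ 1) (ν : ℕ) :
    min 2 (ν * s) ≤ 4 * (1 - (1 - s) ^ ν) := by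
  have hν : (0 : ℝ) ≤ ν * s := by positivity
  have h2 : (1 - s) ^ ν * (1 + ν * s) ≤ 1 := by
    calc (1 - s) ^ ν * (1 + ν * s) ≤ (1 - s) ^ ν * (1 + s) ^ ν :=
          mul_le_mul_of_nonneg_left (one_add_mul_le_pow (by linarith) ν)
            (pow_nonneg (by linarith) _)
      _ = (1 - s ^ 2) ^ ν := by
          rw [← mul_pow]
          ring
      _ ≤ 1 := pow_le_one₀ (by nlinarith) (by nlinarith)
  have h3 : (0 : ℝ) ≤ (1 - s) ^ ν := pow_nonneg (by linarith) _
  rcases le_total (ν * s) 1 with h | h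
  · refine (min_le_right _ _).trans ?_
    nlinarith
  · refine (min_le_left _ _).trans ?_
    nlinarith

namespace PeriodicFlow

variable {X : Type*} [NormedAddCommGroup X] [NormedSpace ℝ X] (R : PeriodicFlow X)

/-- The fractional difference of order `α` with step `h` along the flow, up to the isometry
`R.τ (α * h)`. -/
def diffOp (α h : ℝ) : X →L[ℝ] X := ∑' ν : ℕ, diffCoeff α ν • R.τ (-(ν * h))

theorem norm_smul_τ_le (c t : ℝ) : ‖c • R.τ t‖ ≤ |c| := by
  rw [norm_smul, Real.norm_eq_abs]
  exact mul_le_of_le_one_right (abs_nonneg _) (R.opNorm_τ_le t)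

theorem summable_norm_diffOp {α : ℝ} (hα : 0 ≤ α) (h : ℝ) :
    Summable fun ν : ℕ => ‖diffCoeff α ν • R.τ (-(ν * h))‖ :=
  Summable.of_nonneg_of_le (fun _ => norm_nonneg _) (fun _ => R.norm_smul_τ_le _ _)
    (summable_abs_diffCoeff hα)

variable [CompleteSpace X]

theorem hasSum_diffOp {α : ℝ} (hα : 0 ≤ α) (h : ℝ) (x : X) :
    HasSum (fun ν : ℕ => diffCoeff α ν • R.τ (-(ν * h)) x) (R.diffOp α h x) :=
  (R.summable_norm_diffOp hα h).of_norm.hasSum.mapL (ContinuousLinearMap.apply ℝ X x)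

theorem norm_diffOp_le {α : ℝ} (hα : 0 ≤ α) (h : ℝ) (x : X) :
    ‖R.diffOp α h x‖ ≤ diffNorm α * ‖x‖ := by
  have hs := (summable_abs_diffCoeff hα).mul_right ‖x‖
  have hs' : ∀ ν : ℕ, ‖diffCoeff α ν • R.τ (-(ν * h)) x‖ = |diffCoeff α ν| * ‖x‖ := fun ν => by
    rw [norm_smul, R.norm_τ, Real.norm_eq_abs]
  rw [← (R.hasSum_diffOp hα h x).tsum_eq, diffNorm, ← tsum_mul_right]
  refine (norm_tsum_le_tsum_norm ?_).trans (le_of_eq (tsum_congr hs'))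
  simpa only [hs'] using hs

variable {R} in
theorem Commutes.diffOp {B : X →L[ℝ] X} (hB : R.Commutes B) {α : ℝ} (hα : 0 ≤ α) (h : ℝ) (x : X) :
    B (R.diffOp α h x) = R.diffOp α h (B x) := by
  refine ((R.hasSum_diffOp hα h x).mapL B).unique ?_
  simpa only [map_smul, hB _ x] using R.hasSum_diffOp hα h (B x)

theorem diffOp_add {α β : ℝ} (hα : 0 ≤ α) (hβ : 0 ≤ β) (h : ℝ) (x : X) :
    R.diffOp (α + β) h x = R.diffOp α h (R.diffOp β h x) := by
  have h1 := tsum_mul_tsum_eq_tsum_sum_antidiagonal_of_summable_norm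
    (R.summable_norm_diffOp hα h) (R.summable_norm_diffOp hβ h)
  have h2 : R.diffOp α h * R.diffOp β h = R.diffOp (α + β) h := by
    rw [diffOp, diffOp, h1, diffOp]
    refine tsum_congr fun n => ?_
    rw [diffCoeff_vandermonde, Finset.sum_smul]
    refine Finset.sum_congr rfl fun ij hij => ?_
    rw [Finset.HasAntidiagonal.mem_antidiagonal] at hij
    ext y
    simp only [mul_apply_eq_comp, smul_apply, map_smul, smul_smul]
    rw [← R.τ_add, ← hij]
    have h3 : -(ij.1 * h) + -(ij.2 * h) = -(((ij.1 + ij.2 : ℕ) : ℝ) * h) := by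
      push_cast
      ring
    rw [h3, mul_comm (diffCoeff β _)]
  rw [← h2]
  rfl

theorem diffOp_zero (h : ℝ) (x : X) : R.diffOp 0 h x = x := by
  refine (R.hasSum_diffOp le_rfl h x).unique ?_
  have := hasSum_single (f := fun ν : ℕ => diffCoeff 0 ν • R.τ (-(ν * h)) x) 0 (fun ν hν => by
    obtain ⟨k, rfl⟩ := Nat.exists_eq_succ_of_ne_zero hν
    simp [diffCoeff_zero_succ])
  simpa [diffCoeff_zero, R.τ_zero] using this

theorem diffOp_one (h : ℝ) (x : X) : R.diffOp 1 h x = x - R.τ (-h) x := by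
  refine (R.hasSum_diffOp zero_le_one h x).unique ?_
  have h0 : ∀ ν, diffCoeff 1 (ν + 1) = diffCoeff 0 (ν + 1) - diffCoeff 0 ν := fun ν => by
    simpa using diffCoeff_pascal 0 ν
  have : HasSum _ _ := hasSum_sum_of_ne_finset_zero (f := fun ν : ℕ => diffCoeff 1 ν • R.τ (-(ν * h)) x)
    (s := Finset.range 2) (fun ν hν => by
      rw [Finset.mem_range, not_lt] at hν
      obtain ⟨k, rfl⟩ := Nat.exists_eq_add_of_le' hν
      rw [show k + 2 = k + 1 + 1 from rfl, h0, diffCoeff_zero_succ, diffCoeff_zero_succ]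
      simp)
  simpa [Finset.sum_range_succ, diffCoeff_zero, h0, diffCoeff_zero_succ, R.τ_zero,
    sub_eq_add_neg] using this

theorem continuous_diffOp {α : ℝ} (hα : 0 ≤ α) (x : X) : Continuous fun h => R.diffOp α h x := by
  have h1 : (fun h => R.diffOp α h x) = fun h => ∑' ν : ℕ, diffCoeff α ν • R.τ (-(ν * h)) x :=
    funext fun h => (R.hasSum_diffOp hα h x).tsum_eq.symm
  rw [h1]
  refine continuous_tsum (fun ν => ?_) ((summable_abs_diffCoeff hα).mul_right ‖x‖) fun ν h => ?_
  · exact continuous_const.smul ((R.cont x).comp (by fun_prop))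
  · rw [norm_smul, R.norm_τ, Real.norm_eq_abs]

variable {R}

theorem norm_diffOp_le_of_lipschitz_of_lt_one {α L : ℝ} (hα0 : 0 < α) (hα1 : α < 1) (hL : 0 ≤ L)
    {g : X} (hg : ∀ t, ‖R.τ t g - g‖ ≤ L * |t| * ‖g‖) (h : ℝ) :
    ‖R.diffOp α h g‖ ≤ 4 * (L * |h|) ^ α * ‖g‖ := by
  set s := L * |h| with hs
  have hs0 : 0 ≤ s := by positivity
  rcases le_total 1 s with h1 | h1
  · calc ‖R.diffOp α h g‖ ≤ diffNorm α * ‖g‖ := R.norm_diffOp_le hα0.le h g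
      _ ≤ 4 * 1 * ‖g‖ := by
        gcongr
        linarith [diffNorm_le_two hα0 hα1]
      _ ≤ 4 * s ^ α * ‖g‖ := by
        gcongr
        exact Real.one_le_rpow h1 hα0.le
  · have h2 : HasSum (fun ν : ℕ => diffCoeff α ν • (R.τ (-(ν * h)) g - g)) (R.diffOp α h g) := by
      have h3 := (summable_diffCoeff hα0.le).hasSum.smul_const g
      rw [tsum_diffCoeff hα0, zero_smul] at h3
      simpa only [smul_sub, sub_zero] using (R.hasSum_diffOp hα0.le h g).sub h3
    have h4 : ∀ ν : ℕ, ‖diffCoeff α ν • (R.τ (-(ν * h)) g - g)‖ ≤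
        |diffCoeff α ν| * (1 - (1 - s) ^ ν) * (4 * ‖g‖) := by
      intro ν
      rw [norm_smul, Real.norm_eq_abs]
      have h5 : ‖R.τ (-(ν * h)) g - g‖ ≤ min 2 (ν * s) * ‖g‖ := by
        rw [min_mul_of_nonneg _ _ (norm_nonneg _)]
        refine le_min ?_ ((hg _).trans (le_of_eq ?_))
        · refine (norm_sub_le _ _).trans ?_
          rw [R.norm_τ]
          linarith
        · rw [abs_neg, abs_mul, Nat.abs_cast, hs]
          ring
      calc _ ≤ |diffCoeff α ν| * (4 * (1 - (1 - s) ^ ν) * ‖g‖) := by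
            gcongr
            exact h5.trans (by gcongr; exact min_two_mul_le hs0 h1 ν)
        _ = _ := by ring
    have h6 : Summable fun ν => |diffCoeff α ν| * (1 - (1 - s) ^ ν) := by
      refine Summable.of_nonneg_of_le (fun ν => ?_) (fun ν => ?_) (summable_abs_diffCoeff hα0.le)
      · exact mul_nonneg (abs_nonneg _)
          (sub_nonneg.2 (pow_le_one₀ (by linarith) (by linarith)))
      · exact mul_le_of_le_one_right (abs_nonneg _)
          (sub_le_self _ (pow_nonneg (by linarith) _))
    rw [← h2.tsum_eq]
    refine (tsum_of_norm_bounded (h6.mul_right (4 * ‖g‖)).hasSum h4).trans ?_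
    rw [tsum_mul_right]
    have h7 := tsum_abs_diffCoeff_mul_le hα0 hα1 (r := 1 - s) (by linarith) (by linarith)
    rw [sub_sub_cancel] at h7
    calc _ ≤ s ^ α * (4 * ‖g‖) := by gcongr
      _ = _ := by ring

/-- The Bernstein inequality for fractional differences. -/
theorem norm_diffOp_le_of_lipschitz {α L : ℝ} (hα : 0 ≤ α) (hL : 0 ≤ L) {U : X →L[ℝ] X}
    (hU : R.Commutes U) (hUL : ∀ t x, ‖R.τ t (U x) - U x‖ ≤ L * |t| * ‖x‖) {g : X}
    (hg : U g = g) (h : ℝ) : ‖R.diffOp α h g‖ ≤ 4 * (L * |h|) ^ α * ‖g‖ := by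
  have key : ∀ k : ℕ, ∀ β : ℝ, 0 ≤ β → β < 1 → ∀ g, U g = g →
      ‖R.diffOp (β + k) h g‖ ≤ 4 * (L * |h|) ^ (β + k) * ‖g‖ := by
    intro k
    induction k with
    | zero =>
      intro β h0 h1 g hg
      rw [Nat.cast_zero, add_zero]
      rcases h0.eq_or_lt with rfl | h0
      · rw [diffOp_zero, Real.rpow_zero]
        linarith [norm_nonneg g]
      · exact norm_diffOp_le_of_lipschitz_of_lt_one h0 h1 hL
          (fun t => by simpa only [hg] using hUL t g) h
    | succ k ih =>
      intro β h0 h1 g hg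
      have hβ : 0 ≤ β + k := by positivity
      push_cast
      rw [← add_assoc, R.diffOp_add hβ zero_le_one]
      have h2 : U (R.diffOp 1 h g) = R.diffOp 1 h g := by rw [hU.diffOp zero_le_one, hg]
      have h3 : ‖R.diffOp 1 h g‖ ≤ L * |h| * ‖g‖ := by
        rw [diffOp_one, norm_sub_rev]
        simpa only [hg, abs_neg] using hUL (-h) g
      have hL : 0 ≤ L * |h| := by positivity
      calc _ ≤ 4 * (L * |h|) ^ (β + k) * ‖R.diffOp 1 h g‖ := ih β h0 h1 _ h2
        _ ≤ 4 * (L * |h|) ^ (β + k) * (L * |h| * ‖g‖) := by gcongr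
        _ = 4 * (L * |h|) ^ (β + k + 1) * ‖g‖ := by
          rw [Real.rpow_add_one' hL (by positivity)]
          ring
  have := key ⌊α⌋₊ (α - ⌊α⌋₊) (sub_nonneg.2 (Nat.floor_le hα))
    (by linarith [Nat.lt_floor_add_one α]) g hg
  rwa [sub_add_cancel] at this

variable (R)

theorem norm_diffOp_le_of_U_eq {α : ℝ} (hα : 0 ≤ α) {j : ℕ} {g : X} (hg : R.U j g = g) (h : ℝ) :
    ‖R.diffOp α h g‖ ≤ 4 * (1000000 * 8 ^ j * |h|) ^ α * ‖g‖ :=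
  norm_diffOp_le_of_lipschitz hα (by positivity) (R.commutes_U j)
    (fun t x => (R.norm_τ_U_sub_le j t x).trans (le_of_eq (by ring))) hg h

omit [CompleteSpace X] in
theorem norm_τ_neg_sub (t : ℝ) (x : X) : ‖R.τ (-t) x - x‖ = ‖R.τ t x - x‖ := by
  rw [← R.norm_τ t, map_sub, ← R.τ_add, add_neg_cancel, R.τ_zero, norm_sub_rev]

omit [CompleteSpace X] in
theorem norm_τ_nat_mul_sub_le (k : ℕ) (h : ℝ) (x : X) :
    ‖R.τ (k * h) x - x‖ ≤ k * ‖R.τ h x - x‖ := by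
  induction k with
  | zero => simp [R.τ_zero]
  | succ k ih =>
    have : R.τ ((k + 1 : ℕ) * h) x - x = R.τ (k * h) (R.τ h x - x) + (R.τ (k * h) x - x) := by
      rw [map_sub, ← R.τ_add]
      push_cast
      rw [add_mul, one_mul]
      abel
    rw [this]
    refine (norm_add_le _ _).trans ?_
    rw [R.norm_τ]
    push_cast
    linarith

omit [CompleteSpace X] in
theorem norm_τ_sub_le_div (h : ℝ) (hh : h ≠ 0) (t : ℝ) (x : X) :
    ∃ ρ, |ρ| ≤ |h| ∧ ‖R.τ t x - x‖ ≤ |t| / |h| * ‖R.τ h x - x‖ + ‖R.τ ρ x - x‖ := by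
  have hh' : 0 < |h| := abs_pos.2 hh
  set k := ⌊|t| / |h|⌋₊ with hk
  have h1 : (k : ℝ) ≤ |t| / |h| := Nat.floor_le (by positivity)
  have h2 : |t| / |h| < k + 1 := Nat.lt_floor_add_one _
  rw [le_div_iff₀ hh'] at h1
  rw [div_lt_iff₀ hh'] at h2
  have habs : ∀ s, ‖R.τ |s| x - x‖ = ‖R.τ s x - x‖ := fun s => by
    rcases abs_choice s with h | h <;> simp [h, R.norm_τ_neg_sub]
  refine ⟨|t| - k * |h|, ?_, ?_⟩
  · rw [abs_le]
    constructor <;> linarith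
  · rw [← habs t, ← habs h]
    have h3 : R.τ |t| x - x = R.τ (k * |h|) (R.τ (|t| - k * |h|) x - x) +
        (R.τ (k * |h|) x - x) := by
      rw [map_sub, ← R.τ_add]
      rw [add_sub_cancel]
      abel
    rw [h3, add_comm (|t| / |h| * _)]
    refine (norm_add_le _ _).trans ?_
    rw [R.norm_τ]
    gcongr
    refine (R.norm_τ_nat_mul_sub_le k |h| x).trans ?_
    gcongr
    exact Nat.floor_le (by positivity)

theorem norm_le_diffOp_one_of_U_eq {j : ℕ} {g : X} (hg : R.U j g = g) {h : ℝ} (hh : h ≠ 0)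
    (hs : 2 * 1000000 ^ 2 * (8 ^ j * |h|) ≤ 1) :
    8 ^ j * |h| * ‖g‖ ≤ 2 * 1000000 * ‖R.diffOp 1 h g‖ := by
  have hh' : 0 < |h| := abs_pos.2 hh
  set d := ‖R.diffOp 1 h g‖ with hd
  have hd' : ‖R.τ h g - g‖ = d := by
    rw [hd, diffOp_one, norm_sub_rev g, R.norm_τ_neg_sub]
  set s := 8 ^ j * |h| with hs'
  have hs0 : 0 < s := by positivity
  have h1 := R.abs_map_conv_le (blockKernel j) (integral_blockKernel j) g
    (ContinuousLinearMap.id ℝ X)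
  have h2 : ‖g‖ ≤ (∫ t in (-π)..π, |blockKernel j t| * (1 + 8 ^ j * |t|)) *
      (d / s + 1000000 * s * ‖g‖) := by
    rw [← intervalIntegral.integral_mul_const]
    calc ‖g‖ = ‖ContinuousLinearMap.id ℝ X (R.conv (blockKernel j) g)‖ := by
          rw [ContinuousLinearMap.id_apply]
          exact congrArg norm hg.symm
      _ ≤ _ := h1
      _ ≤ _ := by
        refine intervalIntegral.integral_mono_on neg_pi_le_pi ?_ ?_ fun t _ => ?_
        · exact ((blockKernel j).continuous.abs.mul
            ((R.cont g).sub continuous_const).norm).intervalIntegrable _ _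
        · exact Continuous.intervalIntegrable (by fun_prop) _ _
        · rw [mul_assoc]
          refine mul_le_mul_of_nonneg_left ?_ (abs_nonneg _)
          obtain ⟨ρ, hρ, h3⟩ := R.norm_τ_sub_le_div h hh t g
          have h4 : ‖R.τ ρ g - g‖ ≤ 1000000 * s * ‖g‖ := by
            have := R.norm_τ_U_sub_le j ρ g
            rw [hg] at this
            refine this.trans ?_
            calc 1000000 * 8 ^ j * ‖g‖ * |ρ| ≤ 1000000 * 8 ^ j * ‖g‖ * |h| := by gcongr
              _ = _ := by
                rw [hs']
                ring
          rw [hd'] at h3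
          have h5 : |t| / |h| * d = 8 ^ j * |t| * (d / s) := by
            rw [hs']
            field_simp
          have h6 : 0 ≤ d / s := div_nonneg (norm_nonneg _) hs0.le
          have h7 : 0 ≤ 8 ^ j * |t| * (1000000 * s * ‖g‖) := by positivity
          simp only [ContinuousLinearMap.id_apply]
          rw [h5] at h3
          linarith
  have h8 : ‖g‖ ≤ 1000000 * (d / s + 1000000 * s * ‖g‖) := by
    have h6 : 0 ≤ d / s := div_nonneg (norm_nonneg _) hs0.le
    refine h2.trans (mul_le_mul_of_nonneg_right (integral_abs_blockKernel_mul_le j) ?_)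
    positivity
  have h9 : 1000000 * (1000000 * s * ‖g‖) ≤ 1 / 2 * ‖g‖ := by
    have := mul_le_mul_of_nonneg_right hs (norm_nonneg g)
    linarith
  have h10 : ‖g‖ ≤ 2 * 1000000 * (d / s) := by linarith
  calc s * ‖g‖ ≤ s * (2 * 1000000 * (d / s)) := by gcongr
    _ = _ := by field_simp

theorem pow_norm_le_diffOp_of_U_eq (r : ℕ) {j : ℕ} {g : X} (hg : R.U j g = g) {h : ℝ} (hh : h ≠ 0)
    (hs : 2 * 1000000 ^ 2 * (8 ^ j * |h|) ≤ 1) :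
    (8 ^ j * |h|) ^ r * ‖g‖ ≤ (2 * 1000000) ^ r * ‖R.diffOp r h g‖ := by
  induction r generalizing g with
  | zero => simp [diffOp_zero]
  | succ r ih =>
    have h1 : R.U j (R.diffOp 1 h g) = R.diffOp 1 h g := by
      rw [(R.commutes_U j).diffOp zero_le_one, hg]
    have h2 := R.norm_le_diffOp_one_of_U_eq hg hh hs
    have h3 := ih h1
    push_cast
    rw [R.diffOp_add (Nat.cast_nonneg r) zero_le_one]
    calc (8 ^ j * |h|) ^ (r + 1) * ‖g‖ = (8 ^ j * |h|) ^ r * (8 ^ j * |h| * ‖g‖) := by ring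
      _ ≤ (8 ^ j * |h|) ^ r * (2 * 1000000 * ‖R.diffOp 1 h g‖) := by gcongr
      _ = 2 * 1000000 * ((8 ^ j * |h|) ^ r * ‖R.diffOp 1 h g‖) := by ring
      _ ≤ 2 * 1000000 * ((2 * 1000000) ^ r * ‖R.diffOp r h (R.diffOp 1 h g)‖) := by gcongr
      _ = _ := by ring

/-- The inverse Bernstein inequality on dyadic blocks. -/
theorem rpow_norm_le_diffOp_of_U_eq {α : ℝ} (hα : 0 ≤ α) :
    ∃ C > 0, ∀ (j : ℕ) (g : X) (h : ℝ), R.U j g = g →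
      2 * 1000000 ^ 2 * (8 ^ j * |h|) ≤ 1 →
      (8 ^ j * |h|) ^ α * ‖g‖ ≤ C * ‖R.diffOp α h g‖ := by
  set r := ⌈α⌉₊
  have hr : 0 ≤ (r : ℝ) - α := sub_nonneg.2 (Nat.le_ceil α)
  refine ⟨(2 * 1000000) ^ r * (4 * 1000000 ^ ((r : ℝ) - α)) , by positivity,
    fun j g h hg hs => ?_⟩
  rcases hα.eq_or_lt with h0 | h0
  · subst h0
    rw [Real.rpow_zero, one_mul, diffOp_zero]
    refine le_mul_of_one_le_left (norm_nonneg _) ?_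
    have h1 : (1 : ℝ) ≤ (2 * 1000000) ^ r := one_le_pow₀ (by norm_num)
    have h2 : (1 : ℝ) ≤ 1000000 ^ ((r : ℝ) - 0) := Real.one_le_rpow (by norm_num) hr
    nlinarith
  rcases eq_or_ne h 0 with rfl | hh
  · rw [abs_zero, mul_zero, Real.zero_rpow h0.ne', zero_mul]
    positivity
  set s := 8 ^ j * |h| with hs'
  have hs0 : 0 < s := by
    have := abs_pos.2 hh
    positivity
  have h1 := R.pow_norm_le_diffOp_of_U_eq r hg hh hs
  have h2 : R.U j (R.diffOp α h g) = R.diffOp α h g := by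
    rw [(R.commutes_U j).diffOp hα, hg]
  have h3 := R.norm_diffOp_le_of_U_eq hr h2 h
  rw [← R.diffOp_add hr hα, sub_add_cancel, mul_assoc 1000000, ← hs',
    Real.mul_rpow (by norm_num) hs0.le] at h3
  have h4 : s ^ r = s ^ ((r : ℝ) - α) * s ^ α := by
    rw [← Real.rpow_add hs0, sub_add_cancel, Real.rpow_natCast]
  rw [← hs', h4] at h1
  have h5 : 0 < s ^ ((r : ℝ) - α) := by positivity
  refine le_of_mul_le_mul_left ?_ h5
  calc s ^ ((r : ℝ) - α) * (s ^ α * ‖g‖) ≤ (2 * 1000000) ^ r * ‖R.diffOp r h g‖ := by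
        rw [← mul_assoc]
        exact h1
    _ ≤ (2 * 1000000) ^ r * (4 * (1000000 ^ ((r : ℝ) - α) * s ^ ((r : ℝ) - α)) *
        ‖R.diffOp α h g‖) := by gcongr
    _ = _ := by ring

end PeriodicFlow

end FractionalDifference

section Averages

namespace PeriodicFlow

variable {X : Type*} [NormedAddCommGroup X] [NormedSpace ℝ X] [CompleteSpace X]
  (R : PeriodicFlow X)

/-- The average of the flow over an interval of length `s`. -/
def avg (s : ℝ) : X →L[ℝ] X :=
  strongIntegral 0 1 (fun u => R.τ (-(s * u))) fun x => (R.cont x).comp (by fun_prop)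

/-- The average over steps in `[0, L]` of the fractional differences of order `α`. -/
def avgDiff {α : ℝ} (hα : 0 ≤ α) (L : ℝ) : X →L[ℝ] X :=
  strongIntegral 0 1 (fun u => R.diffOp α (u * L)) fun x =>
    (R.continuous_diffOp hα x).comp (by fun_prop)

variable {R} in
theorem Commutes.avg {B : X →L[ℝ] X} (hB : R.Commutes B) (s : ℝ) (x : X) :
    B (R.avg s x) = R.avg s (B x) := by
  rw [PeriodicFlow.avg, map_strongIntegral, strongIntegral_apply]
  simp [hB _ x]

variable {R} in
theorem Commutes.avgDiff {B : X →L[ℝ] X} (hB : R.Commutes B) {α : ℝ} (hα : 0 ≤ α) (L : ℝ) (x : X) :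
    B (R.avgDiff hα L x) = R.avgDiff hα L (B x) := by
  rw [PeriodicFlow.avgDiff, map_strongIntegral, strongIntegral_apply]
  simp [hB.diffOp hα _ x]

theorem norm_avgDiff_le_of_forall {α : ℝ} (hα : 0 ≤ α) {L : ℝ} (hL : 0 ≤ L) {x : X} {M : ℝ}
    (hM : ∀ h, |h| ≤ L → ‖R.diffOp α h x‖ ≤ M) : ‖R.avgDiff hα L x‖ ≤ M := by
  have := intervalIntegral.norm_integral_le_of_norm_le_const (a := 0) (b := 1)
    (f := fun u => R.diffOp α (u * L) x) (C := M) (fun u hu => hM _ (by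
      rw [Set.uIoc_of_le zero_le_one] at hu
      rw [abs_of_nonneg (mul_nonneg hu.1.le hL)]
      exact mul_le_of_le_one_left hL hu.2))
  rw [sub_zero, abs_one, mul_one] at this
  exact this

theorem norm_τ_avg_sub_le {s : ℝ} (hs : 0 < s) (t : ℝ) (x : X) :
    ‖R.τ t (R.avg s x) - R.avg s x‖ ≤ 2 * |t| / s * ‖x‖ := by
  have hcont : ∀ a b : ℝ, IntervalIntegrable (fun w => R.τ w x) volume a b :=
    fun a b => (R.cont x).intervalIntegrable _ _
  have h1 : ∀ t, R.τ t (R.avg s x) = (-s)⁻¹ • ∫ w in t..(-s + t), R.τ w x := by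
    intro t
    rw [avg, map_strongIntegral]
    have h2 := intervalIntegral.integral_comp_mul_add (a := 0) (b := 1) (fun w => R.τ w x)
      (neg_ne_zero.2 hs.ne') t
    rw [mul_zero, zero_add, mul_one] at h2
    rw [← h2]
    refine intervalIntegral.integral_congr fun u _ => ?_
    rw [← R.τ_add]
    congr 2
    ring
  have h0 := h1 0
  rw [R.τ_zero, add_zero] at h0
  have hb : ∀ a b : ℝ, ‖∫ w in a..b, R.τ w x‖ ≤ ‖x‖ * |b - a| := fun a b =>
    intervalIntegral.norm_integral_le_of_norm_le_const fun w _ => (R.norm_τ w x).le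
  rw [h1, h0, ← smul_sub, intervalIntegral.integral_interval_sub_interval_comm (hcont _ _)
    (hcont _ _) (hcont _ _), norm_smul, norm_inv, norm_neg, Real.norm_eq_abs, abs_of_pos hs]
  have h3 := hb t 0
  have h4 := hb (-s + t) (-s)
  rw [zero_sub, abs_neg] at h3
  rw [show -s - (-s + t) = -t by ring, abs_neg] at h4
  calc s⁻¹ * _ ≤ s⁻¹ * (‖x‖ * |t| + ‖x‖ * |t|) := by
        gcongr
        exact (norm_sub_le _ _).trans (add_le_add h3 h4)
    _ = _ := by
      field_simp
      ring

theorem norm_avg_sub_V_le {s : ℝ} (hs : 0 < s) (j : ℕ) (x : X) :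
    ‖R.avg s x - R.V j (R.avg s x)‖ ≤ 20000 / (8 ^ j * s) * ‖x‖ := by
  refine (R.norm_sub_conv_le _ (integral_kernel j) _).trans ?_
  calc _ ≤ ∫ t in (-π)..π, |kernel j t| * (1 + 8 ^ j * |t|) * (2 / (8 ^ j * s) * ‖x‖) := by
        refine intervalIntegral.integral_mono_on neg_pi_le_pi ?_ ?_ fun t _ => ?_
        · exact ((kernel j).continuous.abs.mul
            ((R.cont _).sub continuous_const).norm).intervalIntegrable _ _
        · exact Continuous.intervalIntegrable (by fun_prop) _ _
        · rw [mul_assoc]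
          refine mul_le_mul_of_nonneg_left ?_ (abs_nonneg _)
          refine (R.norm_τ_avg_sub_le hs t x).trans ?_
          have h1 : 2 * |t| / s * ‖x‖ = 8 ^ j * |t| * (2 / (8 ^ j * s) * ‖x‖) := by field_simp
          rw [h1]
          gcongr
          linarith
    _ ≤ 10000 * (2 / (8 ^ j * s) * ‖x‖) := by
      rw [intervalIntegral.integral_mul_const]
      gcongr
      exact integral_abs_kernel_le j
    _ = _ := by ring

theorem hasSum_avgDiff {α : ℝ} (hα : 0 ≤ α) (L : ℝ) (x : X) :
    HasSum (fun ν : ℕ => diffCoeff α ν • R.avg (ν * L) x) (R.avgDiff hα L x) := by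
  have h1 := intervalIntegral.hasSum_integral_of_dominated_convergence (μ := volume) (a := 0) (b := 1)
    (F := fun (ν : ℕ) u => diffCoeff α ν • R.τ (-(ν * (u * L))) x)
    (f := fun u => R.diffOp α (u * L) x) (fun ν _ => |diffCoeff α ν| * ‖x‖)
    (fun ν => (continuous_const.smul ((R.cont x).comp (by fun_prop))).aestronglyMeasurable)
    (fun ν => Filter.Eventually.of_forall fun u _ => by
      rw [norm_smul, R.norm_τ, Real.norm_eq_abs])
    (Filter.Eventually.of_forall fun u _ => (summable_abs_diffCoeff hα).mul_right _)
    intervalIntegrable_const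
    (Filter.Eventually.of_forall fun u _ => R.hasSum_diffOp hα (u * L) x)
  refine (funext fun ν => ?_ : (fun ν : ℕ => diffCoeff α ν • R.avg (ν * L) x) = _) ▸ h1
  rw [intervalIntegral.integral_smul, avg, strongIntegral_apply]
  congr 1
  refine intervalIntegral.integral_congr fun u _ => ?_
  congr 2
  ring

/-- A Jackson-type estimate: high-frequency vectors are controlled by their averaged fractional
differences. -/
theorem norm_le_avgDiff {α : ℝ} (hα : 0 ≤ α) {L : ℝ} (hL : 0 < L) {j : ℕ} {g : X}
    (hg : R.V j g = 0) (hj : 40000 * diffNorm α ≤ 8 ^ j * L) : ‖g‖ ≤ 2 * ‖R.avgDiff hα L g‖ := by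
  have h0 := (R.hasSum_avgDiff hα L g)
  rw [← hasSum_nat_add_iff' 1] at h0
  have h1 : R.avg ((0 : ℕ) * L) g = g := by simp [avg, strongIntegral_apply, R.τ_zero]
  rw [Finset.sum_range_one, diffCoeff_zero, one_smul, h1] at h0
  have hb : ∀ ν : ℕ, ‖diffCoeff α (ν + 1) • R.avg ((ν + 1 : ℕ) * L) g‖ ≤
      |diffCoeff α (ν + 1)| * (20000 / (8 ^ j * L) * ‖g‖) := by
    intro ν
    rw [norm_smul, Real.norm_eq_abs]
    have hs : 0 < ((ν + 1 : ℕ) : ℝ) * L := by positivity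
    have h2 := R.norm_avg_sub_V_le hs j g
    have h3 : R.V j (R.avg (((ν + 1 : ℕ) : ℝ) * L) g) = 0 := by
      rw [(R.commutes_V j).avg, hg, map_zero]
    rw [h3, sub_zero] at h2
    gcongr
    refine h2.trans ?_
    gcongr
    refine le_mul_of_one_le_left hL.le ?_
    exact_mod_cast Nat.le_add_left 1 ν
  have hs := summable_abs_diffCoeff hα
  have h4 : ‖R.avgDiff hα L g - g‖ ≤ diffNorm α * (20000 / (8 ^ j * L) * ‖g‖) := by
    rw [← h0.tsum_eq]
    refine (tsum_of_norm_bounded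
      (((summable_nat_add_iff 1).2 hs).mul_right _).hasSum hb).trans ?_
    rw [tsum_mul_right]
    gcongr
    rw [diffNorm, hs.tsum_eq_zero_add]
    linarith [abs_nonneg (diffCoeff α 0)]
  have h5 : diffNorm α * (20000 / (8 ^ j * L) * ‖g‖) ≤ 1 / 2 * ‖g‖ := by
    rw [← mul_assoc]
    gcongr
    rw [mul_div_assoc', div_le_iff₀ (by positivity)]
    linarith
  have h6 : ‖g‖ ≤ ‖R.avgDiff hα L g‖ + ‖R.avgDiff hα L g - g‖ := by
    have := norm_sub_le (R.avgDiff hα L g) (R.avgDiff hα L g - g)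
    rwa [sub_sub_cancel] at this
  linarith

/-- The upper square-function estimate with exponent `θ`. -/
def UpperEstimate (θ : ℝ) : Prop := ∃ C : ℝ, 0 < C ∧ ∀ (n : ℕ) (x : ℕ → X),
  ‖∑ j ∈ Finset.range n, R.U j (x j)‖ ^ θ ≤ C * ∑ j ∈ Finset.range n, ‖x j‖ ^ θ

/-- The lower square-function estimate with exponent `σ`. -/
def LowerEstimate (σ : ℝ) : Prop := ∃ C : ℝ, 0 < C ∧ ∀ (n : ℕ) (x : X),
  ∑ j ∈ Finset.range n, ‖R.U j x‖ ^ σ ≤ C * ‖x‖ ^ σ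

/-- The dyadic blocks below `m`, completed by the high-frequency remainder. -/
def block (m j : ℕ) : X →L[ℝ] X := if j < m then R.Δ j else 1 - R.V m

theorem block_of_lt {m j : ℕ} (h : j < m) : R.block m j = R.Δ j := if_pos h

theorem block_self_apply (m : ℕ) (x : X) : R.block m m x = x - R.V m x := by
  rw [block, if_neg (lt_irrefl m)]
  rfl

variable {R} in
theorem Commutes.block {B : X →L[ℝ] X} (hB : R.Commutes B) (m j : ℕ) (x : X) :
    B (R.block m j x) = R.block m j (B x) := by
  rw [PeriodicFlow.block]
  split_ifs
  · exact hB.Δ j x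
  · simp [hB.V]

theorem sum_block (x : X) {i m : ℕ} (h : i ≤ m) :
    ∑ j ∈ Finset.Ico i (m + 1), R.block m j x = x - R.V i x := by
  rw [Finset.sum_Ico_succ_top h, block_self_apply,
    Finset.sum_congr rfl fun j hj => by rw [R.block_of_lt (Finset.mem_Ico.1 hj).2], R.sum_Δ x i m h]
  abel

theorem add_rpow_le_two_rpow_mul {a b s : ℝ} (ha : 0 ≤ a) (hb : 0 ≤ b) (hs : 0 ≤ s) :
    (a + b) ^ s ≤ 2 ^ s * (a ^ s + b ^ s) := by
  have h1 : a + b ≤ 2 * max a b := by linarith [le_max_left a b, le_max_right a b]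
  have h2 : max a b ^ s ≤ a ^ s + b ^ s := by
    rcases max_choice a b with h | h <;> rw [h]
    · exact le_add_of_nonneg_right (Real.rpow_nonneg hb _)
    · exact le_add_of_nonneg_left (Real.rpow_nonneg ha _)
  calc (a + b) ^ s ≤ (2 * max a b) ^ s := Real.rpow_le_rpow (by positivity) h1 hs
    _ = 2 ^ s * max a b ^ s := Real.mul_rpow (by norm_num) (le_max_of_le_left ha)
    _ ≤ _ := by gcongr

variable {R}

/-- The one-parameter inverse estimate. -/
theorem UpperEstimate.norm_diffOp_le {θ : ℝ} (hR : R.UpperEstimate θ) (hθ : 0 < θ) {α : ℝ}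
    (hα : 0 ≤ α) : ∃ C : ℝ, 0 < C ∧ ∀ (m : ℕ) (h : ℝ) (x : X), R.V 0 x = 0 → 8 ^ m * |h| ≤ 1 →
      ‖R.diffOp α h x‖ ^ θ ≤
        C * ∑ j ∈ Finset.range (m + 1), (8 ^ j / 8 ^ m : ℝ) ^ (α * θ) * ‖R.block m j x‖ ^ θ := by
  obtain ⟨C, hC0, hC⟩ := hR
  have hD := diffNorm_nonneg α
  set E : ℝ := 4 * 1000000 ^ α with hE
  have hE0 : 0 < E := by positivity
  refine ⟨2 ^ θ * (C * E ^ θ + diffNorm α ^ θ), by positivity, fun m h x hx hh => ?_⟩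
  set w : ℕ → ℝ := fun j => (8 ^ j / 8 ^ m : ℝ) ^ (α * θ) * ‖R.block m j x‖ ^ θ with hw
  have hw0 : ∀ j, 0 ≤ w j := fun j => by positivity
  have h1 : x = ∑ j ∈ Finset.range m, R.U j (R.Δ j x) + (x - R.V m x) := by
    have := R.sum_Δ x 0 m (Nat.zero_le _)
    rw [← Finset.range_eq_Ico, hx, sub_zero] at this
    simp only [R.U_Δ, this]
    abel
  have h2 : R.diffOp α h x = ∑ j ∈ Finset.range m, R.U j (R.diffOp α h (R.Δ j x)) +
      R.diffOp α h (x - R.V m x) := by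
    conv_lhs => rw [h1]
    rw [map_add, map_sum]
    congr 1
    exact Finset.sum_congr rfl fun j _ => ((R.commutes_U j).diffOp hα h _).symm
  have h3 : ∀ j ∈ Finset.range m, ‖R.diffOp α h (R.Δ j x)‖ ^ θ ≤ E ^ θ * w j := by
    intro j hj
    have h4 := R.norm_diffOp_le_of_U_eq hα (R.U_Δ j x) h
    have h5 : (1000000 * 8 ^ j * |h|) ^ α ≤ 1000000 ^ α * (8 ^ j / 8 ^ m : ℝ) ^ α := by
      rw [← Real.mul_rpow (by norm_num) (by positivity), mul_assoc]
      gcongr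
      rw [le_div_iff₀ (by positivity)]
      calc (8 : ℝ) ^ j * |h| * 8 ^ m = 8 ^ j * (8 ^ m * |h|) := by ring
        _ ≤ 8 ^ j * 1 := by gcongr
        _ = 8 ^ j := mul_one _
    calc ‖R.diffOp α h (R.Δ j x)‖ ^ θ ≤ (E * ((8 ^ j / 8 ^ m : ℝ) ^ α * ‖R.Δ j x‖)) ^ θ := by
          gcongr
          calc _ ≤ 4 * (1000000 ^ α * (8 ^ j / 8 ^ m : ℝ) ^ α) * ‖R.Δ j x‖ := h4.trans (by gcongr)
            _ = _ := by
              rw [hE]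
              ring
      _ = E ^ θ * w j := by
        rw [Real.mul_rpow hE0.le (by positivity), Real.mul_rpow (by positivity) (norm_nonneg _),
          ← Real.rpow_mul (by positivity), hw]
        simp only
        rw [R.block_of_lt (Finset.mem_range.1 hj)]
  have h6 : ‖R.diffOp α h (x - R.V m x)‖ ^ θ ≤ diffNorm α ^ θ * w m := by
    calc _ ≤ (diffNorm α * ‖x - R.V m x‖) ^ θ := by
          gcongr
          exact R.norm_diffOp_le hα h _
      _ = _ := by
        rw [Real.mul_rpow hD (norm_nonneg _), hw]
        simp only
        rw [div_self (by positivity), Real.one_rpow, one_mul, block_self_apply]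
  rw [h2, Finset.sum_range_succ]
  set W := ∑ j ∈ Finset.range m, w j with hW
  have hW0 : 0 ≤ W := Finset.sum_nonneg fun j _ => hw0 j
  calc _ ≤ (‖∑ j ∈ Finset.range m, R.U j (R.diffOp α h (R.Δ j x))‖ +
        ‖R.diffOp α h (x - R.V m x)‖) ^ θ := by
        gcongr
        exact norm_add_le _ _
    _ ≤ 2 ^ θ * (‖∑ j ∈ Finset.range m, R.U j (R.diffOp α h (R.Δ j x))‖ ^ θ +
        ‖R.diffOp α h (x - R.V m x)‖ ^ θ) :=
      add_rpow_le_two_rpow_mul (norm_nonneg _) (norm_nonneg _) hθ.le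
    _ ≤ 2 ^ θ * (C * (E ^ θ * W) + diffNorm α ^ θ * w m) := by
      gcongr
      refine (hC m _).trans ?_
      gcongr
      rw [hW, Finset.mul_sum]
      exact Finset.sum_le_sum h3
    _ ≤ _ := by
      have h7 := hw0 m
      have h8 : 0 ≤ diffNorm α ^ θ := Real.rpow_nonneg hD _
      rw [mul_assoc]
      gcongr
      have h9 : 0 ≤ C * E ^ θ * w m := by positivity
      have h10 : 0 ≤ diffNorm α ^ θ * W := by positivity
      linarith

/-- The one-parameter direct estimate. -/
theorem LowerEstimate.sum_norm_sub_V_le {σ : ℝ} (hR : R.LowerEstimate σ) (hσ : 1 ≤ σ) {α : ℝ}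
    (hα : 0 < α) : ∃ κ : ℝ, 8 ≤ κ ∧ ∃ ε : ℝ, 0 < ε ∧ ε ≤ 1 ∧ ∃ C : ℝ, 0 < C ∧
      ∀ (m : ℕ) (L : ℝ) (x : X), 1 ≤ m → 0 < L → R.V 0 x = 0 → κ ≤ 8 ^ m * L → 8 ^ m * L ≤ 8 * κ →
      ∑ i ∈ Finset.range (m + 1), (8 ^ i / 8 ^ m : ℝ) ^ (α * σ) * ‖x - R.V i x‖ ^ σ ≤
        C * (‖R.diffOp α (ε * L) x‖ ^ σ + ‖R.avgDiff hα.le L x‖ ^ σ) := by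
  obtain ⟨C, hC0, hC⟩ := hR
  obtain ⟨C', hC'0, hC'⟩ := R.rpow_norm_le_diffOp_of_U_eq hα.le
  have hD := diffNorm_nonneg α
  have hσ0 : 0 < σ := by linarith
  set κ : ℝ := 8 + 8 * 40000 * diffNorm α with hκ
  have hκ8 : 8 ≤ κ := by
    rw [hκ]
    linarith
  have hκ0 : 0 < κ := by linarith
  set ε : ℝ := 1 / (2 * 1000000 ^ 2 * (8 * κ)) with hε
  have hε0 : 0 < ε := by positivity
  have hε1 : ε ≤ 1 := by
    rw [hε, div_le_one (by positivity)]
    linarith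
  set G : ℝ := (2 / (1 - (8 : ℝ) ^ (-α))) ^ σ with hG
  have hr1 : (8 : ℝ) ^ (-α) < 1 := Real.rpow_lt_one_of_one_lt_of_neg (by norm_num) (by linarith)
  have hG0 : 0 < G := by
    have : 0 < 1 - (8 : ℝ) ^ (-α) := by linarith
    positivity
  set E : ℝ := C' / (ε * κ) ^ α * 20000 with hE
  have hE0 : 0 < E := by positivity
  refine ⟨κ, hκ8, ε, hε0, hε1, G * (E ^ σ * C + 20002 ^ σ), by positivity,
    fun m L x hm hL hx hmL hmL' => ?_⟩
  set a : ℕ → ℝ := fun j => (8 ^ j / 8 ^ m : ℝ) ^ α * ‖R.block m j x‖ with ha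
  have ha0 : ∀ j, 0 ≤ a j := fun j => by positivity
  have h1 : ∀ i ∈ Finset.range (m + 1), (8 ^ i / 8 ^ m : ℝ) ^ (α * σ) * ‖x - R.V i x‖ ^ σ ≤
      (∑ j ∈ Finset.range (m + 1), ((8 : ℝ) ^ (-α)) ^ ((i - j) + (j - i)) * a j) ^ σ := by
    intro i hi
    rw [Finset.mem_range_succ_iff] at hi
    rw [Real.rpow_mul (by positivity), ← Real.mul_rpow (by positivity) (norm_nonneg _)]
    refine Real.rpow_le_rpow (by positivity) ?_ hσ0.le
    rw [← R.sum_block x hi]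
    calc _ ≤ (8 ^ i / 8 ^ m : ℝ) ^ α * ∑ j ∈ Finset.Ico i (m + 1), ‖R.block m j x‖ := by
          gcongr
          exact norm_sum_le _ _
      _ = ∑ j ∈ Finset.Ico i (m + 1), ((8 : ℝ) ^ (-α)) ^ ((i - j) + (j - i)) * a j := by
        rw [Finset.mul_sum]
        refine Finset.sum_congr rfl fun j hj => ?_
        rw [ha, ← mul_assoc]
        congr 1
        have hij := (Finset.mem_Ico.1 hj).1
        rw [Nat.sub_eq_zero_of_le hij, zero_add, Real.rpow_neg (by norm_num),
          ← Real.inv_rpow (by norm_num), Real.rpow_pow_comm (by norm_num),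
          ← Real.mul_rpow (by positivity) (by positivity)]
        congr 1
        obtain ⟨d, rfl⟩ := Nat.exists_eq_add_of_le hij
        rw [Nat.add_sub_cancel_left, pow_add, inv_pow]
        field_simp
      _ ≤ _ := by
        refine Finset.sum_le_sum_of_subset_of_nonneg ?_ fun j _ _ => ?_
        · intro j hj
          exact Finset.mem_range.2 (Finset.mem_Ico.1 hj).2
        · exact mul_nonneg (by positivity) (ha0 j)
  have h2 := hardy_geometric (Real.rpow_nonneg (by norm_num : (0 : ℝ) ≤ 8) (-α)) hr1 hσ (m + 1) a ha0
  refine (Finset.sum_le_sum h1).trans (h2.trans ?_)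
  rw [← hG, mul_assoc G]
  gcongr
  rw [Finset.sum_range_succ]
  have h3 : ∀ j ∈ Finset.range m, a j ^ σ ≤ E ^ σ * ‖R.U j (R.diffOp α (ε * L) x)‖ ^ σ := by
    intro j hj
    rw [← Real.mul_rpow hE0.le (norm_nonneg _)]
    refine Real.rpow_le_rpow (ha0 j) ?_ hσ0.le
    have hjm := Finset.mem_range.1 hj
    have hεL : |ε * L| = ε * L := abs_of_pos (by positivity)
    have h4 := hC' j (R.Δ j x) (ε * L) (R.U_Δ j x) (by
      rw [hεL]
      calc 2 * 1000000 ^ 2 * (8 ^ j * (ε * L)) = 2 * 1000000 ^ 2 * ε * (8 ^ j * L) := by ring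
        _ ≤ 2 * 1000000 ^ 2 * ε * (8 * κ) := by
          refine mul_le_mul_of_nonneg_left (le_trans ?_ hmL') (by positivity)
          gcongr
          norm_num
        _ = 1 := by
          rw [hε]
          field_simp)
    have h5 : (8 ^ j / 8 ^ m : ℝ) ^ α * (ε * κ) ^ α ≤ (8 ^ j * |ε * L|) ^ α := by
      rw [hεL, ← Real.mul_rpow (by positivity) (by positivity)]
      refine Real.rpow_le_rpow (by positivity) ?_ hα.le
      calc (8 : ℝ) ^ j / 8 ^ m * (ε * κ) ≤ (8 : ℝ) ^ j / 8 ^ m * (ε * (8 ^ m * L)) := by gcongr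
        _ = 8 ^ j * (ε * L) := by field_simp
    have h6 : ‖R.diffOp α (ε * L) (R.Δ j x)‖ ≤ 20000 * ‖R.U j (R.diffOp α (ε * L) x)‖ := by
      rw [← (R.commutes_Δ j).diffOp hα.le, ← R.U_Δ, (R.commutes_U j).Δ]
      exact R.norm_Δ_le _ _
    have h7 : a j * (ε * κ) ^ α ≤ C' * (20000 * ‖R.U j (R.diffOp α (ε * L) x)‖) := by
      calc a j * (ε * κ) ^ α = (8 ^ j / 8 ^ m : ℝ) ^ α * (ε * κ) ^ α * ‖R.Δ j x‖ := by
            rw [ha]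
            simp only
            rw [R.block_of_lt hjm]
            ring
        _ ≤ _ := (mul_le_mul_of_nonneg_right h5 (norm_nonneg _)).trans (h4.trans (by gcongr))
    rw [← le_div_iff₀ (by positivity)] at h7
    refine h7.trans (le_of_eq ?_)
    rw [hE]
    ring
  have h8 : a m ^ σ ≤ 20002 ^ σ * ‖R.avgDiff hα.le L x‖ ^ σ := by
    rw [← Real.mul_rpow (by norm_num) (norm_nonneg _)]
    refine Real.rpow_le_rpow (ha0 m) ?_ hσ0.le
    obtain ⟨k, rfl⟩ := Nat.exists_eq_add_of_le' hm
    have h9 : R.V k (x - R.V (k + 1) x) = 0 := by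
      rw [map_sub, R.V_V_of_gt (Nat.lt_succ_self k), sub_self]
    have h10 := R.norm_le_avgDiff hα.le hL h9 (by
      rw [pow_succ] at hmL
      rw [hκ] at hmL
      linarith)
    rw [map_sub, ← (R.commutes_V _).avgDiff] at h10
    have h11 := R.norm_sub_V_le (k + 1) (R.avgDiff hα.le L x)
    rw [ha]
    simp only
    rw [div_self (by positivity), Real.one_rpow, one_mul, block_self_apply]
    linarith
  calc _ ≤ E ^ σ * (C * ‖R.diffOp α (ε * L) x‖ ^ σ) + 20002 ^ σ * ‖R.avgDiff hα.le L x‖ ^ σ := by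
        refine add_le_add ((Finset.sum_le_sum h3).trans ?_) h8
        rw [← Finset.mul_sum]
        gcongr
        exact hC m _
    _ ≤ _ := by
      have h12 : 0 ≤ ‖R.diffOp α (ε * L) x‖ ^ σ := by positivity
      have h13 : 0 ≤ ‖R.avgDiff hα.le L x‖ ^ σ := by positivity
      have h14 : 0 ≤ E ^ σ * C * ‖R.avgDiff hα.le L x‖ ^ σ := by positivity
      have h15 : 0 ≤ 20002 ^ σ * ‖R.diffOp α (ε * L) x‖ ^ σ := by positivity
      linarith

end PeriodicFlow

end Averages

section TwoFlows

namespace PeriodicFlow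

variable {X : Type*} [NormedAddCommGroup X] [NormedSpace ℝ X] [CompleteSpace X]
  {R S : PeriodicFlow X}

/-- The two-parameter inverse estimate. -/
theorem exists_norm_diffOp_diffOp_le (hRS : ∀ s, S.Commutes (R.τ s)) {θ : ℝ}
    (hR : R.UpperEstimate θ) (hS : S.UpperEstimate θ) (hθ : 0 < θ) {α₁ α₂ : ℝ} (hα₁ : 0 ≤ α₁)
    (hα₂ : 0 ≤ α₂) : ∃ C : ℝ, 0 < C ∧ ∀ (m₁ m₂ : ℕ) (h₁ h₂ : ℝ) (x : X), R.V 0 x = 0 →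
      S.V 0 x = 0 → 8 ^ m₁ * |h₁| ≤ 1 → 8 ^ m₂ * |h₂| ≤ 1 →
      ‖R.diffOp α₁ h₁ (S.diffOp α₂ h₂ x)‖ ^ θ ≤ C * ∑ j₁ ∈ Finset.range (m₁ + 1),
        ∑ j₂ ∈ Finset.range (m₂ + 1), (8 ^ j₁ / 8 ^ m₁ : ℝ) ^ (α₁ * θ) *
          ((8 ^ j₂ / 8 ^ m₂ : ℝ) ^ (α₂ * θ) * ‖R.block m₁ j₁ (S.block m₂ j₂ x)‖ ^ θ) := by
  obtain ⟨C₁, hC₁0, hC₁⟩ := hR.norm_diffOp_le hθ hα₁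
  obtain ⟨C₂, hC₂0, hC₂⟩ := hS.norm_diffOp_le hθ hα₂
  refine ⟨C₁ * C₂, by positivity, fun m₁ m₂ h₁ h₂ x hx₁ hx₂ hh₁ hh₂ => ?_⟩
  have hSR : ∀ s, R.Commutes (S.τ s) := fun s t x => (hRS t s x).symm
  have hV : S.Commutes (R.V 0) := fun t x => ((hSR t).V 0 x).symm
  have hVS : ∀ j x, R.block m₁ j (S.V 0 x) = S.V 0 (R.block m₁ j x) := fun j x =>
    Commutes.V (R := S) (fun t x => ((hSR t).block m₁ j x).symm) 0 x
  refine (hC₁ m₁ h₁ _ (by rw [hV.diffOp hα₂, hx₁, map_zero]) hh₁).trans ?_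
  rw [mul_assoc, Finset.mul_sum (a := C₂)]
  refine mul_le_mul_of_nonneg_left (Finset.sum_le_sum fun j₁ _ => ?_) hC₁0.le
  have hB : S.Commutes (R.block m₁ j₁) := fun t x => ((hSR t).block m₁ j₁ x).symm
  rw [← Finset.mul_sum, mul_left_comm]
  gcongr
  rw [hB.diffOp hα₂]
  refine (hC₂ m₂ h₂ _ (by rw [← hVS, hx₂, map_zero]) hh₂).trans (le_of_eq ?_)
  simp only [hB.block]

/-- The two-parameter direct estimate. -/
theorem exists_sum_norm_sub_V_sub_V_le (hRS : ∀ s, S.Commutes (R.τ s)) {σ : ℝ}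
    (hR : R.LowerEstimate σ) (hS : S.LowerEstimate σ) (hσ : 1 ≤ σ) {α₁ α₂ : ℝ} (hα₁ : 0 < α₁)
    (hα₂ : 0 < α₂) : ∃ κ₁ : ℝ, 8 ≤ κ₁ ∧ ∃ κ₂ : ℝ, 8 ≤ κ₂ ∧ ∃ C : ℝ, 0 < C ∧
      ∀ (m₁ m₂ : ℕ) (L₁ L₂ M : ℝ) (x : X), 1 ≤ m₁ → 1 ≤ m₂ → 0 < L₁ → 0 < L₂ → R.V 0 x = 0 →
      S.V 0 x = 0 → κ₁ ≤ 8 ^ m₁ * L₁ → 8 ^ m₁ * L₁ ≤ 8 * κ₁ → κ₂ ≤ 8 ^ m₂ * L₂ →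
      8 ^ m₂ * L₂ ≤ 8 * κ₂ →
      (∀ h₁ h₂, |h₁| ≤ L₁ → |h₂| ≤ L₂ → ‖R.diffOp α₁ h₁ (S.diffOp α₂ h₂ x)‖ ≤ M) →
      ∑ i₁ ∈ Finset.range (m₁ + 1), ∑ i₂ ∈ Finset.range (m₂ + 1),
        (8 ^ i₁ / 8 ^ m₁ : ℝ) ^ (α₁ * σ) * ((8 ^ i₂ / 8 ^ m₂ : ℝ) ^ (α₂ * σ) *
          ‖x - S.V i₂ x - R.V i₁ (x - S.V i₂ x)‖ ^ σ) ≤ C * M ^ σ := by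
  obtain ⟨κ₁, hκ₁, ε₁, hε₁0, hε₁1, C₁, hC₁0, hC₁⟩ := hR.sum_norm_sub_V_le hσ hα₁
  obtain ⟨κ₂, hκ₂, ε₂, hε₂0, hε₂1, C₂, hC₂0, hC₂⟩ := hS.sum_norm_sub_V_le hσ hα₂
  refine ⟨κ₁, hκ₁, κ₂, hκ₂, 4 * (C₁ * C₂), by positivity,
    fun m₁ m₂ L₁ L₂ M x hm₁ hm₂ hL₁ hL₂ hx₁ hx₂ hm₁L hm₁L' hm₂L hm₂L' hM => ?_⟩
  have hSR : ∀ s, R.Commutes (S.τ s) := fun s t x => (hRS t s x).symm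
  have hσ0 : 0 ≤ σ := by linarith
  have hD : ∀ h, S.Commutes (R.diffOp α₁ h) := fun h t x => ((hSR t).diffOp hα₁.le h x).symm
  have hA : S.Commutes (R.avgDiff hα₁.le L₁) := fun t x => ((hSR t).avgDiff hα₁.le L₁ x).symm
  have hVR : ∀ j, S.Commutes (R.V j) := fun j t x => ((hSR t).V j x).symm
  have hε : ∀ {ε L : ℝ}, 0 < ε → ε ≤ 1 → 0 < L → |ε * L| ≤ L := fun h0 h1 hL => by
    rw [abs_of_pos (mul_pos h0 hL)]
    exact mul_le_of_le_one_left hL.le h1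
  have key : ∀ B : X →L[ℝ] X, S.Commutes B → (∀ h₂, |h₂| ≤ L₂ → ‖B (S.diffOp α₂ h₂ x)‖ ≤ M) →
      ∑ i₂ ∈ Finset.range (m₂ + 1), (8 ^ i₂ / 8 ^ m₂ : ℝ) ^ (α₂ * σ) *
        ‖B (x - S.V i₂ x)‖ ^ σ ≤ C₂ * (2 * M ^ σ) := by
    intro B hB hBM
    have h1 := hC₂ m₂ L₂ (B x) hm₂ hL₂ (by rw [← hB.V, hx₂, map_zero]) hm₂L hm₂L'
    simp only [map_sub, hB.V]
    refine h1.trans ?_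
    rw [two_mul]
    simp only [hB.diffOp hα₂.le] at hBM
    gcongr
    · exact hBM _ (hε hε₂0 hε₂1 hL₂)
    · exact norm_avgDiff_le_of_forall _ _ hL₂.le hBM
  have h1 := key (R.diffOp α₁ (ε₁ * L₁)) (hD _)
    fun h₂ hh₂ => hM _ _ (hε hε₁0 hε₁1 hL₁) hh₂
  have h2 := key (R.avgDiff hα₁.le L₁) hA fun h₂ hh₂ =>
    norm_avgDiff_le_of_forall _ _ hL₁.le fun h₁ hh₁ => hM _ _ hh₁ hh₂
  rw [Finset.sum_comm]
  calc _ ≤ ∑ i₂ ∈ Finset.range (m₂ + 1), (8 ^ i₂ / 8 ^ m₂ : ℝ) ^ (α₂ * σ) *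
        (C₁ * (‖R.diffOp α₁ (ε₁ * L₁) (x - S.V i₂ x)‖ ^ σ +
          ‖R.avgDiff hα₁.le L₁ (x - S.V i₂ x)‖ ^ σ)) := by
        gcongr with i₂
        have h3 := hC₁ m₁ L₁ (x - S.V i₂ x) hm₁ hL₁ (by
          rw [map_sub, (hVR 0).V, hx₁, map_zero, sub_zero]) hm₁L hm₁L'
        refine le_trans (le_of_eq ?_) (mul_le_mul_of_nonneg_left h3 (by positivity))
        rw [Finset.mul_sum]
        exact Finset.sum_congr rfl fun i₁ _ => by ring
    _ = C₁ * (∑ i₂ ∈ Finset.range (m₂ + 1), (8 ^ i₂ / 8 ^ m₂ : ℝ) ^ (α₂ * σ) *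
          ‖R.diffOp α₁ (ε₁ * L₁) (x - S.V i₂ x)‖ ^ σ +
        ∑ i₂ ∈ Finset.range (m₂ + 1), (8 ^ i₂ / 8 ^ m₂ : ℝ) ^ (α₂ * σ) *
          ‖R.avgDiff hα₁.le L₁ (x - S.V i₂ x)‖ ^ σ) := by
      rw [← Finset.sum_add_distrib, Finset.mul_sum]
      exact Finset.sum_congr rfl fun i₂ _ => by ring
    _ ≤ C₁ * (C₂ * (2 * M ^ σ) + C₂ * (2 * M ^ σ)) := by gcongr
    _ = _ := by ring

end PeriodicFlow

end TwoFlows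

theorem compMeasurePreserving_congr {G : Type*} [MeasurableSpace G] {μ : Measure G} {q : ℝ≥0∞}
    {f g : G → G} (hf : MeasurePreserving f μ μ) (hg : MeasurePreserving g μ μ) (h : f = g)
    (F : Lp ℝ q μ) : Lp.compMeasurePreserving f hf F = Lp.compMeasurePreserving g hg F := by
  subst h
  rfl

section Translation

variable {G : Type*} [AddCommGroup G] [TopologicalSpace G] [IsTopologicalAddGroup G]
  [MeasurableSpace G] [BorelSpace G] {μ : Measure G} [IsLocallyFiniteMeasure μ]
  [μ.InnerRegularCompactLTTop] [μ.IsAddRightInvariant] {q : ℝ≥0∞} [Fact (1 ≤ q)]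

/-- The translation flow on `L_q` along a `2π`-periodic one-parameter group. -/
def translationFlow (hq : q ≠ ∞) (ι : ℝ →+ G) (hι : Continuous ι) (hper : ι (2 * π) = 0) :
    PeriodicFlow (Lp ℝ q μ) where
  τ t := (Lp.compMeasurePreservingₗᵢ ℝ (fun z => z + ι t)
    (measurePreserving_add_right μ (ι t))).toContinuousLinearMap
  τ_zero F := by
    refine (compMeasurePreserving_congr _ (.id μ) ?_ F).trans
      (Lp.compMeasurePreserving_id_apply F)
    funext z
    simp
  τ_add s t F := by
    refine (compMeasurePreserving_congr _ ((measurePreserving_add_right μ (ι t)).comp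
      (measurePreserving_add_right μ (ι s))) ?_ F).trans
      (Lp.compMeasurePreserving_comp_apply F _ _)
    funext z
    simp [add_assoc]
  norm_τ t F := Lp.norm_compMeasurePreserving F _
  cont F := by
    have h : Continuous fun t : ℝ =>
        (⟨fun z => z + ι t, by fun_prop⟩ : C(G, G)) :=
      ContinuousMap.continuous_of_continuous_uncurry _ (by
        change Continuous fun x : ℝ × G => x.2 + ι x.1
        fun_prop)
    exact (continuous_const (y := F)).compMeasurePreservingLp h
      (fun t => measurePreserving_add_right μ (ι t)) hq
  periodic t F := by
    refine compMeasurePreserving_congr _ _ ?_ F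
    funext z
    rw [map_add, hper, add_zero]

variable (hq : q ≠ ∞) (ι : ℝ →+ G) (hι : Continuous ι) (hper : ι (2 * π) = 0)

theorem coeFn_translationFlow (t : ℝ) (F : Lp ℝ q μ) :
    (translationFlow hq ι hι hper).τ t F =ᵐ[μ] fun z => F (z + ι t) :=
  Lp.coeFn_compMeasurePreserving F (measurePreserving_add_right μ (ι t))

theorem translationFlow_comm (κ : ℝ →+ G) (hκ : Continuous κ) (hper' : κ (2 * π) = 0) (s : ℝ) :
    (translationFlow (μ := μ) hq κ hκ hper').Commutes ((translationFlow hq ι hι hper).τ s) := by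
  intro t F
  refine (Lp.compMeasurePreserving_comp_apply F (measurePreserving_add_right μ (κ t))
    (measurePreserving_add_right μ (ι s))).symm.trans ?_
  refine (compMeasurePreserving_congr _ ((measurePreserving_add_right μ (ι s)).comp
      (measurePreserving_add_right μ (κ t))) ?_ F).trans
      (Lp.compMeasurePreserving_comp_apply F _ _)
  funext z
  simp only [Function.comp_apply]
  abel

end Translation

/-- The odd power function `t ↦ sgn t |t|^s`. -/
def oddPow (s t : ℝ) : ℝ := SignType.sign t * |t| ^ s

theorem abs_oddPow {s : ℝ} (hs : 0 < s) (t : ℝ) : |oddPow s t| = |t| ^ s := by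
  rw [oddPow, abs_mul, abs_of_nonneg (rpow_nonneg (abs_nonneg t) s)]
  rcases eq_or_ne t 0 with rfl | ht
  · simp [zero_rpow hs.ne']
  · rcases ht.lt_or_gt with h | h <;> simp [h]

theorem oddPow_neg (s t : ℝ) : oddPow s (-t) = -oddPow s t := by
  simp [oddPow, Left.sign_neg]

theorem oddPow_of_nonneg {s : ℝ} (hs : 0 < s) {t : ℝ} (ht : 0 ≤ t) : oddPow s t = t ^ s := by
  rcases ht.eq_or_lt with rfl | h
  · simp [oddPow, zero_rpow hs.ne']
  · simp [oddPow, h, abs_of_pos h]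

theorem oddPow_mul_self {s : ℝ} (hs : 0 < s) (t : ℝ) : oddPow s t * t = |t| ^ (s + 1) := by
  have key : ∀ t : ℝ, 0 ≤ t → oddPow s t * t = |t| ^ (s + 1) := fun t ht => by
    rw [oddPow_of_nonneg hs ht, abs_of_nonneg ht, rpow_add_one' ht (by linarith)]
  rcases le_total 0 t with h | h
  · exact key t h
  · have := key (-t) (by linarith)
    rwa [oddPow_neg, neg_mul_neg, abs_neg] at this

theorem measurable_oddPow (s : ℝ) : Measurable (oddPow s) := by
  have : Measurable fun t : ℝ => ((SignType.sign t : SignType) : ℝ) := by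
    have h : (fun t : ℝ => ((SignType.sign t : SignType) : ℝ)) =
        fun t => if 0 < t then 1 else if t < 0 then -1 else 0 := by
      funext t
      rw [sign_apply]
      split_ifs <;> simp
    rw [h]
    exact Measurable.ite measurableSet_Ioi measurable_const
      (Measurable.ite measurableSet_Iio measurable_const measurable_const)
  exact this.mul (by fun_prop)

theorem abs_oddPow_sub_le_of_le_one {s : ℝ} (hs : 0 < s) (hs1 : s ≤ 1) (a b : ℝ) :
    |oddPow s a - oddPow s b| ≤ 2 * |a - b| ^ s := by
  have pos : ∀ a b : ℝ, 0 ≤ b → b ≤ a → |oddPow s a - oddPow s b| ≤ 2 * |a - b| ^ s := by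
    intro a b hb hab
    rw [oddPow_of_nonneg hs hb, oddPow_of_nonneg hs (hb.trans hab),
      abs_of_nonneg (sub_nonneg.2 (rpow_le_rpow hb hab hs.le)), abs_of_nonneg (sub_nonneg.2 hab)]
    have h := rpow_add_le_add_rpow (sub_nonneg.2 hab) hb hs.le hs1
    rw [sub_add_cancel] at h
    have := rpow_nonneg (sub_nonneg.2 hab) s
    linarith
  have mixed : ∀ a b : ℝ, 0 ≤ a → b ≤ 0 → |oddPow s a - oddPow s b| ≤ 2 * |a - b| ^ s := by
    intro a b ha hb
    have h1 : |a| ^ s ≤ |a - b| ^ s := by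
      refine rpow_le_rpow (abs_nonneg _) ?_ hs.le
      rw [abs_of_nonneg ha, abs_of_nonneg (by linarith)]
      linarith
    have h2 : |b| ^ s ≤ |a - b| ^ s := by
      refine rpow_le_rpow (abs_nonneg _) ?_ hs.le
      rw [abs_of_nonpos hb, abs_of_nonneg (by linarith)]
      linarith
    calc |oddPow s a - oddPow s b| ≤ |oddPow s a| + |oddPow s b| := abs_sub _ _
      _ ≤ 2 * |a - b| ^ s := by rw [abs_oddPow hs, abs_oddPow hs]; linarith
  have same : ∀ a b : ℝ, 0 ≤ a → 0 ≤ b → |oddPow s a - oddPow s b| ≤ 2 * |a - b| ^ s := by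
    intro a b ha hb
    rcases le_total b a with h | h
    · exact pos a b hb h
    · rw [abs_sub_comm, abs_sub_comm a b]
      exact pos b a ha h
  rcases le_total 0 a with ha | ha <;> rcases le_total 0 b with hb | hb
  · exact same a b ha hb
  · exact mixed a b ha hb
  · rw [abs_sub_comm, abs_sub_comm a b]
    exact mixed b a hb ha
  · have := same (-b) (-a) (by linarith) (by linarith)
    simpa only [oddPow_neg, neg_sub_neg] using this

theorem abs_oddPow_sub_le_of_one_le {s : ℝ} (hs : 1 ≤ s) (a b : ℝ) :
    |oddPow s a - oddPow s b| ≤ s * ((|a| + |b|) ^ (s - 1) * |a - b|) := by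
  have hs0 : 0 < s := by linarith
  have pos : ∀ a b : ℝ, 0 ≤ b → b ≤ a →
      |oddPow s a - oddPow s b| ≤ s * ((|a| + |b|) ^ (s - 1) * |a - b|) := by
    intro a b hb hab
    have ha := hb.trans hab
    rw [oddPow_of_nonneg hs0 hb, oddPow_of_nonneg hs0 ha,
      abs_of_nonneg (sub_nonneg.2 (rpow_le_rpow hb hab hs0.le)), abs_of_nonneg (sub_nonneg.2 hab),
      abs_of_nonneg ha, abs_of_nonneg hb]
    have h := (convex_Icc 0 a).norm_image_sub_le_of_norm_deriv_le (𝕜 := ℝ)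
      (f := fun t : ℝ => t ^ s) (C := s * a ^ (s - 1)) (x := b) (y := a)
      (fun t _ => (differentiable_rpow_const hs).differentiableAt) (fun t ht => by
        rw [Real.deriv_rpow_const, norm_eq_abs, abs_of_nonneg
          (mul_nonneg hs0.le (rpow_nonneg ht.1 _))]
        exact mul_le_mul_of_nonneg_left (rpow_le_rpow ht.1 ht.2 (by linarith)) hs0.le)
      ⟨hb, hab⟩ ⟨ha, le_rfl⟩
    rw [norm_eq_abs, norm_eq_abs, abs_of_nonneg (sub_nonneg.2 hab)] at h
    refine (le_abs_self _).trans (h.trans ?_)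
    rw [mul_assoc]
    have : a ^ (s - 1) ≤ (a + b) ^ (s - 1) := rpow_le_rpow ha (by linarith) (by linarith)
    have := sub_nonneg.2 hab
    gcongr
  have mixed : ∀ a b : ℝ, 0 ≤ a → b ≤ 0 →
      |oddPow s a - oddPow s b| ≤ s * ((|a| + |b|) ^ (s - 1) * |a - b|) := by
    intro a b ha hb
    have e : |a - b| = |a| + |b| := by
      rw [abs_of_nonneg ha, abs_of_nonpos hb, abs_of_nonneg (by linarith)]
      ring
    have h0 : 0 ≤ |a| + |b| := by positivity
    calc |oddPow s a - oddPow s b| ≤ |oddPow s a| + |oddPow s b| := abs_sub _ _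
      _ = |a| ^ s + |b| ^ s := by rw [abs_oddPow hs0, abs_oddPow hs0]
      _ ≤ (|a| + |b|) ^ s := add_rpow_le_rpow_add (abs_nonneg a) (abs_nonneg b) hs
      _ = (|a| + |b|) ^ (s - 1) * |a - b| := by
          rw [e, ← rpow_add_one' h0 (by linarith), sub_add_cancel]
      _ ≤ _ := le_mul_of_one_le_left (by positivity) hs
  have same : ∀ a b : ℝ, 0 ≤ a → 0 ≤ b →
      |oddPow s a - oddPow s b| ≤ s * ((|a| + |b|) ^ (s - 1) * |a - b|) := by
    intro a b ha hb
    rcases le_total b a with h | h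
    · exact pos a b hb h
    · rw [abs_sub_comm, abs_sub_comm a b, add_comm |a|]
      exact pos b a ha h
  rcases le_total 0 a with ha | ha <;> rcases le_total 0 b with hb | hb
  · exact same a b ha hb
  · exact mixed a b ha hb
  · rw [abs_sub_comm, abs_sub_comm a b, add_comm |a|]
    exact mixed b a hb ha
  · have := same (-b) (-a) (by linarith) (by linarith)
    simpa only [oddPow_neg, neg_sub_neg, abs_neg, add_comm |b|] using this

section Duality

variable {G : Type*} [MeasurableSpace G] {μ : Measure G} {p p' : ℝ}

theorem eLpNorm_abs_rpow (hpp : p.HolderConjugate p') {f : G → ℝ} :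
    eLpNorm (fun z => |f z| ^ (p - 1)) (ENNReal.ofReal p') μ =
      eLpNorm f (ENNReal.ofReal p) μ ^ (p - 1) := by
  have h := eLpNorm_norm_rpow (p := ENNReal.ofReal p') (μ := μ) f hpp.sub_one_pos
  simp only [norm_eq_abs] at h
  rw [h, ← ENNReal.ofReal_mul hpp.symm.nonneg]
  congr 3
  have := hpp.sub_one_mul_conj
  linarith

theorem memLp_oddPow (hpp : p.HolderConjugate p') {f : G → ℝ}
    (hf : MemLp f (ENNReal.ofReal p) μ) :
    MemLp (fun z => oddPow (p - 1) (f z)) (ENNReal.ofReal p') μ := by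
  refine ⟨((measurable_oddPow _).comp_aemeasurable hf.1.aemeasurable).aestronglyMeasurable, ?_⟩
  have : eLpNorm (fun z => oddPow (p - 1) (f z)) (ENNReal.ofReal p') μ =
      eLpNorm (fun z => |f z| ^ (p - 1)) (ENNReal.ofReal p') μ := by
    refine eLpNorm_congr_norm_ae (.of_forall fun z => ?_)
    rw [norm_eq_abs, abs_oddPow hpp.sub_one_pos, norm_eq_abs,
      abs_of_nonneg (rpow_nonneg (abs_nonneg (f z)) _)]
  rw [this, eLpNorm_abs_rpow hpp]
  exact ENNReal.rpow_lt_top_of_nonneg hpp.sub_one_pos.le hf.2.ne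

/-- The duality map `F ↦ sgn F |F|^{p-1}` from `L_p` to `L_{p'}`. -/
def dualVec (hpp : p.HolderConjugate p') (F : Lp ℝ (ENNReal.ofReal p) μ) :
    Lp ℝ (ENNReal.ofReal p') μ := (memLp_oddPow hpp (Lp.memLp F)).toLp _

theorem coeFn_dualVec (hpp : p.HolderConjugate p') (F : Lp ℝ (ENNReal.ofReal p) μ) :
    dualVec hpp F =ᵐ[μ] fun z => oddPow (p - 1) (F z) := MemLp.coeFn_toLp _

theorem norm_dualVec (hpp : p.HolderConjugate p') (F : Lp ℝ (ENNReal.ofReal p) μ) :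
    ‖dualVec hpp F‖ = ‖F‖ ^ (p - 1) := by
  rw [dualVec, Lp.norm_toLp, Lp.norm_def, ENNReal.toReal_rpow, ← eLpNorm_abs_rpow hpp]
  congr 1
  refine eLpNorm_congr_norm_ae (.of_forall fun z => ?_)
  rw [norm_eq_abs, abs_oddPow hpp.sub_one_pos, norm_eq_abs,
    abs_of_nonneg (rpow_nonneg (abs_nonneg (F z)) _)]

theorem Lp_norm_rpow (hp : 0 < p) (F : Lp ℝ (ENNReal.ofReal p) μ) :
    ‖F‖ ^ p = ∫ z, |F z| ^ p ∂μ := by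
  rw [Lp.norm_def, (Lp.memLp F).eLpNorm_eq_integral_rpow_norm (by simpa using hp)
    ENNReal.ofReal_ne_top, ENNReal.toReal_ofReal (by positivity), ENNReal.toReal_ofReal hp.le,
    ← rpow_mul (integral_nonneg fun z => by positivity), inv_mul_cancel₀ hp.ne', rpow_one]
  simp only [norm_eq_abs]

theorem norm_dualVec_sub_le_of_le_two (hpp : p.HolderConjugate p') (hp2 : p ≤ 2)
    (F H : Lp ℝ (ENNReal.ofReal p) μ) :
    ‖dualVec hpp F - dualVec hpp H‖ ≤ 2 * ‖F - H‖ ^ (p - 1) := by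
  rw [← norm_dualVec hpp]
  refine Lp.norm_le_mul_norm_of_ae_le_mul ?_
  filter_upwards [Lp.coeFn_sub (dualVec hpp F) (dualVec hpp H), coeFn_dualVec hpp F,
    coeFn_dualVec hpp H, coeFn_dualVec hpp (F - H), Lp.coeFn_sub F H] with z h1 h2 h3 h4 h5
  rw [h1, h4, Pi.sub_apply, h2, h3, h5, norm_eq_abs, norm_eq_abs, abs_oddPow hpp.sub_one_pos]
  exact abs_oddPow_sub_le_of_le_one hpp.sub_one_pos (by linarith) _ _

theorem norm_dualVec_sub_le_of_two_lt (hpp : p.HolderConjugate p') (hp2 : 2 < p)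
    [Fact (1 ≤ ENNReal.ofReal p)] (F H : Lp ℝ (ENNReal.ofReal p) μ) :
    ‖dualVec hpp F - dualVec hpp H‖ ≤ (p - 1) * ((‖F‖ + ‖H‖) ^ (p - 2) * ‖F - H‖) := by
  have hp0 : 0 < p := by linarith
  set A : G → ℝ := fun z => |F z| + |H z| with hA
  have hAm : AEStronglyMeasurable A μ :=
    (Lp.aestronglyMeasurable F).norm.add (Lp.aestronglyMeasurable H).norm
  have hA' : eLpNorm A (ENNReal.ofReal p) μ ≤ ENNReal.ofReal (‖F‖ + ‖H‖) := by
    refine (eLpNorm_add_le (Lp.aestronglyMeasurable F).norm (Lp.aestronglyMeasurable H).norm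
      Fact.out).trans ?_
    rw [eLpNorm_norm, eLpNorm_norm, ENNReal.ofReal_add (norm_nonneg _) (norm_nonneg _),
      Lp.norm_def, Lp.norm_def, ENNReal.ofReal_toReal (Lp.eLpNorm_ne_top F),
      ENNReal.ofReal_toReal (Lp.eLpNorm_ne_top H)]
  set r : ℝ := p / (p - 2) with hr
  have hr0 : 0 < r := div_pos hp0 (by linarith)
  have hT : ENNReal.HolderTriple (ENNReal.ofReal r) (ENNReal.ofReal p) (ENNReal.ofReal p') := by
    constructor
    rw [← ENNReal.ofReal_inv_of_pos hr0, ← ENNReal.ofReal_inv_of_pos hp0,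
      ← ENNReal.ofReal_inv_of_pos hpp.symm.pos, ← ENNReal.ofReal_add (by positivity)
      (by positivity), hr]
    congr 1
    have := hpp.inv_add_inv_eq_one
    have e : p'⁻¹ = 1 - p⁻¹ := by linarith
    rw [e]
    field_simp
    ring
  have hAr : eLpNorm (fun z => A z ^ (p - 2)) (ENNReal.ofReal r) μ =
      eLpNorm A (ENNReal.ofReal p) μ ^ (p - 2) := by
    have h := eLpNorm_norm_rpow (p := ENNReal.ofReal r) (μ := μ) A
      (show 0 < p - 2 by linarith)
    rw [← ENNReal.ofReal_mul hr0.le, hr, div_mul_cancel₀ p (by linarith)] at h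
    rw [← h]
    congr 1
    funext z
    rw [norm_eq_abs, abs_of_nonneg (by positivity : 0 ≤ A z)]
  have hp1 : 0 ≤ p - 1 := by linarith
  set D : G → ℝ := ⇑(F - H) with hD
  have hDm : AEStronglyMeasurable D μ := Lp.aestronglyMeasurable _
  rw [Lp.norm_def]
  refine ENNReal.toReal_le_of_le_ofReal (by positivity) ?_
  rw [ENNReal.ofReal_mul hp1, ENNReal.ofReal_mul (by positivity)]
  calc eLpNorm (dualVec hpp F - dualVec hpp H : Lp ℝ (ENNReal.ofReal p') μ) (ENNReal.ofReal p') μ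
      ≤ ENNReal.ofReal (p - 1) *
        eLpNorm ((fun z => A z ^ (p - 2)) • D) (ENNReal.ofReal p') μ := by
        refine eLpNorm_le_mul_eLpNorm_of_ae_le_mul ?_ _
        filter_upwards [Lp.coeFn_sub (dualVec hpp F) (dualVec hpp H), coeFn_dualVec hpp F,
          coeFn_dualVec hpp H, Lp.coeFn_sub F H] with z h1 h2 h3 h5
        replace h5 : D z = F z - H z := h5
        rw [h1, Pi.sub_apply, h2, h3, Pi.smul_apply', h5, norm_eq_abs, norm_eq_abs, smul_eq_mul,
          abs_mul, abs_of_nonneg (by positivity : 0 ≤ A z ^ (p - 2))]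
        refine (abs_oddPow_sub_le_of_one_le (by linarith) _ _).trans (le_of_eq ?_)
        rw [show p - 1 - 1 = p - 2 by ring]
    _ ≤ ENNReal.ofReal (p - 1) * (eLpNorm (fun z => A z ^ (p - 2)) (ENNReal.ofReal r) μ *
          eLpNorm D (ENNReal.ofReal p) μ) := by
        refine mul_le_mul_right (eLpNorm_smul_le_mul_eLpNorm hDm ?_) _
        exact (hAm.aemeasurable.pow_const _).aestronglyMeasurable
    _ ≤ _ := by
        rw [hAr, Lp.norm_def (F - H), ← hD,
          ENNReal.ofReal_toReal (Lp.eLpNorm_ne_top (F - H)), ← ENNReal.ofReal_rpow_of_nonneg (by positivity) (by linarith)]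
        gcongr

variable [Fact (1 ≤ ENNReal.ofReal p)] [Fact (1 ≤ ENNReal.ofReal p')]
  [ENNReal.HolderConjugate (ENNReal.ofReal p) (ENNReal.ofReal p')]

/-- The integral pairing of `L_p` and `L_{p'}`. -/
def lpPair (μ : Measure G) (p p' : ℝ) [Fact (1 ≤ ENNReal.ofReal p)] [Fact (1 ≤ ENNReal.ofReal p')]
    [ENNReal.HolderConjugate (ENNReal.ofReal p) (ENNReal.ofReal p')] :
    Lp ℝ (ENNReal.ofReal p) μ →L[ℝ] Lp ℝ (ENNReal.ofReal p') μ →L[ℝ] ℝ :=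
  (ContinuousLinearMap.mul ℝ ℝ).lpPairing μ (ENNReal.ofReal p) (ENNReal.ofReal p')

theorem lpPair_apply (F : Lp ℝ (ENNReal.ofReal p) μ) (H : Lp ℝ (ENNReal.ofReal p') μ) :
    lpPair μ p p' F H = ∫ z, F z * H z ∂μ :=
  ContinuousLinearMap.lpPairing_eq_integral _ F H

theorem abs_lpPair_le (F : Lp ℝ (ENNReal.ofReal p) μ) (H : Lp ℝ (ENNReal.ofReal p') μ) :
    |lpPair μ p p' F H| ≤ ‖F‖ * ‖H‖ := by
  have h := (ContinuousLinearMap.mul ℝ ℝ).norm_holder_apply_apply_le (r := 1) F H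
  have h1 : |lpPair μ p p' F H| ≤ ‖(ContinuousLinearMap.mul ℝ ℝ).holder 1 F H‖ := by
    have e : lpPair μ p p' F H = L1.integral ((ContinuousLinearMap.mul ℝ ℝ).holder 1 F H) := by
      rw [lpPair_apply, L1.integral_eq_integral]
      exact (integral_congr_ae ((ContinuousLinearMap.mul ℝ ℝ).coeFn_holder F H)).symm
    rw [e]
    rw [← norm_eq_abs]
    exact L1.norm_integral_le _
  refine h1.trans (h.trans ?_)
  rw [ContinuousLinearMap.opNorm_mul, one_mul]

end Duality

section TranslationEstimates

variable {G : Type*} [AddCommGroup G] [TopologicalSpace G] [IsTopologicalAddGroup G]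
  [MeasurableSpace G] [BorelSpace G] {μ : Measure G} [IsLocallyFiniteMeasure μ]
  [μ.InnerRegularCompactLTTop] [μ.IsAddRightInvariant] {p p' : ℝ}
  (ι : ℝ →+ G) (hι : Continuous ι) (hper : ι (2 * π) = 0)

theorem lpPair_translationFlow [Fact (1 ≤ ENNReal.ofReal p)] [Fact (1 ≤ ENNReal.ofReal p')]
    [ENNReal.HolderConjugate (ENNReal.ofReal p) (ENNReal.ofReal p')] (t : ℝ)
    (F : Lp ℝ (ENNReal.ofReal p) μ) (H : Lp ℝ (ENNReal.ofReal p') μ) :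
    lpPair μ p p' ((translationFlow ENNReal.ofReal_ne_top ι hι hper).τ t F)
      ((translationFlow ENNReal.ofReal_ne_top ι hι hper).τ t H) = lpPair μ p p' F H := by
  rw [lpPair_apply, lpPair_apply]
  refine Eq.trans (integral_congr_ae ?_)
    (integral_add_right_eq_self (fun z => F z * H z) (ι t))
  filter_upwards [coeFn_translationFlow ENNReal.ofReal_ne_top ι hι hper t F,
    coeFn_translationFlow ENNReal.ofReal_ne_top ι hι hper t H] with z h1 h2
  rw [h1, h2]

theorem dualVec_translationFlow [Fact (1 ≤ ENNReal.ofReal p)] [Fact (1 ≤ ENNReal.ofReal p')]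
    (hpp : p.HolderConjugate p') (t : ℝ) (F : Lp ℝ (ENNReal.ofReal p) μ) :
    dualVec hpp ((translationFlow ENNReal.ofReal_ne_top ι hι hper).τ t F) =
      (translationFlow ENNReal.ofReal_ne_top ι hι hper).τ t (dualVec hpp F) := by
  refine Lp.ext ?_
  filter_upwards [coeFn_dualVec hpp ((translationFlow ENNReal.ofReal_ne_top ι hι hper).τ t F),
    coeFn_translationFlow ENNReal.ofReal_ne_top ι hι hper t F,
    coeFn_translationFlow ENNReal.ofReal_ne_top ι hι hper t (dualVec hpp F),
    (measurePreserving_add_right μ (ι t)).quasiMeasurePreserving.ae (coeFn_dualVec hpp F)]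
    with z h1 h2 h3 h4
  rw [h1, h2, h3, h4]

omit [AddCommGroup G] [TopologicalSpace G] [IsTopologicalAddGroup G] [BorelSpace G]
  [IsLocallyFiniteMeasure μ] [μ.InnerRegularCompactLTTop] [μ.IsAddRightInvariant] in
theorem lpPair_dualVec_self [Fact (1 ≤ ENNReal.ofReal p)] [Fact (1 ≤ ENNReal.ofReal p')]
    [ENNReal.HolderConjugate (ENNReal.ofReal p') (ENNReal.ofReal p)]
    (hpp : p.HolderConjugate p') (F : Lp ℝ (ENNReal.ofReal p) μ) :
    lpPair μ p' p (dualVec hpp F) F = ‖F‖ ^ p := by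
  rw [lpPair_apply, Lp_norm_rpow hpp.pos]
  refine integral_congr_ae ?_
  filter_upwards [coeFn_dualVec hpp F] with z h1
  rw [h1, oddPow_mul_self hpp.sub_one_pos, sub_add_cancel]

/-- The duality map of `L_p`, as a `DualityMap` of the translation flow. -/
def translationDuality [Fact (1 ≤ ENNReal.ofReal p)] [Fact (1 ≤ ENNReal.ofReal p')]
    [ENNReal.HolderConjugate (ENNReal.ofReal p') (ENNReal.ofReal p)]
    (hpp : p.HolderConjugate p') :
    DualityMap (translationFlow (μ := μ) (q := ENNReal.ofReal p) ENNReal.ofReal_ne_top ι hι hper)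
      p (min 2 p) where
  J F := lpPair μ p' p (dualVec hpp F)
  K := 2 + p
  K_nonneg := by linarith [hpp.pos]
  apply_self F := lpPair_dualVec_self hpp F
  norm_le F := by
    refine ContinuousLinearMap.opNorm_le_bound _ (by positivity) fun H => ?_
    rw [norm_eq_abs, ← norm_dualVec hpp]
    exact abs_lpPair_le _ _
  equivariant t F H := by
    rw [dualVec_translationFlow, lpPair_translationFlow]
  holder F H := by
    have h1 : ‖lpPair μ p' p (dualVec hpp F) - lpPair μ p' p (dualVec hpp H)‖ ≤
        ‖dualVec hpp F - dualVec hpp H‖ := by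
      rw [← map_sub]
      exact ContinuousLinearMap.opNorm_le_bound _ (norm_nonneg _) fun H => abs_lpPair_le _ _
    refine h1.trans ?_
    have hp0 := hpp.pos
    rcases le_or_gt p 2 with h2 | h2
    · rw [min_eq_right h2, sub_self, rpow_zero, mul_one]
      refine (norm_dualVec_sub_le_of_le_two hpp h2 F H).trans ?_
      gcongr
      linarith
    · rw [min_eq_left h2.le, show (2 : ℝ) - 1 = 1 by norm_num, rpow_one, mul_assoc]
      refine (norm_dualVec_sub_le_of_two_lt hpp h2 F H).trans ?_
      gcongr
      linarith

/-- The integral pairing of the translation flows on `L_p` and `L_{p'}`. -/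
def translationPairing [Fact (1 ≤ ENNReal.ofReal p)] [Fact (1 ≤ ENNReal.ofReal p')]
    [ENNReal.HolderConjugate (ENNReal.ofReal p') (ENNReal.ofReal p)]
    (hpp : p.HolderConjugate p') :
    FlowPairing
      (translationFlow (μ := μ) (q := ENNReal.ofReal p) ENNReal.ofReal_ne_top ι hι hper)
      (translationFlow (μ := μ) (q := ENNReal.ofReal p') ENNReal.ofReal_ne_top ι hι hper) where
  pair := lpPair μ p' p
  norm_le := abs_lpPair_le
  adjoint t H F := by
    conv_lhs => rw [← PeriodicFlow.τ_zero
      (translationFlow (μ := μ) (q := ENNReal.ofReal p') ENNReal.ofReal_ne_top ι hι hper) H,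
      ← add_neg_cancel t, PeriodicFlow.τ_add]
    exact lpPair_translationFlow _ _ _ _ _ _
  norming F := by
    have hp0 := hpp.pos
    rcases eq_or_ne F 0 with rfl | hF
    · exact ⟨0, by simp, by simp⟩
    have hF' : 0 < ‖F‖ := norm_pos_iff.2 hF
    refine ⟨(‖F‖ ^ (p - 1))⁻¹ • dualVec hpp F, ?_, ?_⟩
    · rw [norm_smul, norm_dualVec, norm_eq_abs, abs_of_pos (by positivity),
        inv_mul_cancel₀ (by positivity)]
    · rw [map_smul, _root_.smul_apply, lpPair_dualVec_self, smul_eq_mul, rpow_sub_one hF'.ne']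
      field_simp

end TranslationEstimates

section Conjugate

variable {G : Type*} [AddCommGroup G] [TopologicalSpace G] [IsTopologicalAddGroup G]
  [MeasurableSpace G] [BorelSpace G] {μ : Measure G} [IsLocallyFiniteMeasure μ]
  [μ.InnerRegularCompactLTTop] [μ.IsAddRightInvariant] {p : ℝ} [Fact (1 ≤ ENNReal.ofReal p)]
  (ι : ℝ →+ G) (hι : Continuous ι) (hper : ι (2 * π) = 0)

theorem upperEstimate_translationFlow (hp : 1 < p) :
    (translationFlow (μ := μ) (q := ENNReal.ofReal p) ENNReal.ofReal_ne_top ι hι hper).UpperEstimate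
      (min 2 p) := by
  have hpp := HolderConjugate.conjExponent hp
  have : Fact (1 ≤ ENNReal.ofReal (conjExponent p)) := ⟨by
    rw [ENNReal.one_le_ofReal]
    exact hpp.symm.lt.le⟩
  have : ENNReal.HolderConjugate (ENNReal.ofReal (conjExponent p)) (ENNReal.ofReal p) :=
    hpp.symm.ennrealOfReal
  exact (translationDuality ι hι hper hpp).exists_norm_sum_U_le hp
    (lt_min (by norm_num) hp) (min_le_left _ _) (min_le_right _ _)

theorem lowerEstimate_translationFlow (hp : 1 < p) :
    (translationFlow (μ := μ) (q := ENNReal.ofReal p) ENNReal.ofReal_ne_top ι hι hper).LowerEstimate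
      (max 2 p) := by
  have hpp := HolderConjugate.conjExponent hp
  have : Fact (1 ≤ ENNReal.ofReal (conjExponent p)) := ⟨by
    rw [ENNReal.one_le_ofReal]
    exact hpp.symm.lt.le⟩
  have : ENNReal.HolderConjugate (ENNReal.ofReal (conjExponent p)) (ENNReal.ofReal p) :=
    hpp.symm.ennrealOfReal
  have : ENNReal.HolderConjugate (ENNReal.ofReal p) (ENNReal.ofReal (conjExponent p)) :=
    hpp.ennrealOfReal
  have hσ : (max 2 p).HolderConjugate (min 2 (conjExponent p)) := by
    rcases le_total p 2 with h | h
    · have : 2 ≤ conjExponent p := by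
        rw [conjExponent, le_div_iff₀ (by linarith)]
        linarith
      rw [max_eq_left h, min_eq_left this]
      exact ⟨by norm_num, by norm_num, by norm_num⟩
    · have : conjExponent p ≤ 2 := by
        rw [conjExponent, div_le_iff₀ (by linarith)]
        linarith
      rw [max_eq_right h, min_eq_right this]
      exact hpp
  exact (translationPairing ι hι hper hpp).exists_sum_norm_U_le
    (translationDuality ι hι hper hpp.symm) hpp.symm.lt (lt_min (by norm_num) hpp.symm.lt)
    (min_le_left _ _) (min_le_right _ _) hσ

end Conjugate

theorem ae_tsum_eq_of_summable_norm {G : Type*} [MeasurableSpace G] {μ : Measure G}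
    [IsFiniteMeasure μ] {q : ℝ≥0∞} [Fact (1 ≤ q)] {F : ℕ → Lp ℝ q μ} {S : Lp ℝ q μ}
    (hS : HasSum F S) (hF : Summable fun ν => ‖F ν‖) : ∀ᵐ z ∂μ, S z = ∑' ν, F ν z := by
  have hq0 : q ≠ 0 := (zero_lt_one.trans_le (Fact.out : 1 ≤ q)).ne'
  set c : ℝ≥0∞ := μ Set.univ ^ (1 / (1 : ℝ≥0∞).toReal - 1 / q.toReal) with hc
  have hctop : c ≠ ∞ := by
    refine ENNReal.rpow_ne_top_of_nonneg ?_ (measure_ne_top _ _)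
    rcases eq_or_ne q ∞ with rfl | hq
    · simp
    · have : 1 ≤ q.toReal := by
        have := ENNReal.toReal_mono hq (Fact.out : 1 ≤ q)
        simpa using this
      simp only [ENNReal.toReal_one, div_one, one_div, sub_nonneg]
      exact inv_le_one_of_one_le₀ this
  have hfin : ∫⁻ z, ∑' ν, ‖F ν z‖ₑ ∂μ ≠ ∞ := by
    rw [lintegral_tsum fun ν => (Lp.aestronglyMeasurable (F ν)).enorm]
    have h1 : ∀ ν, ∫⁻ z, ‖F ν z‖ₑ ∂μ ≤ ENNReal.ofReal ‖F ν‖ * c := fun ν => by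
      rw [← eLpNorm_one_eq_lintegral_enorm, Lp.norm_def, ENNReal.ofReal_toReal
        (Lp.eLpNorm_ne_top _)]
      exact eLpNorm_le_eLpNorm_mul_rpow_measure_univ Fact.out (Lp.aestronglyMeasurable _)
    refine ((ENNReal.tsum_le_tsum h1).trans_lt ?_).ne
    rw [ENNReal.tsum_mul_right]
    exact ENNReal.mul_lt_top hF.tsum_ofReal_lt_top hctop.lt_top
  have hsum : ∀ᵐ z ∂μ, Summable fun ν => F ν z := by
    filter_upwards [ae_lt_top' (AEMeasurable.tsum
      fun ν => (Lp.aestronglyMeasurable (F ν)).enorm) hfin] with z hz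
    refine Summable.of_norm ?_
    have := ENNReal.summable_toReal hz.ne
    simpa using this
  have hm : TendstoInMeasure μ (fun n => ⇑(∑ ν ∈ Finset.range n, F ν)) Filter.atTop S := by
    refine tendstoInMeasure_of_tendsto_eLpNorm hq0 (fun n => Lp.aestronglyMeasurable _)
      (Lp.aestronglyMeasurable _) ?_
    exact (Lp.tendsto_Lp_iff_tendsto_eLpNorm' _ _).1 hS.tendsto_sum_nat
  obtain ⟨ns, hns, hae⟩ := hm.exists_seq_tendsto_ae
  have hco : ∀ᵐ z ∂μ, ∀ n, (∑ ν ∈ Finset.range n, F ν : Lp ℝ q μ) z =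
      ∑ ν ∈ Finset.range n, F ν z := by
    refine ae_all_iff.2 fun n => ?_
    filter_upwards [Lp.coeFn_finsetSum (Finset.range n) F] with z hz
    rw [hz, Finset.sum_apply]
  filter_upwards [hsum, hae, hco] with z h1 h2 h3
  refine tendsto_nhds_unique h2 ?_
  simp only [h3]
  exact h1.hasSum.tendsto_sum_nat.comp hns.tendsto_atTop

section TranslationConv

variable {G : Type*} [AddCommGroup G] [TopologicalSpace G] [IsTopologicalAddGroup G]
  [SecondCountableTopology G] [MeasurableSpace G] [BorelSpace G] {μ : Measure G}
  [IsFiniteMeasure μ] [μ.InnerRegularCompactLTTop] [μ.IsAddRightInvariant] {q : ℝ≥0∞}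
  [Fact (1 ≤ q)] (hq : q ≠ ∞) (ι : ℝ →+ G) (hι : Continuous ι) (hper : ι (2 * π) = 0)

include hι in
omit [μ.InnerRegularCompactLTTop] in
theorem integrable_prod_translate {g : G → ℝ} (hg : Measurable g) (hgi : Integrable g μ)
    (v : C(ℝ, ℝ)) : Integrable (fun w : G × ℝ => v w.2 * g (w.1 + ι w.2))
      (μ.prod (volume.restrict (Set.Ioc (-π) π))) := by
  have hm : Measurable fun w : G × ℝ => v w.2 * g (w.1 + ι w.2) := by
    have h1 : Continuous fun w : G × ℝ => w.1 + ι w.2 := by fun_prop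
    have h2 : Continuous fun w : G × ℝ => v w.2 := by fun_prop
    exact h2.measurable.mul (hg.comp h1.measurable)
  rw [integrable_prod_iff' hm.aestronglyMeasurable]
  constructor
  · refine .of_forall fun t => ?_
    exact (hgi.comp_add_right (ι t)).const_mul (v t)
  · have : (fun t => ∫ z, ‖v t * g (z + ι t)‖ ∂μ) = fun t => |v t| * ∫ z, ‖g z‖ ∂μ := by
      funext t
      simp only [norm_mul, integral_const_mul, norm_eq_abs]
      rw [integral_add_right_eq_self fun z => |g z|]
    simp only [this]
    refine Integrable.mul_const ?_ _
    have hc : Continuous fun t => |v t| := by fun_prop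
    exact (hc.integrableOn_Icc).mono_set Set.Ioc_subset_Icc_self

include hι in
omit [μ.InnerRegularCompactLTTop] in
theorem ae_intervalIntegrable_translate {g : G → ℝ} (hg : Measurable g) (hgi : Integrable g μ) :
    ∀ᵐ z ∂μ, IntervalIntegrable (fun t => g (z + ι t)) volume (-π) π := by
  filter_upwards [(integrable_prod_translate ι hι hg hgi 1).prod_right_ae] with z hz
  rw [intervalIntegrable_iff_integrableOn_Ioc_of_le PeriodicFlow.neg_pi_le_pi]
  simpa [IntegrableOn] using hz

theorem coeFn_conv_translationFlow {g : G → ℝ} (hg : Measurable g) (F : Lp ℝ q μ)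
    (hF : F =ᵐ[μ] g) (v : C(ℝ, ℝ)) :
    (translationFlow hq ι hι hper).conv v F =ᵐ[μ] fun z => ∫ t in (-π)..π, v t * g (z + ι t) := by
  have hgi : Integrable g μ := ((Lp.memLp F).integrable Fact.out).congr hF
  have hprod := integrable_prod_translate ι hι hg hgi v
  simp only [intervalIntegral.integral_of_le PeriodicFlow.neg_pi_le_pi]
  refine ae_eq_of_forall_setIntegral_eq_of_sigmaFinite
    (fun s _ _ => ((Lp.memLp _).integrable Fact.out).integrableOn)
    (fun s _ _ => hprod.integral_prod_left.integrableOn) fun s hs hμs => ?_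
  let ℓ : Lp ℝ q μ →L[ℝ] ℝ :=
    LinearMap.mkContinuousOfExistsBound
      { toFun := fun H => ∫ z in s, H z ∂μ
        map_add' := fun H K => by
          rw [← integral_add ((Lp.memLp H).integrable Fact.out).integrableOn
            ((Lp.memLp K).integrable Fact.out).integrableOn]
          exact integral_congr_ae (ae_restrict_of_ae (Lp.coeFn_add H K))
        map_smul' := fun c H => by
          rw [RingHom.id_apply, ← integral_smul]
          exact integral_congr_ae (ae_restrict_of_ae (Lp.coeFn_smul c H)) }
      (by
        set c : ℝ≥0∞ := μ Set.univ ^ (1 / (1 : ℝ≥0∞).toReal - 1 / q.toReal) with hc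
        have hctop : c ≠ ∞ := by
          refine ENNReal.rpow_ne_top_of_nonneg ?_ (measure_ne_top _ _)
          have : 1 ≤ q.toReal := by
            have := ENNReal.toReal_mono hq (Fact.out : 1 ≤ q)
            simpa using this
          simp only [ENNReal.toReal_one, div_one, one_div, sub_nonneg]
          exact inv_le_one_of_one_le₀ this
        refine ⟨c.toReal, fun H => ?_⟩
        have h1 : ‖∫ z in s, H z ∂μ‖ ≤ ∫ z, ‖H z‖ ∂μ :=
          (norm_integral_le_integral_norm _).trans (setIntegral_le_integral
            ((Lp.memLp H).integrable Fact.out).norm (.of_forall fun _ => norm_nonneg _))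
        refine h1.trans ?_
        rw [integral_norm_eq_lintegral_enorm (Lp.aestronglyMeasurable H),
          ← eLpNorm_one_eq_lintegral_enorm, Lp.norm_def, ← ENNReal.toReal_mul, mul_comm]
        exact ENNReal.toReal_mono (ENNReal.mul_ne_top (Lp.eLpNorm_ne_top _) hctop)
          (eLpNorm_le_eLpNorm_mul_rpow_measure_univ Fact.out (Lp.aestronglyMeasurable _)))
  have hℓ : ∀ H : Lp ℝ q μ, ℓ H = ∫ z in s, H z ∂μ := fun H => rfl
  have hprod' : Integrable (fun w : G × ℝ => v w.2 * g (w.1 + ι w.2))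
      ((μ.restrict s).prod (volume.restrict (Set.Ioc (-π) π))) :=
    hprod.mono_measure (Measure.prod_mono Measure.restrict_le_self le_rfl)
  rw [integral_integral_swap hprod', ← hℓ, PeriodicFlow.conv, map_strongIntegral,
    intervalIntegral.integral_of_le PeriodicFlow.neg_pi_le_pi]
  congr 1
  funext t
  rw [_root_.smul_apply, map_smul, hℓ, smul_eq_mul, ← integral_const_mul]
  refine integral_congr_ae (ae_restrict_of_ae ?_)
  filter_upwards [coeFn_translationFlow hq ι hι hper t F,
    (measurePreserving_add_right μ (ι t)).quasiMeasurePreserving.ae hF] with z h1 h2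
  rw [h1, h2]

end TranslationConv

section TranslationPointwise

variable {G : Type*} [AddCommGroup G] [TopologicalSpace G] [IsTopologicalAddGroup G]
  [SecondCountableTopology G] [MeasurableSpace G] [BorelSpace G] {μ : Measure G}
  [IsFiniteMeasure μ] [μ.InnerRegularCompactLTTop] [μ.IsAddRightInvariant] {q : ℝ≥0∞}
  [Fact (1 ≤ q)] (hq : q ≠ ∞) (ι : ℝ →+ G) (hι : Continuous ι) (hper : ι (2 * π) = 0)

omit [SecondCountableTopology G] in
theorem coeFn_diffOp_translationFlow {g : G → ℝ} {F : Lp ℝ q μ} (hF : F =ᵐ[μ] g) {α : ℝ}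
    (hα : 0 ≤ α) (h : ℝ) :
    (translationFlow hq ι hι hper).τ (α * h) ((translationFlow hq ι hι hper).diffOp α h F)
      =ᵐ[μ] fun z => ∑' ν : ℕ, (-1 : ℝ) ^ ν * fracBinom α ν * g (z + ι ((α - ν) * h)) := by
  set R := translationFlow (μ := μ) hq ι hι hper
  have hS := (R.hasSum_diffOp hα h F).mapL (R.τ (α * h))
  have hN : Summable fun ν : ℕ => ‖R.τ (α * h) (diffCoeff α ν • R.τ (-(ν * h)) F)‖ := by
    simp only [map_smul, norm_smul, R.norm_τ, norm_eq_abs]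
    exact (summable_abs_diffCoeff hα).mul_right _
  have hterm : ∀ᵐ z ∂μ, ∀ ν : ℕ, (R.τ (α * h) (diffCoeff α ν • R.τ (-(ν * h)) F)) z =
      (-1 : ℝ) ^ ν * fracBinom α ν * g (z + ι ((α - ν) * h)) := by
    refine ae_all_iff.2 fun ν => ?_
    have h1 : R.τ (α * h) (diffCoeff α ν • R.τ (-(ν * h)) F) =
        diffCoeff α ν • R.τ ((α - ν) * h) F := by
      rw [map_smul, ← R.τ_add]
      congr 3
      ring
    rw [h1]
    filter_upwards [Lp.coeFn_smul (diffCoeff α ν) (R.τ ((α - ν) * h) F),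
      coeFn_translationFlow hq ι hι hper ((α - ν) * h) F,
      (measurePreserving_add_right μ (ι ((α - ν) * h))).quasiMeasurePreserving.ae hF] with z h1 h2 h3
    rw [h1, Pi.smul_apply, h2, h3, smul_eq_mul, diffCoeff]
  filter_upwards [ae_tsum_eq_of_summable_norm hS hN, hterm] with z h1 h2
  rw [h1]
  exact tsum_congr h2

theorem V_zero_translationFlow_eq_zero {g : G → ℝ} (hg : Measurable g) {F : Lp ℝ q μ}
    (hF : F =ᵐ[μ] g) (hmean : ∀ᵐ z ∂μ, ∫ t in (-π)..π, g (z + ι t) = 0) :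
    (translationFlow hq ι hι hper).V 0 F = 0 := by
  refine Lp.ext ?_
  filter_upwards [coeFn_conv_translationFlow hq ι hι hper hg F hF (kernel 0),
    hmean, Lp.coeFn_zero ℝ q μ] with z h1 h2 h3
  rw [PeriodicFlow.V, h1, h3]
  simp only [kernel, ContinuousMap.const_apply, intervalIntegral.integral_const_mul, h2,
    mul_zero, Pi.zero_apply]

theorem V_translationFlow_eq_self {g : G → ℝ} (hg : Measurable g) {F : Lp ℝ q μ}
    (hF : F =ᵐ[μ] g) {N j : ℕ} (hN : N ≤ scaleDeg (j - 1))
    (hpoly : ∀ z, ∃ a b : ℕ → ℝ, ∀ t, g (z + ι t) = ∑ k ∈ Finset.range (N + 1),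
      (a k * Real.cos (k * t) + b k * Real.sin (k * t))) :
    (translationFlow hq ι hι hper).V j F = F := by
  refine Lp.ext ?_
  filter_upwards [coeFn_conv_translationFlow hq ι hι hper hg F hF (kernel j), hF]
    with z h1 h2
  obtain ⟨a, b, hab⟩ := hpoly z
  rw [PeriodicFlow.V, h1, h2]
  have h0 := hab 0
  simp only [map_zero, add_zero, mul_zero, Real.cos_zero, mul_one, Real.sin_zero] at h0
  rw [h0]
  have hcont : Continuous (kernel j) := (kernel j).continuous
  have hs : ∀ t, kernel j t * g (z + ι t) = ∑ k ∈ Finset.range (N + 1),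
      (a k * (kernel j t * Real.cos (k * t)) + b k * (kernel j t * Real.sin (k * t))) := fun t => by
    rw [hab, Finset.mul_sum]
    exact Finset.sum_congr rfl fun k _ => by ring
  simp only [hs]
  rw [intervalIntegral.integral_finsetSum fun k _ => by
    apply Continuous.intervalIntegrable; fun_prop]
  refine Finset.sum_congr rfl fun k hk => ?_
  rw [intervalIntegral.integral_add (by apply Continuous.intervalIntegrable; fun_prop)
    (by apply Continuous.intervalIntegrable; fun_prop), intervalIntegral.integral_const_mul,
    intervalIntegral.integral_const_mul, integral_kernel_mul_cos
      ((Nat.lt_succ_iff.1 (Finset.mem_range.1 hk)).trans hN),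
    PeriodicFlow.integral_mul_sin_eq_zero _ (kernel_even j), mul_one, mul_zero, add_zero]

end TranslationPointwise

/-- The trigonometric polynomial `∑ c k * cos (k * ·)` convolved with `φ`. -/
def cosConv (N : ℕ) (c : ℕ → ℝ) (φ : ℝ → ℝ) (x : ℝ) : ℝ :=
  ∑ k ∈ Finset.range (N + 1),
    (c k * (∫ s in (-π)..π, Real.cos (k * s) * φ s) * Real.cos (k * x) +
      c k * (∫ s in (-π)..π, Real.sin (k * s) * φ s) * Real.sin (k * x))

theorem integral_mul_comp_add_eq_cosConv {N : ℕ} {c : ℕ → ℝ} {v φ : ℝ → ℝ}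
    (hv : ∀ t, v t = ∑ k ∈ Finset.range (N + 1), c k * Real.cos (k * t))
    (hφ : Function.Periodic φ (2 * π)) (hi : IntervalIntegrable φ volume (-π) π) (x : ℝ) :
    ∫ t in (-π)..π, v t * φ (x + t) = cosConv N c φ x := by
  have hvp : Function.Periodic v (2 * π) := fun t => by
    simp only [hv]
    refine Finset.sum_congr rfl fun k _ => ?_
    rw [mul_add, Real.cos_add_nat_mul_two_pi]
  have h1 : ∫ t in (-π)..π, v t * φ (x + t) = ∫ s in (-π)..π, v (s - x) * φ s := by
    have h2 : ∀ t, v t * φ (x + t) = (fun s => v (s - x) * φ s) (t + x) := fun t => by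
      simp [add_comm x t]
    simp only [h2]
    rw [intervalIntegral.integral_comp_add_right (fun s => v (s - x) * φ s)]
    have hp : Function.Periodic (fun s => v (s - x) * φ s) (2 * π) := fun s => by
      simp only
      rw [hφ, add_sub_right_comm, hvp]
    have := hp.intervalIntegral_add_eq (-π + x) (-π)
    rw [show -π + x + 2 * π = π + x by ring, show -π + 2 * π = π by ring] at this
    exact this
  rw [h1, cosConv]
  have hs : ∀ s, v (s - x) * φ s = ∑ k ∈ Finset.range (N + 1),
      (c k * Real.cos (k * x) * (Real.cos (k * s) * φ s) +
        c k * Real.sin (k * x) * (Real.sin (k * s) * φ s)) := fun s => by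
    rw [hv, Finset.sum_mul]
    refine Finset.sum_congr rfl fun k _ => ?_
    rw [mul_sub, Real.cos_sub]
    ring
  have hci : ∀ k : ℕ, IntervalIntegrable (fun s => Real.cos (k * s) * φ s) volume (-π) π :=
    fun k => hi.continuousOn_mul (by fun_prop)
  have hsi : ∀ k : ℕ, IntervalIntegrable (fun s => Real.sin (k * s) * φ s) volume (-π) π :=
    fun k => hi.continuousOn_mul (by fun_prop)
  simp only [hs]
  rw [intervalIntegral.integral_finsetSum fun k _ =>
    ((hci k).const_mul _).add ((hsi k).const_mul _)]
  refine Finset.sum_congr rfl fun k _ => ?_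
  rw [intervalIntegral.integral_add ((hci k).const_mul _) ((hsi k).const_mul _),
    intervalIntegral.integral_const_mul, intervalIntegral.integral_const_mul]
  ring

section Torus

instance : Fact (0 < 2 * π) := ⟨two_pi_pos⟩

/-- The two-dimensional torus. -/
abbrev Torus : Type := AddCircle (2 * π) × AddCircle (2 * π)

instance : (volume : Measure Torus).IsAddRightInvariant :=
  inferInstanceAs
    ((volume : Measure (AddCircle (2 * π))).prod (volume : Measure (AddCircle (2 * π)))).IsAddRightInvariant

/-- Functions that are `2π`-periodic in each variable. -/
structure BiPeriodic (g : ℝ → ℝ → ℝ) : Prop where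
  left : ∀ y, Function.Periodic (fun x => g x y) (2 * π)
  right : ∀ x, Function.Periodic (g x) (2 * π)

/-- The function on the torus induced by a doubly periodic function. -/
def torusLift (g : ℝ → ℝ → ℝ) (z : Torus) : ℝ :=
  g (AddCircle.equivIoc (2 * π) 0 z.1) (AddCircle.equivIoc (2 * π) 0 z.2)

theorem Function.Periodic.apply_equivIoc {β : Type*} {φ : ℝ → β}
    (hφ : Function.Periodic φ (2 * π)) (x : ℝ) :
    φ (AddCircle.equivIoc (2 * π) 0 (x : AddCircle (2 * π))) = φ x := by
  have h : ((AddCircle.equivIoc (2 * π) 0 (x : AddCircle (2 * π)) : ℝ) : AddCircle (2 * π)) = x :=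
    AddCircle.coe_equivIoc
  rw [← hφ.lift_coe, h, hφ.lift_coe]

theorem BiPeriodic.torusLift_coe {g : ℝ → ℝ → ℝ} (hg : BiPeriodic g) (x y : ℝ) :
    torusLift g ((x : AddCircle (2 * π)), (y : AddCircle (2 * π))) = g x y := by
  rw [torusLift, (hg.right _).apply_equivIoc y]
  exact (hg.left y).apply_equivIoc x

theorem measurable_torusLift {g : ℝ → ℝ → ℝ} (hg : Measurable (Function.uncurry g)) :
    Measurable (torusLift g) := by
  have h : Measurable fun b : AddCircle (2 * π) => (AddCircle.equivIoc (2 * π) 0 b : ℝ) :=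
    measurable_subtype_coe.comp (AddCircle.measurableEquivIoc (2 * π) 0).measurable
  exact hg.comp ((h.comp measurable_fst).prodMk (h.comp measurable_snd))

theorem Torus.exists_coe (z : Torus) : ∃ x y : ℝ, z = ((x : AddCircle (2 * π)), (y : AddCircle (2 * π))) := by
  obtain ⟨a, b⟩ := z
  induction a using QuotientAddGroup.induction_on with | _ x => ?_
  induction b using QuotientAddGroup.induction_on with | _ y => ?_
  exact ⟨x, y, rfl⟩

/-- Translation in the first coordinate. -/
def dirX : ℝ →+ Torus :=
  (AddMonoidHom.inl _ _).comp (QuotientAddGroup.mk' (AddSubgroup.zmultiples (2 * π)))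

/-- Translation in the second coordinate. -/
def dirY : ℝ →+ Torus :=
  (AddMonoidHom.inr _ _).comp (QuotientAddGroup.mk' (AddSubgroup.zmultiples (2 * π)))

theorem dirX_apply (t : ℝ) : dirX t = ((t : AddCircle (2 * π)), 0) := rfl

theorem dirY_apply (t : ℝ) : dirY t = (0, (t : AddCircle (2 * π))) := rfl

theorem continuous_dirX : Continuous dirX :=
  (AddCircle.continuous_mk' (2 * π)).prodMk continuous_const

theorem continuous_dirY : Continuous dirY :=
  continuous_const.prodMk (AddCircle.continuous_mk' (2 * π))

theorem dirX_two_pi : dirX (2 * π) = 0 := by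
  rw [dirX_apply, AddCircle.coe_period]; rfl

theorem dirY_two_pi : dirY (2 * π) = 0 := by
  rw [dirY_apply, AddCircle.coe_period]; rfl

theorem BiPeriodic.torusLift_coe_add_dirX {g : ℝ → ℝ → ℝ} (hg : BiPeriodic g) (x y t : ℝ) :
    torusLift g (((x : AddCircle (2 * π)), (y : AddCircle (2 * π))) + dirX t) = g (x + t) y := by
  rw [dirX_apply, Prod.mk_add_mk, add_zero, ← AddCircle.coe_add, hg.torusLift_coe]

theorem BiPeriodic.torusLift_coe_add_dirY {g : ℝ → ℝ → ℝ} (hg : BiPeriodic g) (x y t : ℝ) :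
    torusLift g (((x : AddCircle (2 * π)), (y : AddCircle (2 * π))) + dirY t) = g x (y + t) := by
  rw [dirY_apply, Prod.mk_add_mk, add_zero, ← AddCircle.coe_add, hg.torusLift_coe]

theorem AddCircle.ae_of_ae_coe {P : AddCircle (2 * π) → Prop}
    (h : ∀ᵐ x : ℝ, P x) : ∀ᵐ b : AddCircle (2 * π), P b := by
  have h1 : ∀ᵐ s : Set.Ioc (0 : ℝ) (0 + 2 * π) ∂(Measure.comap (Subtype.val : Set.Ioc (0 : ℝ) (0 + 2 * π) → ℝ) volume),
      P ((s : ℝ) : AddCircle (2 * π)) := by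
    rw [ae_iff, (MeasurableEmbedding.subtype_coe measurableSet_Ioc).comap_apply]
    refine measure_mono_null ?_ (ae_iff.1 h)
    rintro _ ⟨s, hs, rfl⟩
    exact hs
  filter_upwards [(AddCircle.measurePreserving_equivIoc (2 * π)
    (a := 0)).quasiMeasurePreserving.ae h1] with b hb
  rwa [AddCircle.coe_equivIoc] at hb

theorem Torus.ae_snd {P : AddCircle (2 * π) → Prop} (h : ∀ᵐ x : ℝ, P x) :
    ∀ᵐ z : Torus, P z.2 :=
  Measure.quasiMeasurePreserving_snd.ae (AddCircle.ae_of_ae_coe h)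

theorem Torus.ae_fst {P : AddCircle (2 * π) → Prop} (h : ∀ᵐ x : ℝ, P x) :
    ∀ᵐ z : Torus, P z.1 :=
  Measure.quasiMeasurePreserving_fst.ae (AddCircle.ae_of_ae_coe h)

theorem BiPeriodic.Lp2Norm_eq_lintegral {g : ℝ → ℝ → ℝ} (hg : BiPeriodic g) {p : ℝ}
    (hm : AEMeasurable (torusLift g)) :
    Lp2Norm p g = (∫⁻ z : Torus, ENNReal.ofReal (|torusLift g z| ^ p)) ^ (1 / p) := by
  rw [Lp2Norm, Measure.volume_eq_prod, lintegral_prod]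
  · congr 1
    rw [← AddCircle.lintegral_preimage (2 * π) 0, zero_add]
    refine lintegral_congr fun x => ?_
    rw [← AddCircle.lintegral_preimage (2 * π) 0, zero_add]
    exact lintegral_congr fun y => by rw [hg.torusLift_coe]
  · have h : Measurable fun r : ℝ => ENNReal.ofReal (|r| ^ p) := by fun_prop
    exact h.comp_aemeasurable hm

end Torus

section Represents

variable {p : ℝ}

/-- The doubly periodic function `g` represents the class `F` on the torus. -/
structure Represents (g : ℝ → ℝ → ℝ) (F : Lp ℝ (ENNReal.ofReal p) (volume : Measure Torus)) :
    Prop where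
  periodic : BiPeriodic g
  ae_eq : F =ᵐ[volume] torusLift g

theorem lintegral_rpow_eq_eLpNorm (hp : 0 < p) (g : Torus → ℝ) :
    (∫⁻ z : Torus, ENNReal.ofReal (|g z| ^ p)) ^ (1 / p) =
      eLpNorm g (ENNReal.ofReal p) volume := by
  rw [eLpNorm_eq_lintegral_rpow_enorm_toReal (by simpa using hp) ENNReal.ofReal_ne_top,
    ENNReal.toReal_ofReal hp.le]
  congr 1
  refine lintegral_congr fun z => ?_
  rw [← ENNReal.ofReal_rpow_of_nonneg (abs_nonneg _) hp.le, ← Real.norm_eq_abs, ofReal_norm]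

namespace Represents

variable {g g' : ℝ → ℝ → ℝ} {F F' : Lp ℝ (ENNReal.ofReal p) (volume : Measure Torus)}

theorem Lp2Norm_eq (hp : 0 < p) (h : Represents g F) : Lp2Norm p g = ENNReal.ofReal ‖F‖ := by
  rw [h.periodic.Lp2Norm_eq_lintegral ((Lp.aestronglyMeasurable F).aemeasurable.congr h.ae_eq),
    lintegral_rpow_eq_eLpNorm hp, ← eLpNorm_congr_ae h.ae_eq, Lp.norm_def,
    ENNReal.ofReal_toReal (Lp.eLpNorm_ne_top F)]

theorem sub (h : Represents g F) (h' : Represents g' F') :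
    Represents (fun x y => g x y - g' x y) (F - F') where
  periodic := ⟨fun y x => congrArg₂ _ (h.periodic.left y x) (h'.periodic.left y x),
    fun x y => congrArg₂ _ (h.periodic.right x y) (h'.periodic.right x y)⟩
  ae_eq := by
    filter_upwards [Lp.coeFn_sub F F', h.ae_eq, h'.ae_eq] with z h1 h2 h3
    rw [h1, Pi.sub_apply, h2, h3]
    rfl

end Represents

theorem BiPeriodic.exists_represents {g : ℝ → ℝ → ℝ} (hg : BiPeriodic g) (hp : 0 < p)
    (hm : Measurable (Function.uncurry g)) (hfin : Lp2Norm p g ≠ ⊤) :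
    ∃ F : Lp ℝ (ENNReal.ofReal p) (volume : Measure Torus), Represents g F := by
  have hm' := measurable_torusLift hm
  have h : MemLp (torusLift g) (ENNReal.ofReal p) (volume : Measure Torus) := by
    refine ⟨hm'.aestronglyMeasurable, ?_⟩
    rw [← lintegral_rpow_eq_eLpNorm hp, ← hg.Lp2Norm_eq_lintegral hm'.aemeasurable]
    exact hfin.lt_top
  exact ⟨h.toLp _, hg, h.coeFn_toLp⟩

theorem BiPeriodic.swap {g : ℝ → ℝ → ℝ} (hg : BiPeriodic g) : BiPeriodic fun x y => g y x :=
  ⟨hg.right, hg.left⟩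

theorem BiPeriodic.diffX {g : ℝ → ℝ → ℝ} (hg : BiPeriodic g) (α h : ℝ) :
    BiPeriodic (diffX α h g) where
  left y x := tsum_congr fun ν => by
    rw [add_right_comm]
    congr 1
    exact hg.left y _
  right x y := tsum_congr fun ν => by rw [hg.right]

theorem BiPeriodic.diffY {g : ℝ → ℝ → ℝ} (hg : BiPeriodic g) (α h : ℝ) :
    BiPeriodic (diffY α h g) := (hg.swap.diffX α h).swap

variable [Fact (1 ≤ ENNReal.ofReal p)]

variable (p) in
/-- Translations in the first variable. -/
def flowX : PeriodicFlow (Lp ℝ (ENNReal.ofReal p) (volume : Measure Torus)) :=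
  translationFlow ENNReal.ofReal_ne_top dirX continuous_dirX dirX_two_pi

variable (p) in
/-- Translations in the second variable. -/
def flowY : PeriodicFlow (Lp ℝ (ENNReal.ofReal p) (volume : Measure Torus)) :=
  translationFlow ENNReal.ofReal_ne_top dirY continuous_dirY dirY_two_pi

theorem flowY_commutes_flowX (s : ℝ) : (flowY p).Commutes ((flowX p).τ s) :=
  translationFlow_comm _ _ continuous_dirX _ _ _ _ s

theorem flowX_commutes_flowY (s : ℝ) : (flowX p).Commutes ((flowY p).τ s) :=
  translationFlow_comm _ _ continuous_dirY _ _ _ _ s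

namespace Represents

variable {g g' : ℝ → ℝ → ℝ} {F F' : Lp ℝ (ENNReal.ofReal p) (volume : Measure Torus)}

theorem diffX (h : Represents g F) {α : ℝ} (hα : 0 ≤ α) (s : ℝ) :
    Represents (diffX α s g) ((flowX p).τ (α * s) ((flowX p).diffOp α s F)) where
  periodic := h.periodic.diffX α s
  ae_eq := by
    filter_upwards [coeFn_diffOp_translationFlow ENNReal.ofReal_ne_top dirX continuous_dirX
      dirX_two_pi h.ae_eq hα s] with z hz
    obtain ⟨x, y, rfl⟩ := z.exists_coe
    rw [flowX, hz, (h.periodic.diffX α s).torusLift_coe]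
    exact tsum_congr fun ν => by rw [h.periodic.torusLift_coe_add_dirX]

theorem diffY (h : Represents g F) {α : ℝ} (hα : 0 ≤ α) (s : ℝ) :
    Represents (diffY α s g) ((flowY p).τ (α * s) ((flowY p).diffOp α s F)) where
  periodic := h.periodic.diffY α s
  ae_eq := by
    filter_upwards [coeFn_diffOp_translationFlow ENNReal.ofReal_ne_top dirY continuous_dirY
      dirY_two_pi h.ae_eq hα s] with z hz
    obtain ⟨x, y, rfl⟩ := z.exists_coe
    rw [flowY, hz, (h.periodic.diffY α s).torusLift_coe]
    exact tsum_congr fun ν => by rw [h.periodic.torusLift_coe_add_dirY]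

theorem Lp2Norm_diffX_diffY (hp : 0 < p) (h : Represents g F) {α₁ α₂ : ℝ} (hα₁ : 0 ≤ α₁)
    (hα₂ : 0 ≤ α₂) (h₁ h₂ : ℝ) : Lp2Norm p (_root_.diffX α₁ h₁ (_root_.diffY α₂ h₂ g)) =
      ENNReal.ofReal ‖(flowX p).diffOp α₁ h₁ ((flowY p).diffOp α₂ h₂ F)‖ := by
  have hc : (flowY p).Commutes ((flowX p).diffOp α₁ h₁) := fun t x =>
    ((flowX_commutes_flowY t).diffOp hα₁ h₁ x).symm
  rw [((h.diffY hα₂ h₂).diffX hα₁ h₁).Lp2Norm_eq hp, (flowX p).norm_τ, hc, (flowY p).norm_τ]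

theorem V_zero_flowX (h : Represents g F) (hm : Measurable (Function.uncurry g))
    (hmean : ∀ᵐ y : ℝ, ∫ x in (0 : ℝ)..(2 * π), g x y = 0) : (flowX p).V 0 F = 0 := by
  refine V_zero_translationFlow_eq_zero _ _ continuous_dirX _ (measurable_torusLift hm) h.ae_eq ?_
  have h1 : ∀ᵐ y : ℝ, ∀ x : ℝ, ∫ t in (-π)..π, torusLift g
      (((x : AddCircle (2 * π)), (y : AddCircle (2 * π))) + dirX t) = 0 := by
    filter_upwards [hmean] with y hy x
    simp only [h.periodic.torusLift_coe_add_dirX]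
    rw [intervalIntegral.integral_comp_add_left (fun s => g s y), ← hy]
    have := (h.periodic.left y).intervalIntegral_add_eq (x + -π) 0
    rwa [show x + -π + 2 * π = x + π by ring, zero_add] at this
  have h2 := Torus.ae_snd (P := fun b => ∀ x : ℝ, ∫ t in (-π)..π, torusLift g
      (((x : AddCircle (2 * π)), b) + dirX t) = 0) h1
  filter_upwards [h2] with z hz
  obtain ⟨x, y, rfl⟩ := z.exists_coe
  exact hz x

theorem V_zero_flowY (h : Represents g F) (hm : Measurable (Function.uncurry g))
    (hmean : ∀ᵐ x : ℝ, ∫ y in (0 : ℝ)..(2 * π), g x y = 0) : (flowY p).V 0 F = 0 := by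
  refine V_zero_translationFlow_eq_zero _ _ continuous_dirY _ (measurable_torusLift hm) h.ae_eq ?_
  have h1 : ∀ᵐ x : ℝ, ∀ y : ℝ, ∫ t in (-π)..π, torusLift g
      (((x : AddCircle (2 * π)), (y : AddCircle (2 * π))) + dirY t) = 0 := by
    filter_upwards [hmean] with x hx y
    simp only [h.periodic.torusLift_coe_add_dirY]
    rw [intervalIntegral.integral_comp_add_left (fun s => g x s), ← hx]
    have := (h.periodic.right x).intervalIntegral_add_eq (y + -π) 0
    rwa [show y + -π + 2 * π = y + π by ring, zero_add] at this
  have h2 := Torus.ae_fst (P := fun b => ∀ y : ℝ, ∫ t in (-π)..π, torusLift g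
      ((b, (y : AddCircle (2 * π))) + dirY t) = 0) h1
  filter_upwards [h2] with z hz
  obtain ⟨x, y, rfl⟩ := z.exists_coe
  exact hz y

end Represents

end Represents

section AngularApproximation

theorem exists_shift_trig_coeff (N : ℕ) (a b : ℕ → ℝ) (x : ℝ) : ∃ a' b' : ℕ → ℝ, ∀ t,
    ∑ k ∈ Finset.range (N + 1), (a k * Real.cos (k * (x + t)) + b k * Real.sin (k * (x + t))) =
      ∑ k ∈ Finset.range (N + 1), (a' k * Real.cos (k * t) + b' k * Real.sin (k * t)) := by
  refine ⟨fun k => a k * Real.cos (k * x) + b k * Real.sin (k * x),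
    fun k => b k * Real.cos (k * x) - a k * Real.sin (k * x), fun t => ?_⟩
  refine Finset.sum_congr rfl fun k _ => ?_
  rw [mul_add, Real.cos_add, Real.sin_add]
  ring

theorem periodic_trig_sum (N : ℕ) (a b : ℕ → ℝ) :
    Function.Periodic (fun x => ∑ k ∈ Finset.range (N + 1),
      (a k * Real.cos (k * x) + b k * Real.sin (k * x))) (2 * π) := fun x => by
  refine Finset.sum_congr rfl fun k _ => ?_
  rw [mul_add, Real.cos_add_nat_mul_two_pi, Real.sin_add_nat_mul_two_pi]

theorem sum_range_extend {M : Type*} [AddCommMonoid M] {m n : ℕ} (h : m ≤ n) (u : ℕ → M) :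
    ∑ k ∈ Finset.range (n + 1), (if k < m + 1 then u k else 0) =
      ∑ k ∈ Finset.range (m + 1), u k := by
  rw [← Finset.sum_filter]
  congr 1
  ext k
  simp only [Finset.mem_filter, Finset.mem_range]
  omega

variable {p : ℝ}

theorem TrigPolyX.biPeriodic {m : ℕ} {T : ℝ → ℝ → ℝ} (hT : TrigPolyX p m T) :
    BiPeriodic T ∧ ∀ y, ∃ a b : ℕ → ℝ, ∀ x, T x y = ∑ k ∈ Finset.range (m + 1),
      (a k * Real.cos (k * x) + b k * Real.sin (k * x)) := by
  obtain ⟨-, -, hper, a, b, hab⟩ := hT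
  refine ⟨⟨fun y => ?_, hper⟩, fun y => ⟨fun k => a k y, fun k => b k y, fun x => hab x y⟩⟩
  simp only [hab]
  exact periodic_trig_sum m (fun k => a k y) fun k => b k y

theorem TrigPolyY.biPeriodic {m : ℕ} {T : ℝ → ℝ → ℝ} (hT : TrigPolyY p m T) :
    BiPeriodic T ∧ ∀ x, ∃ a b : ℕ → ℝ, ∀ y, T x y = ∑ k ∈ Finset.range (m + 1),
      (a k * Real.cos (k * y) + b k * Real.sin (k * y)) := by
  obtain ⟨-, -, hper, a, b, hab⟩ := hT
  refine ⟨⟨hper, fun x => ?_⟩, fun x => ⟨fun k => a k x, fun k => b k x, fun y => hab x y⟩⟩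
  have : T x = fun y => ∑ k ∈ Finset.range (m + 1),
    (a k x * Real.cos (k * y) + b k x * Real.sin (k * y)) := funext (hab x)
  rw [this]
  exact periodic_trig_sum m (fun k => a k x) fun k => b k x

theorem TrigPolyX.mono {m n : ℕ} (h : m ≤ n) {T : ℝ → ℝ → ℝ} (hT : TrigPolyX p m T) :
    TrigPolyX p n T := by
  obtain ⟨h1, h2, h3, a, b, hab⟩ := hT
  refine ⟨h1, h2, h3, fun k y => if k < m + 1 then a k y else 0,
    fun k y => if k < m + 1 then b k y else 0, fun x y => ?_⟩
  rw [hab, ← sum_range_extend h]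
  refine Finset.sum_congr rfl fun k _ => ?_
  by_cases hk : k < m + 1
  · simp only [if_pos hk]
  · simp only [if_neg hk, zero_mul, add_zero]

theorem TrigPolyY.mono {m n : ℕ} (h : m ≤ n) {T : ℝ → ℝ → ℝ} (hT : TrigPolyY p m T) :
    TrigPolyY p n T := by
  obtain ⟨h1, h2, h3, a, b, hab⟩ := hT
  refine ⟨h1, h2, h3, fun k y => if k < m + 1 then a k y else 0,
    fun k y => if k < m + 1 then b k y else 0, fun x y => ?_⟩
  rw [hab, ← sum_range_extend h]
  refine Finset.sum_congr rfl fun k _ => ?_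
  by_cases hk : k < m + 1
  · simp only [if_pos hk]
  · simp only [if_neg hk, zero_mul, add_zero]

theorem Yapprox_antitone (g : ℝ → ℝ → ℝ) {k₁ k₂ l₁ l₂ : ℕ} (h₁ : k₁ ≤ l₁) (h₂ : k₂ ≤ l₂) :
    Yapprox p l₁ l₂ g ≤ Yapprox p k₁ k₂ g :=
  le_iInf₂ fun T₁ hT₁ => le_iInf₂ fun T₂ hT₂ =>
    (iInf₂_le T₁ (hT₁.mono h₁)).trans (iInf₂_le T₂ (hT₂.mono h₂))

theorem measurable_cosConv (N : ℕ) (c : ℕ → ℝ) {g : ℝ → ℝ → ℝ}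
    (hg : Measurable (Function.uncurry g)) :
    Measurable (Function.uncurry fun x y => cosConv N c (fun s => g s y) x) := by
  have hint : ∀ w : ℝ → ℝ, Measurable w →
      Measurable fun z : ℝ × ℝ => ∫ s in (-π)..π, w s * g s z.2 := fun w hw => by
    simp only [intervalIntegral.integral_of_le PeriodicFlow.neg_pi_le_pi]
    have : Measurable (Function.uncurry fun (z : ℝ × ℝ) s => w s * g s z.2) :=
      (hw.comp measurable_snd).mul (hg.comp (measurable_snd.prodMk measurable_fst.snd))
    exact this.stronglyMeasurable.integral_prod_right.measurable
  change Measurable fun w : ℝ × ℝ => ∑ k ∈ Finset.range (N + 1),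
    (c k * (∫ s in (-π)..π, Real.cos (k * s) * g s w.2) * Real.cos (k * w.1) +
      c k * (∫ s in (-π)..π, Real.sin (k * s) * g s w.2) * Real.sin (k * w.1))
  refine Finset.measurable_fun_sum _ fun k _ => ?_
  have h1 := hint (fun s => Real.cos (k * s)) (by fun_prop)
  have h2 := hint (fun s => Real.sin (k * s)) (by fun_prop)
  exact ((measurable_const.mul h1).mul (by fun_prop)).add
    ((measurable_const.mul h2).mul (by fun_prop))

theorem measurable_cosConv_swap (N : ℕ) (c : ℕ → ℝ) {g : ℝ → ℝ → ℝ}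
    (hg : Measurable (Function.uncurry g)) :
    Measurable (Function.uncurry fun x y => cosConv N c (g x) y) := by
  have h := measurable_cosConv N c (g := fun x y => g y x) (hg.comp measurable_swap)
  have h2 := h.comp measurable_swap
  exact h2

theorem periodic_cosConv (N : ℕ) (c : ℕ → ℝ) (φ : ℝ → ℝ) :
    Function.Periodic (cosConv N c φ) (2 * π) := periodic_trig_sum N _ _

theorem BiPeriodic.cosConv {g : ℝ → ℝ → ℝ} (hg : BiPeriodic g) (N : ℕ) (c : ℕ → ℝ) :
    BiPeriodic fun x y => cosConv N c (fun s => g s y) x where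
  left y := periodic_cosConv N c _
  right x y := by
    have : (fun s => g s (y + 2 * π)) = fun s => g s y := funext fun s => hg.right s y
    simp only [this]

variable [Fact (1 ≤ ENNReal.ofReal p)] {F : Lp ℝ (ENNReal.ofReal p) (volume : Measure Torus)}

theorem TrigPolyX.V_eq_self {m j : ℕ} {T : ℝ → ℝ → ℝ} (hT : TrigPolyX p m T)
    (hm : m ≤ scaleDeg (j - 1)) (hF : Represents T F) : (flowX p).V j F = F := by
  refine V_translationFlow_eq_self _ _ continuous_dirX _ (measurable_torusLift hT.1) hF.ae_eq hm
    fun z => ?_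
  obtain ⟨x, y, rfl⟩ := z.exists_coe
  obtain ⟨hper, h⟩ := hT.biPeriodic
  obtain ⟨a, b, hab⟩ := h y
  obtain ⟨a', b', h'⟩ := exists_shift_trig_coeff m a b x
  exact ⟨a', b', fun t => by rw [hper.torusLift_coe_add_dirX, hab, h']⟩

theorem TrigPolyY.V_eq_self {m j : ℕ} {T : ℝ → ℝ → ℝ} (hT : TrigPolyY p m T)
    (hm : m ≤ scaleDeg (j - 1)) (hF : Represents T F) : (flowY p).V j F = F := by
  refine V_translationFlow_eq_self _ _ continuous_dirY _ (measurable_torusLift hT.1) hF.ae_eq hm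
    fun z => ?_
  obtain ⟨x, y, rfl⟩ := z.exists_coe
  obtain ⟨hper, h⟩ := hT.biPeriodic
  obtain ⟨a, b, hab⟩ := h x
  obtain ⟨a', b', h'⟩ := exists_shift_trig_coeff m a b y
  exact ⟨a', b', fun t => by rw [hper.torusLift_coe_add_dirY, hab, h']⟩

variable {g : ℝ → ℝ → ℝ}

theorem Represents.exists_trigPolyX (h : Represents g F) (hp : 0 < p)
    (hm : Measurable (Function.uncurry g)) (i : ℕ) :
    ∃ T, TrigPolyX p (scaleDeg i) T ∧ Represents T ((flowX p).V i F) := by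
  obtain ⟨c, hc⟩ := isCosPoly_kernel i
  have hrep : Represents (fun x y => _root_.cosConv (scaleDeg i) c (fun s => g s y) x)
      ((flowX p).V i F) := by
    refine ⟨h.periodic.cosConv _ c, ?_⟩
    have hgi : Integrable (torusLift g) := ((Lp.memLp F).integrable Fact.out).congr h.ae_eq
    have hgm := measurable_torusLift hm
    filter_upwards [coeFn_conv_translationFlow ENNReal.ofReal_ne_top dirX continuous_dirX
      dirX_two_pi hgm F h.ae_eq (kernel i), ae_intervalIntegrable_translate dirX continuous_dirX
      hgm hgi] with z h1 h2
    obtain ⟨x, y, rfl⟩ := z.exists_coe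
    rw [PeriodicFlow.V, flowX, h1, (h.periodic.cosConv _ c).torusLift_coe]
    simp only [h.periodic.torusLift_coe_add_dirX] at h2 ⊢
    refine integral_mul_comp_add_eq_cosConv hc (h.periodic.left y) ?_ x
    have h3 := (h2.comp_add_left (-x))
    refine (h.periodic.left y).intervalIntegrable two_pi_pos.ne' (t := -π + x) ?_ _ _
    convert h3 using 1
    · simp
    · ring
    · ring
  refine ⟨_, ⟨measurable_cosConv _ c hm, ?_, hrep.periodic.right,
    fun k y => c k * ∫ s in (-π)..π, Real.cos (k * s) * g s y,
    fun k y => c k * ∫ s in (-π)..π, Real.sin (k * s) * g s y, fun x y => rfl⟩, hrep⟩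
  rw [hrep.Lp2Norm_eq hp]
  exact ENNReal.ofReal_ne_top

theorem Represents.exists_trigPolyY (h : Represents g F) (hp : 0 < p)
    (hm : Measurable (Function.uncurry g)) (i : ℕ) :
    ∃ T, TrigPolyY p (scaleDeg i) T ∧ Represents T ((flowY p).V i F) := by
  obtain ⟨c, hc⟩ := isCosPoly_kernel i
  have hrep : Represents (fun x y => _root_.cosConv (scaleDeg i) c (g x) y)
      ((flowY p).V i F) := by
    refine ⟨(h.periodic.swap.cosConv _ c).swap, ?_⟩
    have hgi : Integrable (torusLift g) := ((Lp.memLp F).integrable Fact.out).congr h.ae_eq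
    have hgm := measurable_torusLift hm
    filter_upwards [coeFn_conv_translationFlow ENNReal.ofReal_ne_top dirY continuous_dirY
      dirY_two_pi hgm F h.ae_eq (kernel i), ae_intervalIntegrable_translate dirY continuous_dirY
      hgm hgi] with z h1 h2
    obtain ⟨x, y, rfl⟩ := z.exists_coe
    rw [PeriodicFlow.V, flowY, h1, ((h.periodic.swap.cosConv _ c).swap).torusLift_coe]
    simp only [h.periodic.torusLift_coe_add_dirY] at h2 ⊢
    refine integral_mul_comp_add_eq_cosConv hc (h.periodic.right x) ?_ y
    have h3 := (h2.comp_add_left (-y))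
    refine (h.periodic.right x).intervalIntegrable two_pi_pos.ne' (t := -π + y) ?_ _ _
    convert h3 using 1
    · simp
    · ring
    · ring
  have hmeas : Measurable (Function.uncurry fun x y => _root_.cosConv (scaleDeg i) c (g x) y) :=
    measurable_cosConv_swap _ c hm
  refine ⟨fun x y => _root_.cosConv (scaleDeg i) c (g x) y, ⟨hmeas, ?_, hrep.periodic.left,
    fun k x => c k * ∫ s in (-π)..π, Real.cos (k * s) * g x s,
    fun k x => c k * ∫ s in (-π)..π, Real.sin (k * s) * g x s, fun x y => rfl⟩, hrep⟩
  rw [hrep.Lp2Norm_eq hp]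
  exact ENNReal.ofReal_ne_top

theorem Represents.Yapprox_le (h : Represents g F) (hp : 0 < p)
    (hm : Measurable (Function.uncurry g)) {i₁ i₂ k₁ k₂ : ℕ} (h₁ : scaleDeg i₁ ≤ k₁)
    (h₂ : scaleDeg i₂ ≤ k₂) : Yapprox p k₁ k₂ g ≤ ENNReal.ofReal
      ‖F - (flowY p).V i₂ F - (flowX p).V i₁ (F - (flowY p).V i₂ F)‖ := by
  obtain ⟨T₂, hT₂, hF₂⟩ := h.exists_trigPolyY hp hm i₂
  obtain ⟨T₁, hT₁, hF₁⟩ := (h.sub hF₂).exists_trigPolyX hp (hm.sub hT₂.1) i₁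
  refine (iInf₂_le T₁ (hT₁.mono h₁)).trans ((iInf₂_le T₂ (hT₂.mono h₂)).trans ?_)
  rw [((h.sub hF₁).sub hF₂).Lp2Norm_eq hp, sub_right_comm]

theorem block_eq_zero {X : Type*} [NormedAddCommGroup X] [NormedSpace ℝ X] [CompleteSpace X]
    (R : PeriodicFlow X) {m j : ℕ} {x : X} (h : ∀ i, j ≤ i → R.V i x = x) (hj : j ≤ m) :
    R.block m j x = 0 := by
  rcases hj.lt_or_eq with hj | rfl
  · rw [R.block_of_lt hj, R.Δ_apply, h j le_rfl, h _ (Nat.le_succ j), sub_self]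
  · rw [R.block_self_apply, h j le_rfl, sub_self]

theorem norm_block_le {X : Type*} [NormedAddCommGroup X] [NormedSpace ℝ X] [CompleteSpace X]
    (R : PeriodicFlow X) {m j : ℕ} (hj : j ≤ m) (x : X) : ‖R.block m j x‖ ≤ 20000 * ‖x‖ := by
  rcases hj.lt_or_eq with hj | rfl
  · rw [R.block_of_lt hj]
    exact R.norm_Δ_le j x
  · rw [R.block_self_apply]
    have := R.norm_sub_V_le j x
    have := norm_nonneg x
    linarith

theorem Represents.norm_block_block_le_Yapprox (h : Represents g F) (hp : 0 < p)
    {m₁ m₂ j₁ j₂ : ℕ} (h₁ : j₁ ≤ m₁) (h₂ : j₂ ≤ m₂) :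
    ENNReal.ofReal (‖(flowX p).block m₁ j₁ ((flowY p).block m₂ j₂ F)‖ / 400000000) ≤
      Yapprox p (scaleDeg (j₁ - 1)) (scaleDeg (j₂ - 1)) g := by
  refine le_iInf₂ fun T₁ hT₁ => le_iInf₂ fun T₂ hT₂ => ?_
  obtain ⟨F₁, hF₁⟩ := hT₁.biPeriodic.1.exists_represents hp hT₁.1 hT₁.2.1
  obtain ⟨F₂, hF₂⟩ := hT₂.biPeriodic.1.exists_represents hp hT₂.1 hT₂.2.1
  rw [((h.sub hF₁).sub hF₂).Lp2Norm_eq hp]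
  refine ENNReal.ofReal_le_ofReal ?_
  have hX : (flowX p).block m₁ j₁ F₁ = 0 := block_eq_zero _ (fun i hi =>
    hT₁.V_eq_self (PeriodicFlow.scaleDeg_mono (Nat.sub_le_sub_right hi 1)) hF₁) h₁
  have hY : (flowY p).block m₂ j₂ F₂ = 0 := block_eq_zero _ (fun i hi =>
    hT₂.V_eq_self (PeriodicFlow.scaleDeg_mono (Nat.sub_le_sub_right hi 1)) hF₂) h₂
  have hc : (flowX p).Commutes ((flowY p).block m₂ j₂) := fun t x =>
    ((flowY_commutes_flowX t).block m₂ j₂ x).symm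
  have hXY : (flowX p).block m₁ j₁ ((flowY p).block m₂ j₂ F₁) = 0 := by
    rw [← hc.block, hX, map_zero]
  have : (flowX p).block m₁ j₁ ((flowY p).block m₂ j₂ F) =
      (flowX p).block m₁ j₁ ((flowY p).block m₂ j₂ (F - F₁ - F₂)) := by
    rw [map_sub, map_sub, map_sub, map_sub, hXY, hY, map_zero, sub_zero, sub_zero]
  rw [this]
  have h3 := norm_block_le (flowX p) h₁ ((flowY p).block m₂ j₂ (F - F₁ - F₂))
  have h4 := norm_block_le (flowY p) h₂ (F - F₁ - F₂)
  linarith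

end AngularApproximation

section WeightedSums

theorem sum_dyadic_le {a : ℝ} (ha : 0 < a) {φ : ℕ → ℝ} (hφ : Antitone φ) (hφ0 : ∀ k, 0 ≤ φ k)
    (k : ℕ) : ∑ j ∈ Finset.range (k + 2), ((8 : ℝ) ^ j) ^ a * φ (scaleDeg (j - 1)) ≤
      64 ^ a * 8 / 7 * (2 * φ 0 +
        ∑ ν ∈ (Finset.Ico 1 (8 ^ k) : Finset ℕ), (ν : ℝ) ^ (a - 1) * φ (ν - 1)) := by
  induction k with
  | zero =>
    have h1 : (1 : ℝ) ≤ 64 ^ a := Real.one_le_rpow (by norm_num) ha.le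
    have h2 : (8 : ℝ) ^ a ≤ 64 ^ a := Real.rpow_le_rpow (by norm_num) (by norm_num) ha.le
    have h3 : (0 : ℝ) ≤ φ 0 := hφ0 0
    simp only [zero_add, Finset.sum_range_succ, Finset.range_zero, Finset.sum_empty, pow_zero,
      Real.one_rpow, pow_one, Finset.Ico_self, add_zero, scaleDeg, Nat.sub_self, Nat.zero_sub,
      if_true, one_mul]
    nlinarith
  | succ k ih =>
    rw [show k + 1 + 2 = (k + 2) + 1 by ring, Finset.sum_range_succ,
      ← Finset.sum_Ico_consecutive _ (Nat.one_le_pow k 8 (by norm_num))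
        (Nat.pow_le_pow_right (by norm_num) (Nat.le_succ k))]
    have hterm : ((8 : ℝ) ^ k) ^ a / 8 ^ (k + 1) * φ (8 ^ (k + 1)) * (7 * 8 ^ k) ≤
        ∑ ν ∈ (Finset.Ico (8 ^ k) (8 ^ (k + 1)) : Finset ℕ), (ν : ℝ) ^ (a - 1) * φ (ν - 1) := by
      have hcard : ((Finset.Ico (8 ^ k) (8 ^ (k + 1)) : Finset ℕ).card : ℝ) = 7 * 8 ^ k := by
        rw [Nat.card_Ico, pow_succ, show 8 ^ k * 8 - 8 ^ k = 7 * 8 ^ k by omega]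
        push_cast
        ring
      rw [← hcard, mul_comm _ ((Finset.card _ : ℕ) : ℝ), ← nsmul_eq_mul]
      refine Finset.card_nsmul_le_sum _ _ _ fun ν hν => ?_
      obtain ⟨hν1, hν2⟩ := Finset.mem_Ico.1 hν
      have hν1' : (8 : ℝ) ^ k ≤ ν := by exact_mod_cast hν1
      have hν2' : (ν : ℝ) ≤ 8 ^ (k + 1) := by exact_mod_cast hν2.le
      have hpos : (0 : ℝ) < ν := lt_of_lt_of_le (by positivity) hν1'
      rw [Real.rpow_sub_one hpos.ne']
      refine mul_le_mul (div_le_div₀ (by positivity)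
        (Real.rpow_le_rpow (by positivity) hν1' ha.le) hpos hν2') (hφ (by omega)) (hφ0 _)
        (by positivity)
    have hs : scaleDeg (k + 2 - 1) = 8 ^ (k + 1) := by
      simp [scaleDeg]
    rw [hs]
    have heq : ((8 : ℝ) ^ (k + 2)) ^ a * φ (8 ^ (k + 1)) = 64 ^ a * 8 / 7 *
        (((8 : ℝ) ^ k) ^ a / 8 ^ (k + 1) * φ (8 ^ (k + 1)) * (7 * 8 ^ k)) := by
      rw [show (8 : ℝ) ^ (k + 2) = 64 * 8 ^ k by ring,
        Real.mul_rpow (by norm_num) (by positivity)]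
      field_simp
      ring
    rw [heq]
    have hK : (0 : ℝ) ≤ 64 ^ a * 8 / 7 := by positivity
    have := mul_le_mul_of_nonneg_left hterm hK
    linarith

theorem exists_sum_dyadic_le {a : ℝ} (ha : 0 < a) : ∃ C : ℝ, 0 < C ∧ ∀ n : ℕ, 1 ≤ n →
    ∀ φ : ℕ → ℝ, Antitone φ → (∀ k, 0 ≤ φ k) →
    ∑ j ∈ Finset.range (Nat.log 8 n + 1), ((8 : ℝ) ^ j / 8 ^ Nat.log 8 n) ^ a *
      φ (scaleDeg (j - 1)) ≤
    C * ((n : ℝ) ^ (-a) * ∑ ν ∈ Finset.Icc 1 (n + 1), (ν : ℝ) ^ (a - 1) * φ (ν - 1)) := by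
  refine ⟨8 ^ a * (3 * (64 ^ a * 8 / 7)), by positivity, fun n hn φ hφ hφ0 => ?_⟩
  set m := Nat.log 8 n with hm
  have hm1 : 8 ^ m ≤ n := Nat.pow_log_le_self 8 (by omega)
  have hm2 : n < 8 ^ (m + 1) := Nat.lt_pow_succ_log_self (by norm_num) n
  have hn0 : (0 : ℝ) < n := by exact_mod_cast hn
  set W := ∑ ν ∈ Finset.Icc 1 (n + 1), (ν : ℝ) ^ (a - 1) * φ (ν - 1) with hW
  have hnn : ∀ ν ∈ Finset.Icc 1 (n + 1), 0 ≤ (ν : ℝ) ^ (a - 1) * φ (ν - 1) := fun ν _ =>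
    mul_nonneg (by positivity) (hφ0 _)
  have h1 : φ 0 ≤ W := by
    have := Finset.single_le_sum hnn (Finset.mem_Icc.2 ⟨le_rfl, by omega⟩ : 1 ∈ Finset.Icc 1 (n + 1))
    simpa using this
  have h2 : ∑ ν ∈ (Finset.Ico 1 (8 ^ (m - 1)) : Finset ℕ), (ν : ℝ) ^ (a - 1) * φ (ν - 1) ≤ W := by
    refine Finset.sum_le_sum_of_subset_of_nonneg (fun ν hν => ?_) fun ν h _ => hnn ν h
    have : 8 ^ (m - 1) ≤ 8 ^ m := Nat.pow_le_pow_right (by norm_num) (Nat.sub_le m 1)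
    rw [Finset.mem_Ico] at hν
    rw [Finset.mem_Icc]
    omega
  have h3 : ∑ j ∈ Finset.range (m + 1), ((8 : ℝ) ^ j) ^ a * φ (scaleDeg (j - 1)) ≤
      3 * (64 ^ a * 8 / 7) * W := by
    refine (Finset.sum_le_sum_of_subset_of_nonneg (Finset.range_mono (show m + 1 ≤ m - 1 + 2 by
      omega)) fun j _ _ => mul_nonneg (by positivity) (hφ0 _)).trans
      ((sum_dyadic_le ha hφ hφ0 (m - 1)).trans ?_)
    have hK : (0 : ℝ) ≤ 64 ^ a * 8 / 7 := by positivity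
    nlinarith
  have h4 : (((8 : ℝ) ^ m) ^ a)⁻¹ ≤ 8 ^ a * (n : ℝ) ^ (-a) := by
    rw [Real.rpow_neg hn0.le, ← div_eq_mul_inv, ← Real.div_rpow (by norm_num) hn0.le,
      ← Real.inv_rpow (by positivity)]
    refine Real.rpow_le_rpow (by positivity) ?_ ha.le
    rw [inv_le_iff_one_le_mul₀ (by positivity), div_mul_eq_mul_div, le_div_iff₀ hn0, one_mul]
    have : (n : ℝ) ≤ 8 ^ (m + 1) := by exact_mod_cast hm2.le
    rwa [pow_succ, mul_comm] at this
  have h5 : ∑ j ∈ Finset.range (m + 1), ((8 : ℝ) ^ j / 8 ^ m) ^ a * φ (scaleDeg (j - 1)) =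
      (((8 : ℝ) ^ m) ^ a)⁻¹ *
        ∑ j ∈ Finset.range (m + 1), ((8 : ℝ) ^ j) ^ a * φ (scaleDeg (j - 1)) := by
    rw [Finset.mul_sum]
    refine Finset.sum_congr rfl fun j _ => ?_
    rw [Real.div_rpow (by positivity) (by positivity)]
    ring
  rw [h5]
  have hW0 : 0 ≤ W := Finset.sum_nonneg hnn
  calc _ ≤ (8 ^ a * (n : ℝ) ^ (-a)) * (3 * (64 ^ a * 8 / 7) * W) :=
        mul_le_mul h4 h3 (Finset.sum_nonneg fun j _ => mul_nonneg (by positivity) (hφ0 _))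
          (by positivity)
    _ = _ := by ring

theorem sum_le_sum_dyadic {a : ℝ} (ha : 0 < a) {φ ψ : ℕ → ℝ} (hφ0 : ∀ i, 0 ≤ φ i)
    (h : ∀ i k, scaleDeg i ≤ k → ψ k ≤ φ i) (k : ℕ) :
    ∑ ν ∈ (Finset.Ico 1 (8 ^ k + 1) : Finset ℕ), (ν : ℝ) ^ (a - 1) * ψ (ν - 1) ≤
      φ 0 + 7 * 8 ^ a * ∑ i ∈ Finset.range k, ((8 : ℝ) ^ i) ^ a * φ i := by
  induction k with
  | zero => simpa [Finset.sum_Ico_succ_top] using h 0 0 le_rfl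
  | succ k ih =>
    rw [← Finset.sum_Ico_consecutive _ (Nat.le_add_left 1 (8 ^ k))
      (Nat.add_le_add_right (Nat.pow_le_pow_right (by norm_num) (Nat.le_succ k)) 1),
      Finset.sum_range_succ]
    have hterm : ∑ ν ∈ (Finset.Ico (8 ^ k + 1) (8 ^ (k + 1) + 1) : Finset ℕ), (ν : ℝ) ^ (a - 1) * ψ (ν - 1) ≤
        (7 * 8 ^ k) * (((8 : ℝ) ^ (k + 1)) ^ a / 8 ^ k * φ k) := by
      have hcard : ((Finset.Ico (8 ^ k + 1) (8 ^ (k + 1) + 1) : Finset ℕ).card : ℝ) = 7 * 8 ^ k := by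
        rw [Nat.card_Ico, pow_succ, show 8 ^ k * 8 + 1 - (8 ^ k + 1) = 7 * 8 ^ k by omega]
        push_cast
        ring
      rw [← hcard, ← nsmul_eq_mul]
      refine Finset.sum_le_card_nsmul _ _ _ fun ν hν => ?_
      obtain ⟨hν1, hν2⟩ := Finset.mem_Ico.1 hν
      have hν1' : (8 : ℝ) ^ k ≤ ν := by exact_mod_cast (by omega : 8 ^ k ≤ ν)
      have hν2' : (ν : ℝ) ≤ 8 ^ (k + 1) := by exact_mod_cast (by omega : ν ≤ 8 ^ (k + 1))
      have hpos : (0 : ℝ) < ν := lt_of_lt_of_le (by positivity) hν1'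
      have hdeg : scaleDeg k ≤ ν - 1 := by
        rw [scaleDeg]
        split_ifs <;> omega
      rw [Real.rpow_sub_one hpos.ne']
      refine (mul_le_mul_of_nonneg_left (h k _ hdeg) (by positivity)).trans
        (mul_le_mul_of_nonneg_right ?_ (hφ0 k))
      exact div_le_div₀ (by positivity) (Real.rpow_le_rpow hpos.le hν2' ha.le) (by positivity) hν1'
    have heq : (7 * 8 ^ k) * (((8 : ℝ) ^ (k + 1)) ^ a / 8 ^ k * φ k) =
        7 * 8 ^ a * (((8 : ℝ) ^ k) ^ a * φ k) := by
      rw [pow_succ, Real.mul_rpow (by positivity) (by norm_num)]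
      field_simp
    rw [heq] at hterm
    linarith

theorem exists_sum_le_sum_dyadic {a κ : ℝ} (ha : 0 < a) (hκ : 8 ≤ κ) : ∃ C : ℝ, 0 < C ∧
    ∀ n m : ℕ, 1 ≤ n → κ ≤ (8 : ℝ) ^ m * (1 / n) → (8 : ℝ) ^ m * (1 / n) ≤ 8 * κ →
    ∀ φ ψ : ℕ → ℝ, (∀ i, 0 ≤ φ i) → (∀ k, 0 ≤ ψ k) → (∀ i k, scaleDeg i ≤ k → ψ k ≤ φ i) →
    ∑ ν ∈ Finset.Icc 1 (n + 1), (ν : ℝ) ^ (a - 1) * ψ (ν - 1) ≤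
      C * ((n : ℝ) ^ a * ∑ i ∈ Finset.range (m + 1), ((8 : ℝ) ^ i / 8 ^ m) ^ a * φ i) := by
  refine ⟨(8 * κ) ^ a * (1 + 7 * 8 ^ a), by positivity, fun n m hn h1 h2 φ ψ hφ0 hψ0 h => ?_⟩
  have hn0 : (0 : ℝ) < n := by exact_mod_cast hn
  rw [mul_one_div, le_div_iff₀ hn0] at h1
  rw [mul_one_div, div_le_iff₀ hn0] at h2
  have hnm : n + 1 ≤ 8 ^ m := by
    have h3 : (8 : ℝ) * n ≤ 8 ^ m := (mul_le_mul_of_nonneg_right hκ hn0.le).trans h1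
    have h4 : 8 * n ≤ 8 ^ m := by exact_mod_cast h3
    omega
  have hnn : ∀ i, 0 ≤ ((8 : ℝ) ^ i) ^ a * φ i := fun i => mul_nonneg (by positivity) (hφ0 i)
  set S := ∑ i ∈ Finset.range (m + 1), ((8 : ℝ) ^ i) ^ a * φ i with hS
  have h3 : ∑ ν ∈ Finset.Icc 1 (n + 1), (ν : ℝ) ^ (a - 1) * ψ (ν - 1) ≤ (1 + 7 * 8 ^ a) * S := by
    have hsub : ∑ ν ∈ Finset.Icc 1 (n + 1), (ν : ℝ) ^ (a - 1) * ψ (ν - 1) ≤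
        ∑ ν ∈ (Finset.Ico 1 (8 ^ m + 1) : Finset ℕ), (ν : ℝ) ^ (a - 1) * ψ (ν - 1) := by
      refine Finset.sum_le_sum_of_subset_of_nonneg (fun ν hν => ?_) fun ν _ _ =>
        mul_nonneg (by positivity) (hψ0 _)
      rw [Finset.mem_Icc] at hν
      rw [Finset.mem_Ico]
      omega
    have h0 : φ 0 ≤ S := by
      have := Finset.single_le_sum (f := fun i => ((8 : ℝ) ^ i) ^ a * φ i) (fun i _ => hnn i)
        (Finset.mem_range.2 (Nat.succ_pos m))
      simpa using this
    have hS' : ∑ i ∈ Finset.range m, ((8 : ℝ) ^ i) ^ a * φ i ≤ S :=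
      Finset.sum_le_sum_of_subset_of_nonneg (Finset.range_mono (Nat.le_succ m))
        fun i _ _ => hnn i
    have h8 : (0 : ℝ) ≤ 7 * 8 ^ a := by positivity
    have := sum_le_sum_dyadic ha hφ0 h m
    nlinarith
  have h5 : ∑ i ∈ Finset.range (m + 1), ((8 : ℝ) ^ i / 8 ^ m) ^ a * φ i =
      (((8 : ℝ) ^ m) ^ a)⁻¹ * S := by
    rw [hS, Finset.mul_sum]
    refine Finset.sum_congr rfl fun j _ => ?_
    rw [Real.div_rpow (by positivity) (by positivity)]
    ring
  have h6 : ((8 : ℝ) ^ m) ^ a ≤ (8 * κ) ^ a * (n : ℝ) ^ a := by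
    rw [← Real.mul_rpow (by positivity) hn0.le]
    exact Real.rpow_le_rpow (by positivity) h2 ha.le
  have hS0 : 0 ≤ S := Finset.sum_nonneg fun i _ => hnn i
  have h7 : (1 : ℝ) ≤ (8 * κ) ^ a * (n : ℝ) ^ a * (((8 : ℝ) ^ m) ^ a)⁻¹ := by
    rwa [← div_eq_mul_inv, one_le_div (by positivity)]
  rw [h5]
  refine h3.trans ?_
  calc (1 + 7 * 8 ^ a) * S = 1 * ((1 + 7 * 8 ^ a) * S) := (one_mul _).symm
    _ ≤ ((8 * κ) ^ a * (n : ℝ) ^ a * (((8 : ℝ) ^ m) ^ a)⁻¹) * ((1 + 7 * 8 ^ a) * S) :=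
        mul_le_mul_of_nonneg_right h7 (by positivity)
    _ = _ := by ring

end WeightedSums

section AngularApproximation

variable {p : ℝ} {f : ℝ → ℝ → ℝ}

theorem exists_sum_block_le {a₁ a₂ : ℝ} (ha₁ : 0 < a₁) (ha₂ : 0 < a₂) : ∃ C : ℝ, 0 < C ∧
    ∀ n₁ n₂ : ℕ, 1 ≤ n₁ → 1 ≤ n₂ → ∀ φ : ℕ → ℕ → ℝ, (∀ i, Antitone (φ i)) →
    (∀ k, Antitone fun i => φ i k) → (∀ i k, 0 ≤ φ i k) →
    ∑ j₁ ∈ Finset.range (Nat.log 8 n₁ + 1), ∑ j₂ ∈ Finset.range (Nat.log 8 n₂ + 1),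
      ((8 : ℝ) ^ j₁ / 8 ^ Nat.log 8 n₁) ^ a₁ * (((8 : ℝ) ^ j₂ / 8 ^ Nat.log 8 n₂) ^ a₂ *
        φ (scaleDeg (j₁ - 1)) (scaleDeg (j₂ - 1))) ≤
    C * ((n₁ : ℝ) ^ (-a₁) * (n₂ : ℝ) ^ (-a₂) * ∑ ν₁ ∈ Finset.Icc 1 (n₁ + 1),
      ∑ ν₂ ∈ Finset.Icc 1 (n₂ + 1), (ν₁ : ℝ) ^ (a₁ - 1) * (ν₂ : ℝ) ^ (a₂ - 1) *
        φ (ν₁ - 1) (ν₂ - 1)) := by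
  obtain ⟨C₁, hC₁, h₁⟩ := exists_sum_dyadic_le ha₁
  obtain ⟨C₂, hC₂, h₂⟩ := exists_sum_dyadic_le ha₂
  refine ⟨C₂ * C₁, mul_pos hC₂ hC₁, fun n₁ n₂ hn₁ hn₂ φ hφ₂ hφ₁ hφ0 => ?_⟩
  set Φ : ℕ → ℝ := fun k => ∑ ν₂ ∈ Finset.Icc 1 (n₂ + 1), (ν₂ : ℝ) ^ (a₂ - 1) * φ k (ν₂ - 1)
    with hΦ
  have hanti : Antitone Φ := fun k l hkl => Finset.sum_le_sum fun ν _ =>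
    mul_le_mul_of_nonneg_left (hφ₁ (ν - 1) hkl) (by positivity)
  have hnn : ∀ k, 0 ≤ Φ k := fun k => Finset.sum_nonneg fun ν _ =>
    mul_nonneg (by positivity) (hφ0 _ _)
  calc _ ≤ ∑ j₁ ∈ Finset.range (Nat.log 8 n₁ + 1), ((8 : ℝ) ^ j₁ / 8 ^ Nat.log 8 n₁) ^ a₁ *
        (C₂ * ((n₂ : ℝ) ^ (-a₂) * Φ (scaleDeg (j₁ - 1)))) := by
        refine Finset.sum_le_sum fun j₁ _ => ?_
        rw [← Finset.mul_sum]
        exact mul_le_mul_of_nonneg_left (h₂ n₂ hn₂ _ (hφ₂ _) (hφ0 _)) (by positivity)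
    _ = C₂ * (n₂ : ℝ) ^ (-a₂) * ∑ j₁ ∈ Finset.range (Nat.log 8 n₁ + 1),
        ((8 : ℝ) ^ j₁ / 8 ^ Nat.log 8 n₁) ^ a₁ * Φ (scaleDeg (j₁ - 1)) := by
        rw [Finset.mul_sum]
        exact Finset.sum_congr rfl fun _ _ => by ring
    _ ≤ C₂ * (n₂ : ℝ) ^ (-a₂) * (C₁ * ((n₁ : ℝ) ^ (-a₁) *
        ∑ ν₁ ∈ Finset.Icc 1 (n₁ + 1), (ν₁ : ℝ) ^ (a₁ - 1) * Φ (ν₁ - 1))) :=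
        mul_le_mul_of_nonneg_left (h₁ n₁ hn₁ Φ hanti hnn) (by positivity)
    _ = _ := by
        simp only [hΦ, Finset.mul_sum]
        exact Finset.sum_congr rfl fun _ _ => Finset.sum_congr rfl fun _ _ => by ring

theorem exists_sum_le_sum_scale {a₁ a₂ κ₁ κ₂ : ℝ} (ha₁ : 0 < a₁) (ha₂ : 0 < a₂) (hκ₁ : 8 ≤ κ₁)
    (hκ₂ : 8 ≤ κ₂) : ∃ C : ℝ, 0 < C ∧ ∀ n₁ n₂ m₁ m₂ : ℕ, 1 ≤ n₁ → 1 ≤ n₂ →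
    κ₁ ≤ (8 : ℝ) ^ m₁ * (1 / n₁) → (8 : ℝ) ^ m₁ * (1 / n₁) ≤ 8 * κ₁ →
    κ₂ ≤ (8 : ℝ) ^ m₂ * (1 / n₂) → (8 : ℝ) ^ m₂ * (1 / n₂) ≤ 8 * κ₂ →
    ∀ φ ψ : ℕ → ℕ → ℝ, (∀ i j, 0 ≤ φ i j) → (∀ k l, 0 ≤ ψ k l) →
    (∀ i j k l, scaleDeg i ≤ k → scaleDeg j ≤ l → ψ k l ≤ φ i j) →
    ∑ ν₁ ∈ Finset.Icc 1 (n₁ + 1), ∑ ν₂ ∈ Finset.Icc 1 (n₂ + 1),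
      (ν₁ : ℝ) ^ (a₁ - 1) * (ν₂ : ℝ) ^ (a₂ - 1) * ψ (ν₁ - 1) (ν₂ - 1) ≤
    C * ((n₁ : ℝ) ^ a₁ * (n₂ : ℝ) ^ a₂ * ∑ i₁ ∈ Finset.range (m₁ + 1),
      ∑ i₂ ∈ Finset.range (m₂ + 1), ((8 : ℝ) ^ i₁ / 8 ^ m₁) ^ a₁ *
        (((8 : ℝ) ^ i₂ / 8 ^ m₂) ^ a₂ * φ i₁ i₂)) := by
  obtain ⟨C₁, hC₁, h₁⟩ := exists_sum_le_sum_dyadic ha₁ hκ₁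
  obtain ⟨C₂, hC₂, h₂⟩ := exists_sum_le_sum_dyadic ha₂ hκ₂
  refine ⟨C₁ * C₂, mul_pos hC₁ hC₂, fun n₁ n₂ m₁ m₂ hn₁ hn₂ hl₁ hu₁ hl₂ hu₂ φ ψ hφ hψ h => ?_⟩
  set Φ : ℕ → ℝ := fun i => C₂ * ((n₂ : ℝ) ^ a₂ *
    ∑ i₂ ∈ Finset.range (m₂ + 1), ((8 : ℝ) ^ i₂ / 8 ^ m₂) ^ a₂ * φ i i₂) with hΦ
  set Ψ : ℕ → ℝ := fun k => ∑ ν₂ ∈ Finset.Icc 1 (n₂ + 1), (ν₂ : ℝ) ^ (a₂ - 1) * ψ k (ν₂ - 1)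
    with hΨ
  have hΦ0 : ∀ i, 0 ≤ Φ i := fun i => mul_nonneg hC₂.le (mul_nonneg (by positivity)
    (Finset.sum_nonneg fun j _ => mul_nonneg (by positivity) (hφ _ _)))
  have hΨ0 : ∀ k, 0 ≤ Ψ k := fun k => Finset.sum_nonneg fun ν _ =>
    mul_nonneg (by positivity) (hψ _ _)
  have hle : ∀ i k, scaleDeg i ≤ k → Ψ k ≤ Φ i := fun i k hik =>
    h₂ n₂ m₂ hn₂ hl₂ hu₂ (φ i) (ψ k) (hφ i) (hψ k) fun j l hjl => h i j k l hik hjl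
  calc _ = ∑ ν₁ ∈ Finset.Icc 1 (n₁ + 1), (ν₁ : ℝ) ^ (a₁ - 1) * Ψ (ν₁ - 1) := by
        simp only [hΨ, Finset.mul_sum, mul_assoc]
    _ ≤ C₁ * ((n₁ : ℝ) ^ a₁ *
        ∑ i ∈ Finset.range (m₁ + 1), ((8 : ℝ) ^ i / 8 ^ m₁) ^ a₁ * Φ i) :=
        h₁ n₁ m₁ hn₁ hl₁ hu₁ Φ Ψ hΦ0 hΨ0 hle
    _ = _ := by
        simp only [hΦ, Finset.mul_sum]
        exact Finset.sum_congr rfl fun _ _ => Finset.sum_congr rfl fun _ _ => by ring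

theorem exists_pow_mul_one_div_mem {κ : ℝ} (hκ : 8 ≤ κ) {n : ℕ} (hn : 1 ≤ n) :
    ∃ m : ℕ, 1 ≤ m ∧ κ ≤ (8 : ℝ) ^ m * (1 / n) ∧ (8 : ℝ) ^ m * (1 / n) ≤ 8 * κ := by
  have hn1 : (1 : ℝ) ≤ n := by exact_mod_cast hn
  have hn0 : (0 : ℝ) < n := by linarith
  obtain ⟨k, hk1, hk2⟩ := exists_nat_pow_near (x := κ * n) (y := 8) (by nlinarith) (by norm_num)
  refine ⟨k + 1, Nat.le_add_left 1 k, ?_, ?_⟩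
  · rw [mul_one_div, le_div_iff₀ hn0]
    exact hk2.le
  · rw [mul_one_div, div_le_iff₀ hn0, pow_succ]
    linarith

theorem Yapprox_ne_top [Fact (1 ≤ ENNReal.ofReal p)] (hp : 0 < p) (hf : MemLp0 p f)
    {F : Lp ℝ (ENNReal.ofReal p) (volume : Measure Torus)} (h : Represents f F) (k l : ℕ) :
    Yapprox p k l f ≠ ⊤ :=
  ne_top_of_le_ne_top ENNReal.ofReal_ne_top
    (h.Yapprox_le hp hf.meas (i₁ := 0) (i₂ := 0) (Nat.zero_le _) (Nat.zero_le _))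

theorem Ysum_eq_ofReal {α₁ α₂ s : ℝ} (hs : 0 < s) (hY : ∀ k l, Yapprox p k l f ≠ ⊤)
    (n₁ n₂ : ℕ) : Ysum p α₁ α₂ s n₁ n₂ f = ENNReal.ofReal ((n₁ : ℝ) ^ (-α₁) * (n₂ : ℝ) ^ (-α₂) *
      (∑ ν₁ ∈ Finset.Icc 1 (n₁ + 1), ∑ ν₂ ∈ Finset.Icc 1 (n₂ + 1),
        (ν₁ : ℝ) ^ (α₁ * s - 1) * (ν₂ : ℝ) ^ (α₂ * s - 1) *
          (Yapprox p (ν₁ - 1) (ν₂ - 1) f).toReal ^ s) ^ (1 / s)) := by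
  rw [Ysum, ENNReal.ofReal_mul (p := (n₁ : ℝ) ^ (-α₁) * (n₂ : ℝ) ^ (-α₂)) (by positivity)]
  congr 1
  rw [← ENNReal.ofReal_rpow_of_nonneg, ENNReal.ofReal_sum_of_nonneg]
  · congr 1
    refine Finset.sum_congr rfl fun ν₁ _ => ?_
    rw [ENNReal.ofReal_sum_of_nonneg]
    · refine Finset.sum_congr rfl fun ν₂ _ => ?_
      rw [ENNReal.ofReal_mul (p := (ν₁ : ℝ) ^ (α₁ * s - 1) * (ν₂ : ℝ) ^ (α₂ * s - 1))
          (by positivity),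
        ← ENNReal.ofReal_rpow_of_nonneg ENNReal.toReal_nonneg hs.le, ENNReal.ofReal_toReal (hY _ _)]
    · intros
      positivity
  all_goals
    intros
    positivity

theorem exists_mixedMod_le_Ysum {α₁ α₂ : ℝ} (hp : 1 < p) (hα₁ : 0 < α₁) (hα₂ : 0 < α₂) :
    ∃ C : ℝ, 0 < C ∧ ∀ (f : ℝ → ℝ → ℝ) (n₁ n₂ : ℕ), 1 ≤ n₁ → 1 ≤ n₂ → MemLp0 p f →
      mixedMod p α₁ α₂ (1 / (n₁ : ℝ)) (1 / (n₂ : ℝ)) f ≤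
        ENNReal.ofReal C * Ysum p α₁ α₂ (min 2 p) n₁ n₂ f := by
  have hp0 : 0 < p := by linarith
  have : Fact (1 ≤ ENNReal.ofReal p) := ⟨by simpa using hp.le⟩
  set θ := min 2 p with hθ
  have hθ0 : 0 < θ := lt_min (by norm_num) hp0
  obtain ⟨C, hC, hup⟩ := PeriodicFlow.exists_norm_diffOp_diffOp_le (flowY_commutes_flowX (p := p))
    (upperEstimate_translationFlow dirX continuous_dirX dirX_two_pi hp)
    (upperEstimate_translationFlow dirY continuous_dirY dirY_two_pi hp) hθ0 hα₁.le hα₂.le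
  obtain ⟨D, hD, hsum⟩ := exists_sum_block_le (mul_pos hα₁ hθ0) (mul_pos hα₂ hθ0)
  refine ⟨(C * 400000000 ^ θ * D) ^ (1 / θ), by positivity, fun f n₁ n₂ hn₁ hn₂ hf => ?_⟩
  obtain ⟨F, hF⟩ := BiPeriodic.exists_represents ⟨hf.periodic_x, hf.periodic_y⟩ hp0 hf.meas
    hf.norm_ne_top
  have hY := Yapprox_ne_top hp0 hf hF
  rw [Ysum_eq_ofReal hθ0 hY, ← ENNReal.ofReal_mul (by positivity)]
  have hy : ∀ {k₁ k₂ l₁ l₂ : ℕ}, k₁ ≤ l₁ → k₂ ≤ l₂ →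
      (Yapprox p l₁ l₂ f).toReal ^ θ ≤ (Yapprox p k₁ k₂ f).toReal ^ θ := fun h₁ h₂ =>
    Real.rpow_le_rpow ENNReal.toReal_nonneg
      (ENNReal.toReal_mono (hY _ _) (Yapprox_antitone f h₁ h₂)) hθ0.le
  have key := hsum n₁ n₂ hn₁ hn₂ (fun k l => (Yapprox p k l f).toReal ^ θ)
    (fun _ _ _ h => hy le_rfl h) (fun _ _ _ h => hy h le_rfl) fun _ _ => by positivity
  set W := ∑ ν₁ ∈ Finset.Icc 1 (n₁ + 1), ∑ ν₂ ∈ Finset.Icc 1 (n₂ + 1),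
    (ν₁ : ℝ) ^ (α₁ * θ - 1) * (ν₂ : ℝ) ^ (α₂ * θ - 1) *
      (Yapprox p (ν₁ - 1) (ν₂ - 1) f).toReal ^ θ with hW
  have hW0 : 0 ≤ W := by positivity
  refine iSup₂_le fun h₁ hh₁ => iSup₂_le fun h₂ hh₂ => ?_
  rw [hF.Lp2Norm_diffX_diffY hp0 hα₁.le hα₂.le]
  refine ENNReal.ofReal_le_ofReal ?_
  have hstep : ∀ {n : ℕ} {h : ℝ}, 1 ≤ n → |h| ≤ 1 / n → (8 : ℝ) ^ Nat.log 8 n * |h| ≤ 1 := by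
    intro n h hn hh
    have hn0 : (0 : ℝ) < n := by exact_mod_cast hn
    have h8 : (8 : ℝ) ^ Nat.log 8 n ≤ n := by exact_mod_cast Nat.pow_log_le_self 8 (by omega)
    calc (8 : ℝ) ^ Nat.log 8 n * |h| ≤ n * (1 / n) := by gcongr
      _ = 1 := by field_simp
  have hblock := hup _ _ h₁ h₂ F (hF.V_zero_flowX hf.meas hf.mean_x)
    (hF.V_zero_flowY hf.meas hf.mean_y) (hstep hn₁ hh₁) (hstep hn₂ hh₂)
  have hpow : ‖(flowX p).diffOp α₁ h₁ ((flowY p).diffOp α₂ h₂ F)‖ ^ θ ≤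
      C * 400000000 ^ θ * D * ((n₁ : ℝ) ^ (-(α₁ * θ)) * (n₂ : ℝ) ^ (-(α₂ * θ)) * W) := by
    refine hblock.trans ?_
    rw [mul_assoc _ D, mul_assoc C]
    refine mul_le_mul_of_nonneg_left ?_ hC.le
    refine le_trans ?_ (mul_le_mul_of_nonneg_left key (by positivity))
    rw [Finset.mul_sum]
    refine Finset.sum_le_sum fun j₁ hj₁ => ?_
    rw [Finset.mul_sum]
    refine Finset.sum_le_sum fun j₂ hj₂ => ?_
    have hle := hF.norm_block_block_le_Yapprox hp0 (Finset.mem_range_succ_iff.1 hj₁)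
      (Finset.mem_range_succ_iff.1 hj₂)
    rw [ENNReal.ofReal_le_iff_le_toReal (hY _ _), div_le_iff₀ (by norm_num), mul_comm _ (400000000 : ℝ)] at hle
    have hle' := Real.rpow_le_rpow (norm_nonneg _) hle hθ0.le
    rw [Real.mul_rpow (by norm_num) ENNReal.toReal_nonneg] at hle'
    calc _ ≤ _ := mul_le_mul_of_nonneg_left (mul_le_mul_of_nonneg_left hle' (by positivity))
          (by positivity)
      _ = _ := by ring
  rw [one_div, ← Real.rpow_le_rpow_iff (norm_nonneg _) (by positivity) hθ0]
  refine hpow.trans_eq ?_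
  rw [Real.mul_rpow (by positivity) (by positivity), Real.rpow_inv_rpow (by positivity) hθ0.ne',
    Real.mul_rpow (by positivity) (by positivity), Real.rpow_inv_rpow hW0 hθ0.ne',
    Real.mul_rpow (by positivity) (by positivity), ← Real.rpow_mul (by positivity),
    ← Real.rpow_mul (by positivity), neg_mul, neg_mul]

theorem exists_Ysum_le_mixedMod {α₁ α₂ : ℝ} (hp : 1 < p) (hα₁ : 0 < α₁) (hα₂ : 0 < α₂) :
    ∃ C : ℝ, 0 < C ∧ ∀ (f : ℝ → ℝ → ℝ) (n₁ n₂ : ℕ), 1 ≤ n₁ → 1 ≤ n₂ → MemLp0 p f →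
      Ysum p α₁ α₂ (max 2 p) n₁ n₂ f ≤
        ENNReal.ofReal C * mixedMod p α₁ α₂ (1 / (n₁ : ℝ)) (1 / (n₂ : ℝ)) f := by
  have hp0 : 0 < p := by linarith
  have : Fact (1 ≤ ENNReal.ofReal p) := ⟨by simpa using hp.le⟩
  set σ := max 2 p with hσ
  have hσ1 : 1 ≤ σ := le_max_of_le_left (by norm_num)
  have hσ0 : 0 < σ := by linarith
  obtain ⟨κ₁, hκ₁, κ₂, hκ₂, C, hC, hlow⟩ := PeriodicFlow.exists_sum_norm_sub_V_sub_V_le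
    (flowY_commutes_flowX (p := p))
    (lowerEstimate_translationFlow dirX continuous_dirX dirX_two_pi hp)
    (lowerEstimate_translationFlow dirY continuous_dirY dirY_two_pi hp) hσ1 hα₁ hα₂
  obtain ⟨D, hD, hsum⟩ := exists_sum_le_sum_scale (mul_pos hα₁ hσ0) (mul_pos hα₂ hσ0) hκ₁ hκ₂
  refine ⟨(D * C) ^ (1 / σ), by positivity, fun f n₁ n₂ hn₁ hn₂ hf => ?_⟩
  obtain ⟨F, hF⟩ := BiPeriodic.exists_represents ⟨hf.periodic_x, hf.periodic_y⟩ hp0 hf.meas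
    hf.norm_ne_top
  have hY := Yapprox_ne_top hp0 hf hF
  rw [Ysum_eq_ofReal hσ0 hY]
  have hK : 0 < (D * C) ^ (1 / σ) := by positivity
  by_cases htop : mixedMod p α₁ α₂ (1 / (n₁ : ℝ)) (1 / (n₂ : ℝ)) f = ⊤
  · rw [htop, ENNReal.mul_top (by simpa using hK)]
    exact le_top
  set M := (mixedMod p α₁ α₂ (1 / (n₁ : ℝ)) (1 / (n₂ : ℝ)) f).toReal with hM
  have hM0 : 0 ≤ M := ENNReal.toReal_nonneg
  rw [← ENNReal.ofReal_toReal htop, ← ENNReal.ofReal_mul hK.le, ← hM]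
  refine ENNReal.ofReal_le_ofReal ?_
  have hn₁0 : (0 : ℝ) < n₁ := by exact_mod_cast hn₁
  have hn₂0 : (0 : ℝ) < n₂ := by exact_mod_cast hn₂
  obtain ⟨m₁, hm₁, hl₁, hu₁⟩ := exists_pow_mul_one_div_mem hκ₁ hn₁
  obtain ⟨m₂, hm₂, hl₂, hu₂⟩ := exists_pow_mul_one_div_mem hκ₂ hn₂
  have hmod : ∀ h₁ h₂ : ℝ, |h₁| ≤ 1 / n₁ → |h₂| ≤ 1 / n₂ →
      ‖(flowX p).diffOp α₁ h₁ ((flowY p).diffOp α₂ h₂ F)‖ ≤ M := by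
    intro h₁ h₂ hh₁ hh₂
    rw [hM, ← ENNReal.ofReal_le_iff_le_toReal htop,
      ← hF.Lp2Norm_diffX_diffY hp0 hα₁.le hα₂.le]
    exact le_iSup₂_of_le h₁ hh₁ (le_iSup₂_of_le h₂ hh₂ le_rfl)
  have hscale := hlow m₁ m₂ (1 / n₁) (1 / n₂) M F hm₁ hm₂ (by positivity) (by positivity)
    (hF.V_zero_flowX hf.meas hf.mean_x) (hF.V_zero_flowY hf.meas hf.mean_y) hl₁ hu₁ hl₂ hu₂ hmod
  have key := hsum n₁ n₂ m₁ m₂ hn₁ hn₂ hl₁ hu₁ hl₂ hu₂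
    (fun i j => ‖F - (flowY p).V j F - (flowX p).V i (F - (flowY p).V j F)‖ ^ σ)
    (fun k l => (Yapprox p k l f).toReal ^ σ) (fun _ _ => by positivity)
    (fun _ _ => by positivity) fun i j k l hik hjl =>
      Real.rpow_le_rpow ENNReal.toReal_nonneg (ENNReal.toReal_le_of_le_ofReal (norm_nonneg _)
        (hF.Yapprox_le hp0 hf.meas hik hjl)) hσ0.le
  set W := ∑ ν₁ ∈ Finset.Icc 1 (n₁ + 1), ∑ ν₂ ∈ Finset.Icc 1 (n₂ + 1),
    (ν₁ : ℝ) ^ (α₁ * σ - 1) * (ν₂ : ℝ) ^ (α₂ * σ - 1) *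
      (Yapprox p (ν₁ - 1) (ν₂ - 1) f).toReal ^ σ with hW
  have hW0 : 0 ≤ W := by positivity
  have hWle : W ≤ D * ((n₁ : ℝ) ^ (α₁ * σ) * (n₂ : ℝ) ^ (α₂ * σ) * (C * M ^ σ)) :=
    key.trans (mul_le_mul_of_nonneg_left (mul_le_mul_of_nonneg_left hscale (by positivity)) hD.le)
  rw [one_div, ← Real.rpow_le_rpow_iff (by positivity) (by positivity) hσ0,
    Real.mul_rpow (by positivity) (by positivity), Real.mul_rpow (by positivity) hM0,
    Real.rpow_inv_rpow hW0 hσ0.ne', Real.rpow_inv_rpow (by positivity) hσ0.ne',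
    Real.mul_rpow (by positivity) (by positivity), ← Real.rpow_mul hn₁0.le,
    ← Real.rpow_mul hn₂0.le, neg_mul, neg_mul, Real.rpow_neg hn₁0.le, Real.rpow_neg hn₂0.le]
  refine (mul_le_mul_of_nonneg_left hWle (by positivity)).trans_eq ?_
  field_simp

end AngularApproximation

/-- Sharp Jackson and sharp inverse inequalities (Theorem 9.1). -/
theorem sharp_jackson_and_inverse (p α₁ α₂ : ℝ) (hp : 1 < p)
    (hα₁ : 0 < α₁) (hα₂ : 0 < α₂) :
    ∃ C : ℝ, 0 < C ∧ ∀ (f : ℝ → ℝ → ℝ) (n₁ n₂ : ℕ), 1 ≤ n₁ → 1 ≤ n₂ → MemLp0 p f →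
      Ysum p α₁ α₂ (max 2 p) n₁ n₂ f ≤
          ENNReal.ofReal C * mixedMod p α₁ α₂ (1/(n₁:ℝ)) (1/(n₂:ℝ)) f ∧
      mixedMod p α₁ α₂ (1/(n₁:ℝ)) (1/(n₂:ℝ)) f ≤
          ENNReal.ofReal C * Ysum p α₁ α₂ (min 2 p) n₁ n₂ f := by
  obtain ⟨C₁, hC₁, h₁⟩ := exists_Ysum_le_mixedMod hp hα₁ hα₂
  obtain ⟨C₂, -, h₂⟩ := exists_mixedMod_le_Ysum hp hα₁ hα₂
  refine ⟨max C₁ C₂, lt_max_of_lt_left hC₁, fun f n₁ n₂ hn₁ hn₂ hf => ⟨?_, ?_⟩⟩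
  · refine (h₁ f n₁ n₂ hn₁ hn₂ hf).trans ?_
    gcongr
    exact le_max_left _ _
  · refine (h₂ f n₁ n₂ hn₁ hn₂ hf).trans ?_
    gcongr
    exact le_max_right _ _

end
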